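/- arXiv:2507.14033 — 2 statements merged into one kernel-verified Lean document; each statement's English description precedes it below -/
import Mathlib

section
/- Let x, x', y, y' be dominant elements of W such that [x,y] and [x',y'] are thick intervals. If [x,y] and [x',y'] are isomorphic as posets, then there exists a weight μ ∈ Λ such that Pgn_{x',y'} + μ = Pgn_{x,y} or Pgn_{x',y'} + μ = σ(Pgn_{x,y}), where σ denotes the linear isometry of E interchanging α1 and α2. In particular, the polygons Pgn_{x,y} and Pgn_{x',y'} are congruent. -/
noncomputable section

open scoped RealInnerProductSpace

/-- The Bruhat strict order on a Coxeter group: the transitive closure of the relation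
"multiply on the left by a reflection, increasing the length". -/
def bruhatLT {B : Type*} {W : Type*} [Group W] {M : CoxeterMatrix B}
    (cs : CoxeterSystem M W) : W → W → Prop :=
  Relation.TransGen (fun a b => (∃ t, cs.IsReflection t ∧ b = t * a) ∧ cs.length a < cs.length b)

/-- The Bruhat order on a Coxeter group. -/
def bruhatLE {B : Type*} {W : Type*} [Group W] {M : CoxeterMatrix B}
    (cs : CoxeterSystem M W) (x y : W) : Prop :=
  x = y ∨ bruhatLT cs x y

/-- The Bruhat interval `[x, y]` as a set. -/
def Iset {B : Type*} {W : Type*} [Group W] {M : CoxeterMatrix B}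
    (cs : CoxeterSystem M W) (x y : W) : Set W :=
  {z | bruhatLE cs x z ∧ bruhatLE cs z y}

/-- The Bruhat covers `U(x)` of an element `x`. -/
def Uset {B : Type*} {W : Type*} [Group W] {M : CoxeterMatrix B}
    (cs : CoxeterSystem M W) (x : W) : Set W :=
  {w | bruhatLT cs x w ∧ cs.length w = cs.length x + 1}

/-- The Bruhat cocovers `L(y)` of an element `y`. -/
def Lset {B : Type*} {W : Type*} [Group W] {M : CoxeterMatrix B}
    (cs : CoxeterSystem M W) (y : W) : Set W :=
  {w | bruhatLT cs w y ∧ cs.length y = cs.length w + 1}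

/-- An interval `[x, y]` is full if it contains all Bruhat covers of `x` and all
Bruhat cocovers of `y`. -/
def FullInt {B : Type*} {W : Type*} [Group W] {M : CoxeterMatrix B}
    (cs : CoxeterSystem M W) (x y : W) : Prop :=
  Uset cs x ⊆ Iset cs x y ∧ Lset cs y ⊆ Iset cs x y

/-- Two Bruhat intervals (possibly in different Coxeter groups) are isomorphic as posets. -/
def IntervalIso {B : Type*} {W : Type*} {B' : Type*} {W' : Type*} [Group W] [Group W']
    {M : CoxeterMatrix B} {M' : CoxeterMatrix B'}
    (cs : CoxeterSystem M W) (cs' : CoxeterSystem M' W') (x y : W) (x' y' : W') : Prop :=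
  ∃ f : {z : W // bruhatLE cs x z ∧ bruhatLE cs z y} ≃
        {z : W' // bruhatLE cs' x' z ∧ bruhatLE cs' z y'},
    ∀ u v, bruhatLE cs u.1 v.1 ↔ bruhatLE cs' (f u).1 (f v).1

/-- The group `G` of generic automorphisms: the subgroup of the permutation group of `W`
generated by the Dynkin diagram automorphisms `δ`, `σ` and inversion. -/
def Gsub {W : Type*} [Group W] (dl sg : W ≃* W) : Subgroup (Equiv.Perm W) :=
  Subgroup.closure {dl.toEquiv, sg.toEquiv, Equiv.inv W}

/-- The Euclidean plane, with coordinates taken in the basis of simple roots of `A₂`. -/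
abbrev E2 : Type := ℝ × ℝ

/-- The `A₂` inner product on the plane, in which `(αᵢ, αᵢ) = 2` and `(α₁, α₂) = -1`. -/
def B2 (u v : E2) : ℝ := 2*u.1*v.1 - u.1*v.2 - u.2*v.1 + 2*u.2*v.2

/-- The simple root `α₁`. -/
def a1 : E2 := (1, 0)
/-- The simple root `α₂`. -/
def a2 : E2 := (0, 1)
/-- The fundamental weight `ϖ₁`, satisfying `(αᵢ, ϖⱼ) = δᵢⱼ`. -/
def fw1 : E2 := (2/3, 1/3)
/-- The fundamental weight `ϖ₂`. -/
def fw2 : E2 := (1/3, 2/3)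
/-- `ρ = ϖ₁ + ϖ₂ = α₁ + α₂`. -/
def rho2 : E2 := (1, 1)

/-- The affine reflection `s_{α,k}` of the plane in the line `{v | (α, v) = k}`,
for a root `α` with `(α, α) = 2`. -/
def reflE (a : E2) (k : ℝ) (v : E2) : E2 := v - (B2 a v - k) • a

/-- The barycenter of the alcove of `z`, i.e. the image under the affine action of `z` of
the barycenter `-ρ/3` of the fundamental alcove (whose vertices are `0, -ϖ₁, -ϖ₂`). -/
def cen {W : Type*} [Group W] (act : W →* Equiv.Perm E2) (z : W) : E2 :=
  act z ((-(1/3 : ℝ)) • rho2)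

/-- The weight lattice `Λ = ℤϖ₁ ⊕ ℤϖ₂`. -/
def wLat : Set E2 := {v | ∃ a b : ℤ, v = (a : ℝ) • fw1 + (b : ℝ) • fw2}

/-- The fundamental alcove `A₊`. -/
def AlcoveFund : Set E2 :=
  {v | (-1 < B2 a1 v ∧ B2 a1 v < 0) ∧ (-1 < B2 a2 v ∧ B2 a2 v < 0) ∧
    (-1 < B2 rho2 v ∧ B2 rho2 v < 0)}

/-- The zone `F_id` of the plane. -/
def Fid : Set E2 := {v | -1 ≤ B2 a1 v ∧ -1 ≤ B2 a2 v ∧ -1 ≤ B2 rho2 v}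

/-- The cone `K` of nonnegative combinations of the simple roots. -/
def coneK : Set E2 := {v | ∃ a b : ℝ, 0 ≤ a ∧ 0 ≤ b ∧ v = a • a1 + b • a2}

/-- The set `D` of dominant elements, given functions `θ, θˢ` enumerating them. -/
def Dset {W : Type*} (th ths : ℕ → ℕ → W) : Set W :=
  {w | (∃ m n, w = th m n) ∨ (∃ m n, w = ths m n)}

/-- The polygon `Pgn_{x,y} = F_id ∩ (cen x + K) ∩ (cen y - K)`. -/
def Pgn {W : Type*} [Group W] (act : W →* Equiv.Perm E2) (x y : W) : Set E2 :=
  {v ∈ Fid | (∃ k ∈ coneK, v = cen act x + k) ∧ (∃ k ∈ coneK, v = cen act y - k)}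

/-- The element `x_k`: the product of the first `k` terms of `s₁, s₂, s₀, s₁, s₂, s₀, …`. -/
def xelt {W : Type*} [Group W] {M : CoxeterMatrix (Fin 3)} (cs : CoxeterSystem M W)
    (k : ℕ) : W :=
  ((List.range k).map (fun j => cs.simple (⟨(j + 1) % 3, Nat.mod_lt _ (by norm_num)⟩ : Fin 3))).prod

/-- `zoneOf cs w v` says that `w` is one of the six elements of `W_f` and `v` lies in the
corresponding zone `F_w` of the plane. -/
def zoneOf {W : Type*} [Group W] {M : CoxeterMatrix (Fin 3)} (cs : CoxeterSystem M W)
    (w : W) (v : E2) : Prop :=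
  (w = 1 ∧ v ∈ Fid) ∨
  (w = cs.simple 1 ∧ B2 a1 v ≤ -1 ∧ -1 ≤ B2 rho2 v) ∨
  (w = cs.simple 2 ∧ B2 a2 v ≤ -1 ∧ -1 ≤ B2 rho2 v) ∨
  (w = cs.simple 1 * cs.simple 2 ∧ B2 rho2 v ≤ -1 ∧ 0 ≤ B2 a2 v) ∨
  (w = cs.simple 2 * cs.simple 1 ∧ B2 rho2 v ≤ -1 ∧ 0 ≤ B2 a1 v) ∨
  (w = cs.simple 1 * cs.simple 2 * cs.simple 1 ∧ B2 a1 v ≤ 0 ∧ B2 a2 v ≤ 0)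

/-- Thickness of the interval `[x,y]`: `x + 2αᵢ` and `y - 2αᵢ` belong to `[x,y]` and their
barycenters lie in `F_id`, for `i = 1, 2`. -/
def Thick {W : Type*} [Group W] {M : CoxeterMatrix (Fin 3)} (cs : CoxeterSystem M W)
    (act : W →* Equiv.Perm E2) (Wadd : W → E2 → W) (x y : W) : Prop :=
  Wadd x ((2 : ℝ) • a1) ∈ Iset cs x y ∧ Wadd x ((2 : ℝ) • a2) ∈ Iset cs x y ∧
  Wadd y (-((2 : ℝ) • a1)) ∈ Iset cs x y ∧ Wadd y (-((2 : ℝ) • a2)) ∈ Iset cs x y ∧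
  cen act (Wadd x ((2 : ℝ) • a1)) ∈ Fid ∧ cen act (Wadd x ((2 : ℝ) • a2)) ∈ Fid ∧
  cen act (Wadd y (-((2 : ℝ) • a1))) ∈ Fid ∧ cen act (Wadd y (-((2 : ℝ) • a2))) ∈ Fid

/-- An integer triple `(I, J, K)`; the alcoves are the triples with `K = I + J` or
`K = I + J - 1`, the coordinates being the rounded up values of the three positive roots. -/
@[ext] structure Alc where
  I : ℤ
  J : ℤ
  K : ℤ

namespace Alc

/-- The triple comes from an alcove. -/
def V (z : Alc) : Prop := z.K = z.I + z.J ∨ z.K = z.I + z.J - 1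

/-- The length of an alcove, i.e. the number of walls separating it from the fundamental one. -/
def L (z : Alc) : ℤ := |z.I| + |z.J| + |z.K|

/-- Reflection in `H_{α₁,m}`. -/
def t1 (m : ℤ) (z : Alc) : Alc := ⟨2 * m + 1 - z.I, z.K - m, z.J + m⟩
/-- Reflection in `H_{α₂,m}`. -/
def t2 (m : ℤ) (z : Alc) : Alc := ⟨z.K - m, 2 * m + 1 - z.J, z.I + m⟩
/-- Reflection in `H_{ρ,m}`. -/
def t3 (m : ℤ) (z : Alc) : Alc := ⟨m + 1 - z.J, m + 1 - z.I, 2 * m + 1 - z.K⟩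

/-- The two alcoves are exchanged by an affine reflection. -/
def Rfl (z w : Alc) : Prop := (∃ m, w = t1 m z) ∨ (∃ m, w = t2 m z) ∨ ∃ m, w = t3 m z

/-- An edge of the Bruhat graph. -/
def Edge (z w : Alc) : Prop := z.V ∧ Rfl z w ∧ z.L < w.L

/-- The Bruhat order. -/
def Le (z w : Alc) : Prop := Relation.ReflTransGen Edge z w

/-- The simple reflections. -/
def s (i : Fin 3) (z : Alc) : Alc := ![t3 (-1) z, t1 0 z, t2 0 z] i

theorem Rfl.symm {z w : Alc} (h : Rfl z w) : Rfl w z := by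
  rcases h with ⟨m, rfl⟩ | ⟨m, rfl⟩ | ⟨m, rfl⟩
  · exact Or.inl ⟨m, by ext <;> simp [t1]⟩
  · exact Or.inr (Or.inl ⟨m, by ext <;> simp [t2]⟩)
  · exact Or.inr (Or.inr ⟨m, by ext <;> simp [t3]⟩)

theorem Rfl.valid {z w : Alc} (h : Rfl z w) (hz : z.V) : w.V := by
  rcases h with ⟨m, rfl⟩ | ⟨m, rfl⟩ | ⟨m, rfl⟩ <;> simp only [V, t1, t2, t3] at * <;> omega

theorem L_lt_t1 {z : Alc} (hz : z.V) (m : ℤ) :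
    z.L < (t1 m z).L ↔ (0 ≤ m ∧ z.I ≤ m) ∨ (m < 0 ∧ m < z.I) := by
  obtain ⟨I, J, K⟩ := z
  simp only [V, L, t1] at *
  rcases hz with rfl | rfl <;> rcases abs_cases I with ⟨e1, _⟩ | ⟨e1, _⟩ <;>
    rcases abs_cases J with ⟨e2, _⟩ | ⟨e2, _⟩ <;> rw [e1, e2] <;> simp only [abs_eq_max_neg] <;> omega

theorem L_lt_t2 {z : Alc} (hz : z.V) (m : ℤ) :
    z.L < (t2 m z).L ↔ (0 ≤ m ∧ z.J ≤ m) ∨ (m < 0 ∧ m < z.J) := by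
  obtain ⟨I, J, K⟩ := z
  simp only [V, L, t2] at *
  rcases hz with rfl | rfl <;> rcases abs_cases I with ⟨e1, _⟩ | ⟨e1, _⟩ <;>
    rcases abs_cases J with ⟨e2, _⟩ | ⟨e2, _⟩ <;> rw [e1, e2] <;> simp only [abs_eq_max_neg] <;> omega

theorem L_lt_t3 {z : Alc} (hz : z.V) (m : ℤ) :
    z.L < (t3 m z).L ↔ (0 ≤ m ∧ z.K ≤ m) ∨ (m < 0 ∧ m < z.K) := by
  obtain ⟨I, J, K⟩ := z
  simp only [V, L, t3] at *
  rcases hz with rfl | rfl <;> rcases abs_cases I with ⟨e1, _⟩ | ⟨e1, _⟩ <;>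
    rcases abs_cases J with ⟨e2, _⟩ | ⟨e2, _⟩ <;> rw [e1, e2] <;> simp only [abs_eq_max_neg] <;> omega

/-- The oriented form of `Edge`: the reflecting wall does not separate `z` from the
fundamental alcove. -/
theorem edge_iff {z w : Alc} : Edge z w ↔ z.V ∧
    ((∃ m, w = t1 m z ∧ ((0 ≤ m ∧ z.I ≤ m) ∨ (m < 0 ∧ m < z.I))) ∨
     (∃ m, w = t2 m z ∧ ((0 ≤ m ∧ z.J ≤ m) ∨ (m < 0 ∧ m < z.J))) ∨
     (∃ m, w = t3 m z ∧ ((0 ≤ m ∧ z.K ≤ m) ∨ (m < 0 ∧ m < z.K)))) := by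
  constructor
  · rintro ⟨hz, ⟨m, rfl⟩ | ⟨m, rfl⟩ | ⟨m, rfl⟩, h⟩
    · exact ⟨hz, Or.inl ⟨m, rfl, (L_lt_t1 hz m).1 h⟩⟩
    · exact ⟨hz, Or.inr (Or.inl ⟨m, rfl, (L_lt_t2 hz m).1 h⟩)⟩
    · exact ⟨hz, Or.inr (Or.inr ⟨m, rfl, (L_lt_t3 hz m).1 h⟩)⟩
  · rintro ⟨hz, ⟨m, rfl, h⟩ | ⟨m, rfl, h⟩ | ⟨m, rfl, h⟩⟩
    · exact ⟨hz, Or.inl ⟨m, rfl⟩, (L_lt_t1 hz m).2 h⟩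
    · exact ⟨hz, Or.inr (Or.inl ⟨m, rfl⟩), (L_lt_t2 hz m).2 h⟩
    · exact ⟨hz, Or.inr (Or.inr ⟨m, rfl⟩), (L_lt_t3 hz m).2 h⟩

theorem s_rfl (i : Fin 3) (z : Alc) : Rfl z (s i z) := by
  fin_cases i
  · exact Or.inr (Or.inr ⟨-1, rfl⟩)
  · exact Or.inl ⟨0, rfl⟩
  · exact Or.inr (Or.inl ⟨0, rfl⟩)

theorem V.s {z : Alc} (hz : z.V) (i : Fin 3) : (s i z).V := (s_rfl i z).valid hz

@[simp] theorem s_s (i : Fin 3) (z : Alc) : s i (s i z) = z := by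
  fin_cases i <;> ext <;> simp [s, t1, t2, t3]

theorem L_s {z : Alc} (hz : z.V) (i : Fin 3) : (s i z).L = z.L + 1 ∨ (s i z).L = z.L - 1 := by
  obtain ⟨I, J, K⟩ := z
  fin_cases i <;> simp [V, L, s, t1, t2, t3, abs_eq_max_neg] at * <;> omega

theorem L_nonneg (z : Alc) : 0 ≤ z.L := by unfold L; positivity

/-- Every alcove but the fundamental one has a descent. -/
theorem exists_descent {z : Alc} (hz : z.V) (h : z.L ≠ 0) : ∃ i, (s i z).L < z.L := by
  by_contra! hc
  have k0 := hc 0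
  have k1 := hc 1
  have k2 := hc 2
  obtain ⟨I, J, K⟩ := z
  simp [V, L, s, t1, t2, t3, abs_eq_max_neg] at *
  omega

theorem L_eq_zero {z : Alc} (h : z.L = 0) : z = ⟨0, 0, 0⟩ := by
  simp only [L] at h
  have := abs_nonneg z.I
  have := abs_nonneg z.J
  have := abs_nonneg z.K
  ext <;> simp <;> rw [← abs_eq_zero] <;> omega

theorem edge_s {z : Alc} (hz : z.V) {i : Fin 3} (h : z.L < (s i z).L) : Edge z (s i z) :=
  ⟨hz, s_rfl i z, h⟩

/-- Left multiplication by a simple reflection preserves the edges other than those that it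
labels. -/
theorem Edge.s {a b : Alc} (h : Edge a b) (i : Fin 3) : b = s i a ∨ Edge (s i a) (s i b) := by
  rw [or_iff_not_imp_left]
  intro hne
  have hV := h.1.s i
  rw [edge_iff] at h ⊢
  refine ⟨hV, ?_⟩
  obtain ⟨I, J, K⟩ := a
  obtain ⟨hz, ⟨m, rfl, h⟩ | ⟨m, rfl, h⟩ | ⟨m, rfl, h⟩⟩ := h <;> clear hV <;> fin_cases i <;>
    simp only [V, Alc.s, Alc.ext_iff, t1, t2, t3, Fin.zero_eta, Fin.mk_one, Fin.reduceFinMk,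
      Matrix.cons_val_zero, Matrix.cons_val_one, Matrix.cons_val] at hne hz h ⊢
  · exact Or.inr (Or.inl ⟨-1-m, by omega⟩)
  · exact Or.inl ⟨-m, by omega⟩
  · exact Or.inr (Or.inr ⟨m, by omega⟩)
  · exact Or.inl ⟨-1-m, by omega⟩
  · exact Or.inr (Or.inr ⟨m, by omega⟩)
  · exact Or.inr (Or.inl ⟨-m, by omega⟩)
  · exact Or.inr (Or.inr ⟨-2-m, by omega⟩)
  · exact Or.inr (Or.inl ⟨m, by omega⟩)
  · exact Or.inl ⟨m, by omega⟩


theorem Edge.valid {a b : Alc} (h : Edge a b) : b.V := h.2.1.valid h.1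

theorem Edge.le {a b : Alc} (h : Edge a b) : Le a b := Relation.ReflTransGen.single h

theorem Le.refl (a : Alc) : Le a a := Relation.ReflTransGen.refl

theorem Le.trans {a b c : Alc} (h : Le a b) (h' : Le b c) : Le a c :=
  Relation.ReflTransGen.trans h h'

theorem Le.L_le {a b : Alc} (h : Le a b) : a.L ≤ b.L := by
  induction h with
  | refl => exact le_rfl
  | tail _ h ih => exact ih.trans h.2.2.le

theorem Le.valid {a b : Alc} (h : Le a b) (ha : a.V) : b.V := by
  induction h with
  | refl => exact ha
  | tail _ h ih => exact h.valid

theorem Le.eq_or_lt {a b : Alc} (h : Le a b) : a = b ∨ a.L < b.L := by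
  rcases Relation.ReflTransGen.cases_head h with rfl | ⟨c, h, h'⟩
  · exact Or.inl rfl
  · exact Or.inr (h.2.2.trans_le (Le.L_le h'))

theorem Le.antisymm {a b : Alc} (h : Le a b) (h' : Le b a) : a = b := by
  rcases h.eq_or_lt with h | h
  · exact h
  · exact absurd h'.L_le (not_le.2 h)

theorem L_parity {a : Alc} (ha : a.V) : (a.L % 2 = 0 ∧ a.K = a.I + a.J) ∨
    (a.L % 2 = 1 ∧ a.K = a.I + a.J - 1) := by
  obtain ⟨I, J, K⟩ := a
  simp only [V, L] at *
  rcases abs_cases I with ⟨e1, _⟩ | ⟨e1, _⟩ <;> rcases abs_cases J with ⟨e2, _⟩ | ⟨e2, _⟩ <;>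
    rcases abs_cases K with ⟨e3, _⟩ | ⟨e3, _⟩ <;> rw [e1, e2, e3] <;> omega

theorem Edge.odd {a b : Alc} (h : Edge a b) : ∃ k, b.L = a.L + 2 * k + 1 := by
  have key : (a.K = a.I + a.J ↔ b.K = b.I + b.J - 1) ∧ (a.K = a.I + a.J - 1 ↔ b.K = b.I + b.J) := by
    obtain ⟨hz, ⟨m, rfl⟩ | ⟨m, rfl⟩ | ⟨m, rfl⟩, -⟩ := h <;>
      simp only [V, t1, t2, t3] at * <;> omega
  refine ⟨(b.L - a.L) / 2, ?_⟩
  rcases L_parity h.1 with ⟨h1, h2⟩ | ⟨h1, h2⟩ <;>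
    rcases L_parity h.valid with ⟨h1', h2'⟩ | ⟨h1', h2'⟩ <;> omega

/-- The larger of `z` and `s i z`. -/
noncomputable def up (i : Fin 3) (z : Alc) : Alc := by
  classical exact if z.L < (s i z).L then s i z else z

theorem up_eq (i : Fin 3) (z : Alc) : up i z = z ∨ up i z = s i z := by
  unfold up; split_ifs <;> simp

theorem le_up (i : Fin 3) {z : Alc} (hz : z.V) : Le z (up i z) := by
  unfold up; split_ifs with h
  · exact (edge_s hz h).le
  · exact Le.refl z

theorem s_le_up (i : Fin 3) {z : Alc} (hz : z.V) : Le (s i z) (up i z) := by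
  unfold up; split_ifs with h
  · exact Le.refl _
  · refine Edge.le ⟨hz.s i, (s_rfl i z).symm, ?_⟩
    rcases L_s hz i with h' | h' <;> omega

theorem up_of_lt {i : Fin 3} {z : Alc} (h : (s i z).L < z.L) : up i z = z := by
  unfold up; rw [if_neg (by omega)]

theorem Edge.up_le {a b : Alc} (h : Edge a b) (i : Fin 3) : Le (up i a) (up i b) := by
  rcases h.s i with rfl | h'
  · unfold up
    rw [if_pos h.2.2, s_s, if_neg h.2.2.le.not_gt]
    exact Le.refl _
  · rcases up_eq i a with e | e <;> rw [e]
    · exact h.le.trans (le_up i h.valid)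
    · exact h'.le.trans (s_le_up i h.valid)

theorem Le.up_le {a b : Alc} (h : Le a b) (i : Fin 3) : Le (up i a) (up i b) := by
  induction h with
  | refl => exact Le.refl _
  | tail _ h ih => exact ih.trans (h.up_le i)

theorem up_le_of_desc {a b : Alc} (h : Le a b) {i : Fin 3} (hb : (s i b).L < b.L) :
    Le (up i a) b := by
  have := h.up_le i
  rwa [up_of_lt hb] at this

/-- An edge of length at least three is not a cover. -/
theorem Edge.exists_between {a b : Alc} (h : Edge a b) (hj : a.L + 2 ≤ b.L) :
    ∃ p, Le a p ∧ Le p b ∧ p ≠ a ∧ p ≠ b := by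
  have key : ∀ n : ℕ, ∀ a b : Alc, b.L.toNat ≤ n → Edge a b → a.L + 3 ≤ b.L →
      ∃ p, Le a p ∧ Le p b ∧ p ≠ a ∧ p ≠ b := by
    intro n
    induction n with
    | zero =>
      intro a b h0 _ h3
      have := L_nonneg a
      omega
    | succ n ih =>
      intro a b hn h h3
      have ha := h.1
      have hb := h.valid
      have := L_nonneg a
      obtain ⟨i, hi⟩ := exists_descent hb (by omega)
      have hLa := L_s ha i
      have hLb := L_s hb i
      have h' : Edge (Alc.s i a) (Alc.s i b) := by
        rcases h.s i with e | e
        · rw [e] at h3; omega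
        · exact e
      have hsb : Le (Alc.s i b) b := Edge.le ⟨hb.s i, (s_rfl i b).symm, hi⟩
      rcases hLa with hLa | hLa
      · refine ⟨Alc.s i a, (edge_s ha (by omega)).le, h'.le.trans hsb, ?_, ?_⟩ <;>
          rintro e <;> rw [e] at hLa <;> omega
      · obtain ⟨p, h1, h2, h3, h4⟩ := ih (Alc.s i a) (Alc.s i b) (by omega) h' (by omega)
        have hp := h1.valid (ha.s i)
        have e1 : up i (Alc.s i a) = a := by
          unfold up; rw [s_s, if_pos (by omega)]
        have q1 : Le a (up i p) := by
          have := h1.up_le i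
          rwa [e1] at this
        have q2 : Le (up i p) b := up_le_of_desc (h2.trans hsb) hi
        by_cases c1 : up i p = a
        · rcases up_eq i p with e | e
          · rw [e] at c1
            subst c1
            refine ⟨Alc.s i b, h2, hsb, ?_, ?_⟩ <;> rintro e <;> rw [e] at hi hLb <;> omega
          · rw [e] at c1
            rw [← c1, s_s] at h3
            exact absurd rfl h3
        · refine ⟨_, q1, q2, c1, ?_⟩
          rintro c2
          rcases up_eq i p with e | e
          · rw [e] at c2
            subst c2
            have := h2.L_le
            omega
          · rw [e] at c2
            rw [← c2, s_s] at h4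
            exact absurd rfl h4
  obtain ⟨k, hk⟩ := h.odd
  exact key _ a b le_rfl h (by omega)

theorem Le.exists_between {a b : Alc} (h : Le a b) (hj : a.L + 2 ≤ b.L) :
    ∃ p, Le a p ∧ Le p b ∧ p ≠ a ∧ p ≠ b := by
  rcases Relation.ReflTransGen.cases_head h with rfl | ⟨c, hc, h'⟩
  · omega
  · by_cases e : c = b
    · subst e; exact hc.exists_between hj
    · exact ⟨c, hc.le, h', fun e => by rw [e] at hc; exact lt_irrefl _ hc.2.2, e⟩

/-- The cover relation. -/
def Cov (a b : Alc) : Prop := a.V ∧ Rfl a b ∧ b.L = a.L + 1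

theorem Cov.edge {a b : Alc} (h : Cov a b) : Edge a b := ⟨h.1, h.2.1, by have := h.2.2; omega⟩

theorem Le.cov {a b : Alc} (h : Le a b) (hL : b.L = a.L + 1) : Cov a b := by
  rcases Relation.ReflTransGen.cases_head h with rfl | ⟨c, hc, h'⟩
  · omega
  · have := hc.2.2
    rcases Le.eq_or_lt h' with rfl | h''
    · exact ⟨hc.1, hc.2.1, hL⟩
    · omega

/-- The inequalities cutting out the lower interval of a dominant alcove. -/
def In (P Q : ℤ) (z : Alc) : Prop :=
  (z.I + z.K ≤ P ∧ z.J - z.I + 1 ≤ P ∧ 2 - z.J - z.K ≤ P) ∧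
  (z.J + z.K ≤ Q ∧ z.I - z.J + 1 ≤ Q ∧ 2 - z.I - z.K ≤ Q)

theorem Edge.in {a b : Alc} {P Q : ℤ} (h : Edge a b) (hb : In P Q b) : In P Q a := by
  rw [edge_iff] at h
  obtain ⟨I, J, K⟩ := a
  obtain ⟨hz, ⟨m, rfl, h⟩ | ⟨m, rfl, h⟩ | ⟨m, rfl, h⟩⟩ := h <;> simp only [V, In, t1, t2, t3] at * <;>
    rcases hz with rfl | rfl <;> rcases h with h | h <;> omega

theorem Le.in {a b : Alc} {P Q : ℤ} (h : Le a b) (hb : In P Q b) : In P Q a := by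
  induction h using Relation.ReflTransGen.head_induction_on with
  | refl => exact hb
  | head h _ ih => exact h.in ih

/-- Strictly dominant alcoves. -/
def Dom (z : Alc) : Prop := z.V ∧ 1 ≤ z.I ∧ 1 ≤ z.J

theorem Dom.in {z : Alc} (h : Dom z) : In (z.I + z.K) (z.J + z.K) z := by
  obtain ⟨hz, h1, h2⟩ := h
  unfold V at hz; unfold In; omega

theorem Dom.le {a b : Alc} (ha : Dom a) (hb : Dom b) (h1 : a.I + a.K ≤ b.I + b.K)
    (h2 : a.J + a.K ≤ b.J + b.K) : Le a b := by
  have key : ∀ n : ℕ, ∀ a : Alc, Dom a → a.I + a.K ≤ b.I + b.K → a.J + a.K ≤ b.J + b.K →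
      (b.I + b.K + b.J + b.K - (a.I + a.K + a.J + a.K)).toNat ≤ n → Le a b := by
    intro n
    induction n with
    | zero =>
      rintro a ⟨ha, ha1, ha2⟩ h1 h2 h3
      obtain ⟨hb, hb1, hb2⟩ := hb
      unfold V at ha hb
      have : a = b := by ext <;> omega
      rw [this]; exact Le.refl _
    | succ n ih =>
      rintro a ⟨ha, ha1, ha2⟩ h1 h2 h3
      obtain ⟨hb, hb1, hb2⟩ := hb
      have e1 : ∀ m, 0 ≤ m → a.I ≤ m → Edge a (t1 m a) := fun m h h' =>
        edge_iff.2 ⟨ha, Or.inl ⟨m, rfl, Or.inl ⟨h, h'⟩⟩⟩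
      have e2 : ∀ m, 0 ≤ m → a.J ≤ m → Edge a (t2 m a) := fun m h h' =>
        edge_iff.2 ⟨ha, Or.inr (Or.inl ⟨m, rfl, Or.inl ⟨h, h'⟩⟩)⟩
      have e3 : ∀ m, 0 ≤ m → a.K ≤ m → Edge a (t3 m a) := fun m h h' =>
        edge_iff.2 ⟨ha, Or.inr (Or.inr ⟨m, rfl, Or.inl ⟨h, h'⟩⟩)⟩
      have go : ∀ c, Edge a c → 1 ≤ c.I → 1 ≤ c.J → c.I + c.K ≤ b.I + b.K →
          c.J + c.K ≤ b.J + b.K → a.I + a.K + a.J + a.K < c.I + c.K + c.J + c.K → Le a b :=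
        fun c hc q1 q2 q3 q4 q5 =>
          hc.le.trans (ih c ⟨hc.valid, q1, q2⟩ q3 q4 (by omega))
      by_cases c0 : a = b
      · rw [c0]; exact Le.refl _
      have c1 : ¬ (a.I = b.I ∧ a.J = b.J ∧ a.K = b.K) := fun h => c0 (Alc.ext h.1 h.2.1 h.2.2)
      unfold V at ha hb
      rcases ha with ha | ha
      · by_cases c2 : a.I + a.K < b.I + b.K
        · refine go _ (e1 a.I (by omega) (by omega)) ?_ ?_ ?_ ?_ ?_ <;> simp [t1] <;> omega
        · refine go _ (e2 a.J (by omega) (by omega)) ?_ ?_ ?_ ?_ ?_ <;> simp [t2] <;> omega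
      · by_cases c2 : a.I + a.K < b.I + b.K
        · by_cases c3 : a.J + a.K < b.J + b.K
          · refine go _ (e3 a.K (by omega) (by omega)) ?_ ?_ ?_ ?_ ?_ <;> simp [t3] <;> omega
          · refine go _ (e1 a.I (by omega) (by omega)) ?_ ?_ ?_ ?_ ?_ <;> simp [t1] <;> omega
        · refine go _ (e2 a.J (by omega) (by omega)) ?_ ?_ ?_ ?_ ?_ <;> simp [t2] <;> omega
  exact key _ a ha h1 h2 le_rfl

/-- The lower interval of a dominant alcove is cut out by linear inequalities. -/
theorem le_dom_iff {z y : Alc} (hz : z.V) (hy : Dom y) : Le z y ↔ In (y.I + y.K) (y.J + y.K) z := by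
  refine ⟨fun h => h.in hy.in, ?_⟩
  have key : ∀ n : ℕ, ∀ z : Alc, z.V → In (y.I + y.K) (y.J + y.K) z →
      (y.I + y.K + y.J + y.K - (z.I + z.K + z.J + z.K)).toNat ≤ n → Le z y := by
    intro n
    induction n with
    | zero =>
      intro z hz h hn
      unfold In at h
      have hz' := hz
      unfold V at hz
      exact Dom.le ⟨hz', by omega, by omega⟩ hy h.1.1 h.2.1
    | succ n ih =>
      intro z hz h hn
      have h' := h
      unfold In at h
      by_cases c1 : z.I ≤ 0
      · have : Edge z (t1 0 z) := edge_iff.2 ⟨hz, Or.inl ⟨0, rfl, Or.inl ⟨le_rfl, c1⟩⟩⟩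
        refine this.le.trans (ih _ this.valid ?_ ?_) <;> unfold V at hz <;>
          simp only [In, t1] <;> omega
      by_cases c2 : z.J ≤ 0
      · have : Edge z (t2 0 z) :=
          edge_iff.2 ⟨hz, Or.inr (Or.inl ⟨0, rfl, Or.inl ⟨le_rfl, c2⟩⟩)⟩
        refine this.le.trans (ih _ this.valid ?_ ?_) <;> unfold V at hz <;>
          simp only [In, t2] <;> omega
      exact Dom.le ⟨hz, by omega, by omega⟩ hy h.1.1 h.2.1
  intro h
  exact key _ z hz h le_rfl


theorem Cov.cases {z w : Alc} (h : Cov z w) :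
    (∃ m, w = t1 m z ∧ (t1 m z).L = z.L + 1) ∨ (∃ m, w = t2 m z ∧ (t2 m z).L = z.L + 1) ∨
      ∃ m, w = t3 m z ∧ (t3 m z).L = z.L + 1 := by
  obtain ⟨_, ⟨m, rfl⟩ | ⟨m, rfl⟩ | ⟨m, rfl⟩, h⟩ := h
  · exact Or.inl ⟨m, rfl, h⟩
  · exact Or.inr (Or.inl ⟨m, rfl, h⟩)
  · exact Or.inr (Or.inr ⟨m, rfl, h⟩)

/-- The covers of a strictly dominant alcove. -/
theorem cov_dom {z w : Alc} (hz : Dom z) (h : Cov z w) :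
    w = t1 z.I z ∨ w = t2 z.J z ∨ w = t1 (-1) z ∨ w = t2 (-1) z ∨ w = t3 (-1) z ∨
      (w = t3 z.K z ∧ z.K = z.I + z.J - 1) := by
  obtain ⟨hv, hI, hJ⟩ := hz
  obtain ⟨I, J, K⟩ := z
  have key := h.cases
  simp only [V, L, t1, t2, t3] at hv hI hJ key ⊢
  rw [abs_of_nonneg (by omega : 0 ≤ I), abs_of_nonneg (by omega : 0 ≤ J),
    abs_of_nonneg (by omega : 0 ≤ K)] at key
  obtain ⟨m, rfl, h⟩ | ⟨m, rfl, h⟩ | ⟨m, rfl, h⟩ := key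
  · have : m = I ∨ m = -1 := by
      rcases abs_cases (2 * m + 1 - I) with ⟨e1, _⟩ | ⟨e1, _⟩ <;>
      rcases abs_cases (K - m) with ⟨e2, _⟩ | ⟨e2, _⟩ <;>
      rcases abs_cases (J + m) with ⟨e3, _⟩ | ⟨e3, _⟩ <;> omega
    rcases this with rfl | rfl <;> simp
  · have : m = J ∨ m = -1 := by
      rcases abs_cases (2 * m + 1 - J) with ⟨e1, _⟩ | ⟨e1, _⟩ <;>
      rcases abs_cases (K - m) with ⟨e2, _⟩ | ⟨e2, _⟩ <;>
      rcases abs_cases (I + m) with ⟨e3, _⟩ | ⟨e3, _⟩ <;> omega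
    rcases this with rfl | rfl <;> simp
  · have : (m = K ∧ K = I + J - 1) ∨ m = -1 := by
      rcases abs_cases (2 * m + 1 - K) with ⟨e1, _⟩ | ⟨e1, _⟩ <;>
      rcases abs_cases (m + 1 - I) with ⟨e2, _⟩ | ⟨e2, _⟩ <;>
      rcases abs_cases (m + 1 - J) with ⟨e3, _⟩ | ⟨e3, _⟩ <;> omega
    rcases this with ⟨rfl, h⟩ | rfl
    · simp [h]
    · simp

theorem dom_cov {z : Alc} (hz : Dom z) :
    Cov z (t1 z.I z) ∧ Cov z (t2 z.J z) ∧ Cov z (t1 (-1) z) ∧ Cov z (t2 (-1) z) ∧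
      Cov z (t3 (-1) z) ∧ (z.K = z.I + z.J - 1 → Cov z (t3 z.K z)) := by
  obtain ⟨hv, hI, hJ⟩ := hz
  refine ⟨⟨hv, Or.inl ⟨_, rfl⟩, ?_⟩, ⟨hv, Or.inr (Or.inl ⟨_, rfl⟩), ?_⟩,
    ⟨hv, Or.inl ⟨_, rfl⟩, ?_⟩, ⟨hv, Or.inr (Or.inl ⟨_, rfl⟩), ?_⟩,
    ⟨hv, Or.inr (Or.inr ⟨_, rfl⟩), ?_⟩, fun hK => ⟨hv, Or.inr (Or.inr ⟨_, rfl⟩), ?_⟩⟩ <;>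
  obtain ⟨I, J, K⟩ := z <;> simp only [V, L, t1, t2, t3] at * <;>
  simp only [abs_eq_max_neg] <;> omega

/-- The list `l` contains all covers of `z`. -/
def CovIn (z : Alc) (l : List Alc) : Prop := ∀ w, Cov z w → w ∈ l

theorem covIn_dom {z : Alc} (hz : Dom z) :
    CovIn z [t1 z.I z, t2 z.J z, t1 (-1) z, t2 (-1) z, t3 (-1) z, t3 z.K z] := by
  intro w h
  have := cov_dom hz h
  simp only [List.mem_cons, List.not_mem_nil]
  tauto

theorem covIn_dom_even {z : Alc} (hz : Dom z) (hK : z.K = z.I + z.J) :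
    CovIn z [t1 z.I z, t2 z.J z, t1 (-1) z, t2 (-1) z, t3 (-1) z] := by
  intro w h
  have := cov_dom hz h
  have h' : ¬ (z.K = z.I + z.J - 1) := by omega
  simp only [List.mem_cons, List.not_mem_nil]
  tauto

theorem covIn_wall1 {z : Alc} (hI : z.I = 0) (hJ : 1 ≤ z.J) (hK : z.K = z.I + z.J) :
    CovIn z [t1 (-1) z, t1 0 z, t2 z.J z, t3 (-1) z] := by
  intro w h
  obtain ⟨I, J, K⟩ := z
  have key := h.cases
  simp only [L, t1, t2, t3] at hI hJ hK key ⊢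
  subst hI hK
  rw [abs_zero, abs_of_nonneg (by omega : 0 ≤ J),
    abs_of_nonneg (by omega : 0 ≤ 0 + J)] at key
  obtain ⟨m, rfl, h⟩ | ⟨m, rfl, h⟩ | ⟨m, rfl, h⟩ := key
  · have : m = 0 ∨ m = -1 := by
      rcases abs_cases (2 * m + 1 - 0) with ⟨e1, _⟩ | ⟨e1, _⟩ <;>
      rcases abs_cases (0 + J - m) with ⟨e2, _⟩ | ⟨e2, _⟩ <;>
      rcases abs_cases (J + m) with ⟨e3, _⟩ | ⟨e3, _⟩ <;> omega
    rcases this with rfl | rfl <;> simp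
  · have : m = J := by
      rcases abs_cases (2 * m + 1 - J) with ⟨e1, _⟩ | ⟨e1, _⟩ <;>
      rcases abs_cases (0 + J - m) with ⟨e2, _⟩ | ⟨e2, _⟩ <;>
      rcases abs_cases (0 + m) with ⟨e3, _⟩ | ⟨e3, _⟩ <;> omega
    subst this; simp
  · have : m = -1 := by
      rcases abs_cases (2 * m + 1 - (0 + J)) with ⟨e1, _⟩ | ⟨e1, _⟩ <;>
      rcases abs_cases (m + 1 - J) with ⟨e2, _⟩ | ⟨e2, _⟩ <;>
      rcases abs_cases (m + 1 - 0) with ⟨e3, _⟩ | ⟨e3, _⟩ <;> omega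
    subst this; simp

/-- The covers of an odd alcove adjacent to the region reached by `t1 (-1)`. -/
theorem covIn_left {z : Alc} (hI : z.I ≤ -2) (hK : z.K = z.I + z.J - 1) (hK0 : 0 ≤ z.K) :
    CovIn z [t1 (z.I - 1) z, t1 0 z, t3 (-1) z, t3 z.K z] := by
  intro w h
  obtain ⟨I, J, K⟩ := z
  have key := h.cases
  simp only [L, t1, t2, t3] at hI hK hK0 key ⊢
  subst hK
  rw [abs_of_nonpos (by omega : I ≤ 0), abs_of_nonneg (by omega : 0 ≤ J),
    abs_of_nonneg (by omega : 0 ≤ I + J - 1)] at key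
  obtain ⟨m, rfl, h⟩ | ⟨m, rfl, h⟩ | ⟨m, rfl, h⟩ := key
  · have : m = 0 ∨ m = I - 1 := by
      rcases abs_cases (2 * m + 1 - I) with ⟨e1, _⟩ | ⟨e1, _⟩ <;>
      rcases abs_cases (I + J - 1 - m) with ⟨e2, _⟩ | ⟨e2, _⟩ <;>
      rcases abs_cases (J + m) with ⟨e3, _⟩ | ⟨e3, _⟩ <;> omega
    rcases this with rfl | rfl <;> simp
  · exfalso
    rcases abs_cases (2 * m + 1 - J) with ⟨e1, _⟩ | ⟨e1, _⟩ <;>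
      rcases abs_cases (I + J - 1 - m) with ⟨e2, _⟩ | ⟨e2, _⟩ <;>
      rcases abs_cases (I + m) with ⟨e3, _⟩ | ⟨e3, _⟩ <;> omega
  · have : m = -1 ∨ m = I + J - 1 := by
      rcases abs_cases (2 * m + 1 - (I + J - 1)) with ⟨e1, _⟩ | ⟨e1, _⟩ <;>
      rcases abs_cases (m + 1 - J) with ⟨e2, _⟩ | ⟨e2, _⟩ <;>
      rcases abs_cases (m + 1 - I) with ⟨e3, _⟩ | ⟨e3, _⟩ <;> omega
    rcases this with rfl | rfl <;> simp

/-- The covers of an odd strictly antidominant alcove. -/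
theorem covIn_anti {z : Alc} (hI : z.I ≤ -1) (hJ : z.J ≤ -1) (hK : z.K = z.I + z.J - 1) :
    CovIn z [t1 (z.I - 1) z, t1 0 z, t2 (z.J - 1) z, t2 0 z] := by
  intro w h
  obtain ⟨I, J, K⟩ := z
  have key := h.cases
  simp only [L, t1, t2, t3] at hI hK hJ key ⊢
  subst hK
  rw [abs_of_nonpos (by omega : I ≤ 0), abs_of_nonpos (by omega : J ≤ 0),
    abs_of_nonpos (by omega : I + J - 1 ≤ 0)] at key
  obtain ⟨m, rfl, h⟩ | ⟨m, rfl, h⟩ | ⟨m, rfl, h⟩ := key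
  · have : m = 0 ∨ m = I - 1 := by
      rcases abs_cases (2 * m + 1 - I) with ⟨e1, _⟩ | ⟨e1, _⟩ <;>
      rcases abs_cases (I + J - 1 - m) with ⟨e2, _⟩ | ⟨e2, _⟩ <;>
      rcases abs_cases (J + m) with ⟨e3, _⟩ | ⟨e3, _⟩ <;> omega
    rcases this with rfl | rfl <;> simp
  · have : m = 0 ∨ m = J - 1 := by
      rcases abs_cases (2 * m + 1 - J) with ⟨e1, _⟩ | ⟨e1, _⟩ <;>
      rcases abs_cases (I + J - 1 - m) with ⟨e2, _⟩ | ⟨e2, _⟩ <;>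
      rcases abs_cases (I + m) with ⟨e3, _⟩ | ⟨e3, _⟩ <;> omega
    rcases this with rfl | rfl <;> simp
  · exfalso
    rcases abs_cases (2 * m + 1 - (I + J - 1)) with ⟨e1, _⟩ | ⟨e1, _⟩ <;>
      rcases abs_cases (m + 1 - J) with ⟨e2, _⟩ | ⟨e2, _⟩ <;>
      rcases abs_cases (m + 1 - I) with ⟨e3, _⟩ | ⟨e3, _⟩ <;> omega


/-- The even strictly dominant alcoves. -/
def TS (z : Alc) : Prop := z.K = z.I + z.J ∧ 1 ≤ z.I ∧ 1 ≤ z.J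
/-- The odd strictly dominant alcoves. -/
def TH (z : Alc) : Prop := z.K = z.I + z.J - 1 ∧ 1 ≤ z.I ∧ 1 ≤ z.J

theorem TS.dom {z : Alc} (h : TS z) : Dom z := ⟨Or.inl h.1, h.2⟩
theorem TH.dom {z : Alc} (h : TH z) : Dom z := ⟨Or.inr h.1, h.2⟩
theorem Dom.ts_or_th {z : Alc} (h : Dom z) : TS z ∨ TH z :=
  h.1.imp (fun h' => ⟨h', h.2⟩) fun k => ⟨k, h.2⟩

/-- Reflection in the nearest upper wall of direction `α₁`. -/
def ra (z : Alc) : Alc := t1 z.I z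
/-- Reflection in the nearest upper wall of direction `α₂`. -/
def rb (z : Alc) : Alc := t2 z.J z
/-- Reflection in the nearest upper wall of direction `ρ`. -/
def rc (z : Alc) : Alc := t3 z.K z
/-- Translation by `a ϖ₁ + b ϖ₂`. -/
def tr (a b : ℤ) (z : Alc) : Alc := ⟨z.I + a, z.J + b, z.K + a + b⟩
/-- The diagram automorphism exchanging the two finite simple roots. -/
def sg (z : Alc) : Alc := ⟨z.J, z.I, z.K⟩

@[simp] theorem sg_sg (z : Alc) : sg (sg z) = z := rfl
theorem sg_inj {z w : Alc} : sg z = sg w ↔ z = w :=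
  ⟨fun h => by simpa using congrArg sg h, fun h => by rw [h]⟩

theorem V.sg {z : Alc} (h : z.V) : (sg z).V := by unfold V Alc.sg at *; simp only; omega
theorem TS.sg {z : Alc} (h : TS z) : TS (sg z) := by unfold TS Alc.sg at *; simp only; omega
theorem TH.sg {z : Alc} (h : TH z) : TH (sg z) := by unfold TH Alc.sg at *; simp only; omega
theorem Dom.sg {z : Alc} (h : Dom z) : Dom (sg z) := ⟨h.1.sg, h.2.2, h.2.1⟩
theorem L_sg (z : Alc) : (sg z).L = z.L := by unfold L sg; ring

theorem Rfl.sg {z w : Alc} (h : Rfl z w) : Rfl (sg z) (sg w) := by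
  rcases h with ⟨m, rfl⟩ | ⟨m, rfl⟩ | ⟨m, rfl⟩
  · exact Or.inr (Or.inl ⟨m, rfl⟩)
  · exact Or.inl ⟨m, rfl⟩
  · exact Or.inr (Or.inr ⟨m, rfl⟩)

theorem Edge.sg {z w : Alc} (h : Edge z w) : Edge (sg z) (sg w) :=
  ⟨h.1.sg, h.2.1.sg, by rw [L_sg, L_sg]; exact h.2.2⟩

theorem Cov.sg {z w : Alc} (h : Cov z w) : Cov (sg z) (sg w) :=
  ⟨h.1.sg, h.2.1.sg, by rw [L_sg, L_sg]; exact h.2.2⟩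

theorem Le.sg {z w : Alc} (h : Le z w) : Le (sg z) (sg w) := by
  induction h with
  | refl => exact Le.refl _
  | tail _ h ih => exact ih.trans h.sg.le

/-- All covers of a dominant alcove lie below `y` as soon as its `ρ`-translate does. -/
theorem Cov.le_of_room {z w y : Alc} (h : Cov z w) (hz : Dom z) (hy : Dom y)
    (h1 : z.I + z.K + 3 ≤ y.I + y.K) (h2 : z.J + z.K + 3 ≤ y.J + y.K) : Le w y := by
  rw [le_dom_iff (h.2.1.valid h.1) hy]
  have hz' := hz
  obtain ⟨hv, hI, hJ⟩ := hz
  unfold V at hv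
  rcases cov_dom hz' h with rfl | rfl | rfl | rfl | rfl | ⟨rfl, h⟩ <;>
    simp only [In, t1, t2, t3] <;> omega

theorem nodup_dom {z : Alc} (hz : Dom z) :
    [t1 z.I z, t2 z.J z, t1 (-1) z, t2 (-1) z, t3 (-1) z].Nodup := by
  obtain ⟨hv, hI, hJ⟩ := hz
  unfold V at hv
  simp only [t1, t2, t3, List.nodup_cons, List.mem_cons, Alc.mk.injEq, List.not_mem_nil,
    List.nodup_nil, or_false, not_false_eq_true, and_true]
  refine ⟨?_, ?_, ?_, ?_⟩ <;> omega

theorem nodup_odd {z : Alc} (hz : TH z) :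
    [t1 z.I z, t2 z.J z, t1 (-1) z, t2 (-1) z, t3 (-1) z, t3 z.K z].Nodup := by
  obtain ⟨hv, hI, hJ⟩ := hz
  simp only [t1, t2, t3, List.nodup_cons, List.mem_cons, Alc.mk.injEq, List.not_mem_nil,
    List.nodup_nil, or_false, not_false_eq_true, and_true]
  refine ⟨?_, ?_, ?_, ?_, ?_⟩ <;> omega

theorem covIn_wall2 {z : Alc} (hJ : z.J = 0) (hI : 1 ≤ z.I) (hK : z.K = z.I + z.J) :
    CovIn z [t2 (-1) z, t2 0 z, t1 z.I z, t3 (-1) z] := by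
  intro w h
  have := covIn_wall1 (z := sg z) hJ hI (by simp [sg]; omega) _ h.sg
  simp only [List.mem_cons, List.not_mem_nil] at this ⊢
  rw [← sg_inj, ← sg_inj (z := w), ← sg_inj (z := w), ← sg_inj (z := w)]
  exact this

theorem covIn_right {z : Alc} (hJ : z.J ≤ -2) (hK : z.K = z.I + z.J - 1) (hK0 : 0 ≤ z.K) :
    CovIn z [t2 (z.J - 1) z, t2 0 z, t3 (-1) z, t3 z.K z] := by
  intro w h
  have := covIn_left (z := sg z) hJ (by simp [sg]; omega) hK0 _ h.sg
  simp only [List.mem_cons, List.not_mem_nil] at this ⊢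
  rw [← sg_inj, ← sg_inj (z := w), ← sg_inj (z := w), ← sg_inj (z := w)]
  exact this

/-- The nondominant covers of an even dominant alcove have few covers. -/
theorem few_covers {z : Alc} (hz : TS z) :
    (∃ l, l.length = 4 ∧ CovIn (t1 (-1) z) l) ∧ (∃ l, l.length = 4 ∧ CovIn (t2 (-1) z) l) ∧
      ∃ l, l.length = 4 ∧ CovIn (t3 (-1) z) l := by
  obtain ⟨hK, hI, hJ⟩ := hz
  refine ⟨⟨_, ?_, covIn_left ?_ ?_ ?_⟩, ⟨_, ?_, covIn_right ?_ ?_ ?_⟩,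
    ⟨_, ?_, covIn_anti ?_ ?_ ?_⟩⟩ <;> first | rfl | (simp [t1, t2, t3]; omega)

/-- A cover of an odd dominant alcove `w` other than `rc w` has at most one common cover
with `rc w`. -/
theorem common_unique {w q p1 p2 : Alc} (hw : TH w) (hq : Cov w q) (hqc : q ≠ rc w)
    (h1 : Cov (rc w) p1) (h1' : Cov q p1) (h2 : Cov (rc w) p2) (h2' : Cov q p2) : p1 = p2 := by
  have hd : Dom (rc w) := by
    obtain ⟨hK, hI, hJ⟩ := hw
    simp only [Dom, V, rc, t3]; omega
  have hne : rc w = t3 w.K w := rfl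
  have hev : ¬ (rc w).K = (rc w).I + (rc w).J - 1 := by
    obtain ⟨hK, hI, hJ⟩ := hw
    simp only [rc, t3]; omega
  have key : ∀ p, Cov (rc w) p → Cov q p →
      (q = t1 w.I w ∧ p = t1 (rc w).I (rc w)) ∨ (q = t2 w.J w ∧ p = t2 (rc w).J (rc w)) ∨
      (q = t1 (-1) w ∧ p = t1 (-1) (rc w)) ∨ (q = t2 (-1) w ∧ p = t2 (-1) (rc w)) ∨
      (q = t3 (-1) w ∧ p = t3 (-1) (rc w)) := by
    intro p hp hqp
    have hR := hqp.2.1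
    have hq1 := cov_dom hw.dom hq
    have hp1 := cov_dom hd hp
    obtain ⟨hK, hI, hJ⟩ := hw
    rcases hq1 with e | e | e | e | e | ⟨e, _⟩
    rotate_right
    · exact absurd e hqc
    all_goals
      rcases hp1 with e' | e' | e' | e' | e' | ⟨_, e'⟩
      rotate_right
      · exact absurd e' hev
      all_goals
        first
        | exact Or.inl ⟨e, e'⟩
        | exact Or.inr (Or.inl ⟨e, e'⟩)
        | exact Or.inr (Or.inr (Or.inl ⟨e, e'⟩))
        | exact Or.inr (Or.inr (Or.inr (Or.inl ⟨e, e'⟩)))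
        | exact Or.inr (Or.inr (Or.inr (Or.inr ⟨e, e'⟩)))
        | exfalso
          rw [e, e'] at hR
          simp only [Rfl, t1, t2, t3, rc, Alc.mk.injEq] at hR
          obtain ⟨m, hm⟩ | ⟨m, hm⟩ | ⟨m, hm⟩ := hR <;> omega
  have k1 := key p1 h1 h1'
  have k2 := key p2 h2 h2'
  have hn := nodup_dom hw.dom
  simp only [List.nodup_cons, List.mem_cons, List.not_mem_nil, not_or] at hn
  rcases k1 with ⟨e, e'⟩ | ⟨e, e'⟩ | ⟨e, e'⟩ | ⟨e, e'⟩ | ⟨e, e'⟩ <;>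
    rcases k2 with ⟨f, f'⟩ | ⟨f, f'⟩ | ⟨f, f'⟩ | ⟨f, f'⟩ | ⟨f, f'⟩ <;>
    first
    | exact e'.trans f'.symm
    | (rw [e] at f; tauto)

/-- Away from the wall, `rb w` and `t2 (-1) w` have two common covers. -/
theorem two_common {w : Alc} (hw : TH w) (hI : 2 ≤ w.I) :
    ∃ p1 p2, p1 ≠ p2 ∧ Cov (rb w) p1 ∧ Cov (rb w) p2 ∧ Cov (t2 (-1) w) p1 ∧
      Cov (t2 (-1) w) p2 := by
  obtain ⟨hK, -, hJ⟩ := hw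
  have hd : Dom (rb w) := by simp only [Dom, V, rb, t2]; omega
  have hd' : Dom w := ⟨Or.inr hK, by omega, hJ⟩
  have h := dom_cov hd
  have hv := (dom_cov hd').2.2.2.1.2.1.valid hd'.1
  have hL := (dom_cov hd').2.2.2.1.2.2
  have hLb := (dom_cov hd').2.1.2.2
  change (rb w).L = _ at hLb
  refine ⟨_, _, ?_, h.2.1, h.2.2.2.1, ⟨hv, Or.inr (Or.inl ⟨0, ?_⟩), ?_⟩,
    ⟨hv, Or.inr (Or.inl ⟨-2 - w.J, ?_⟩), ?_⟩⟩
  · simp [t2, rb]; omega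
  · simp [t2, rb]; omega
  · rw [hL, h.2.1.2.2, hLb]
  · simp [t2, rb]; omega
  · rw [hL, h.2.2.2.1.2.2, hLb]

/-- The common covers of `ra v` and `rb v`. -/
theorem common_ab {v p : Alc} (hv : TS v) (h1 : Cov (ra v) p) (h2 : Cov (rb v) p) :
    p = rc (ra v) ∨ p = rc (rb v) := by
  obtain ⟨hK, hI, hJ⟩ := hv
  have hd1 : Dom (ra v) := by simp only [Dom, V, ra, t1]; omega
  have hR := h2.2.1
  rcases cov_dom hd1 h1 with e | e | e | e | e | ⟨e, _⟩
  rotate_right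
  · exact Or.inl e
  rotate_left
  · right; rw [e]; simp [t2, ra, rb, rc, t1, t3]; omega
  all_goals
    exfalso
    rw [e] at hR
    simp only [Rfl, t1, t2, t3, ra, rb, Alc.mk.injEq] at hR
    obtain ⟨m, hm⟩ | ⟨m, hm⟩ | ⟨m, hm⟩ := hR <;> omega

/-- The common cover of `rc (ra v)` and `rc (rb v)`. -/
theorem common_cc {v p : Alc} (hv : TS v) (h1 : Cov (rc (ra v)) p) (h2 : Cov (rc (rb v)) p) :
    p = rb (rc (ra v)) := by
  obtain ⟨hK, hI, hJ⟩ := hv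
  have hd1 : Dom (rc (ra v)) := by simp only [Dom, V, ra, t1, rc, t3]; omega
  have hR := h2.2.1
  rcases cov_dom hd1 h1 with e | e | e | e | e | ⟨e, e'⟩
  rotate_left
  · exact e
  all_goals
    exfalso
    rw [e] at hR
    simp only [Rfl, t1, t2, t3, ra, rb, rc, Alc.mk.injEq] at hR
    try simp only [t1, t3, ra, rc] at e'
    obtain ⟨m, hm⟩ | ⟨m, hm⟩ | ⟨m, hm⟩ := hR <;> omega

/-- The coatoms between an odd `w` and `ra (rc w)`. -/
theorem between_ac {w q : Alc} (hw : TH w) (h1 : Cov w q) (h2 : Cov q (ra (rc w))) :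
    q = rc w ∨ q = ra w := by
  have hR := h2.2.1
  have hd := hw.dom
  obtain ⟨hK, hI, hJ⟩ := hw
  rcases cov_dom hd h1 with e | e | e | e | e | ⟨e, e'⟩
  · exact Or.inr e
  rotate_right
  · exact Or.inl e
  all_goals
    exfalso
    rw [e] at hR
    simp only [Rfl, t1, t2, t3, ra, rc, Alc.mk.injEq] at hR
    obtain ⟨m, hm⟩ | ⟨m, hm⟩ | ⟨m, hm⟩ := hR <;> omega


/-- Membership in the Bruhat interval `[x, y]`. -/
def Mem (x y z : Alc) : Prop := Le x z ∧ Le z y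

/-- An isomorphism between the Bruhat intervals `[x, y]` and `[x', y']`. -/
structure Iso (x y x' y' : Alc) where
  f : Alc → Alc
  g : Alc → Alc
  hx : x.V
  hx' : x'.V
  hxy : Le x y
  hf : ∀ z, Mem x y z → Mem x' y' (f z)
  hg : ∀ z, Mem x' y' z → Mem x y (g z)
  gf : ∀ z, Mem x y z → g (f z) = z
  fg : ∀ z, Mem x' y' z → f (g z) = z
  f_le : ∀ z w, Mem x y z → Mem x y w → Le z w → Le (f z) (f w)
  g_le : ∀ z w, Mem x' y' z → Mem x' y' w → Le z w → Le (g z) (g w)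

namespace Iso

variable {x y x' y' : Alc}

/-- The inverse isomorphism. -/
def symm (F : Iso x y x' y') : Iso x' y' x y where
  f := F.g
  g := F.f
  hx := F.hx'
  hx' := F.hx
  hxy := (F.hf x ⟨Le.refl x, F.hxy⟩).1.trans (F.hf x ⟨Le.refl x, F.hxy⟩).2
  hf := F.hg
  hg := F.hf
  gf := F.fg
  fg := F.gf
  f_le := F.g_le
  g_le := F.f_le

/-- Conjugation by the diagram automorphism. -/
def sg (F : Iso x y x' y') : Iso (sg x) (sg y) (sg x') (sg y') where
  f := fun z => Alc.sg (F.f (Alc.sg z))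
  g := fun z => Alc.sg (F.g (Alc.sg z))
  hx := F.hx.sg
  hx' := F.hx'.sg
  hxy := F.hxy.sg
  hf := fun z hz => ⟨(F.hf (Alc.sg z) ⟨hz.1.sg, hz.2.sg⟩).1.sg, (F.hf (Alc.sg z) ⟨hz.1.sg, hz.2.sg⟩).2.sg⟩
  hg := fun z hz => ⟨(F.hg (Alc.sg z) ⟨hz.1.sg, hz.2.sg⟩).1.sg, (F.hg (Alc.sg z) ⟨hz.1.sg, hz.2.sg⟩).2.sg⟩
  gf := fun z hz => by
    rw [sg_sg, F.gf _ ⟨hz.1.sg, hz.2.sg⟩, sg_sg]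
  fg := fun z hz => by
    rw [sg_sg, F.fg _ ⟨hz.1.sg, hz.2.sg⟩, sg_sg]
  f_le := fun z w hz hw h => (F.f_le _ _ ⟨hz.1.sg, hz.2.sg⟩ ⟨hw.1.sg, hw.2.sg⟩ h.sg).sg
  g_le := fun z w hz hw h => (F.g_le _ _ ⟨hz.1.sg, hz.2.sg⟩ ⟨hw.1.sg, hw.2.sg⟩ h.sg).sg

theorem inj (F : Iso x y x' y') {z w : Alc} (hz : Mem x y z) (hw : Mem x y w)
    (h : F.f z = F.f w) : z = w := by
  rw [← F.gf z hz, h, F.gf w hw]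

theorem mem_trans {z w : Alc} (hz : Mem x y z) (h : Le z w) (h' : Le w y) : Mem x y w :=
  ⟨hz.1.trans h, h'⟩

theorem L_mono (F : Iso x y x' y') {z w : Alc} (hz : Mem x y z) (hw : Mem x y w) (h : Le z w) :
    w.L - z.L ≤ (F.f w).L - (F.f z).L := by
  have key : ∀ n : ℕ, ∀ z w : Alc, Mem x y z → Mem x y w → Le z w → (w.L - z.L).toNat ≤ n →
      w.L - z.L ≤ (F.f w).L - (F.f z).L := by
    intro n
    induction n with
    | zero =>
      intro z w hz hw h hn
      have := (F.f_le z w hz hw h).L_le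
      omega
    | succ n ih =>
      intro z w hz hw h hn
      by_cases c : z.L + 2 ≤ w.L
      · obtain ⟨p, h1, h2, h3, h4⟩ := h.exists_between c
        have hp : Mem x y p := ⟨hz.1.trans h1, h2.trans hw.2⟩
        have l1 : z.L < p.L := h1.eq_or_lt.resolve_left (Ne.symm h3)
        have l2 : p.L < w.L := h2.eq_or_lt.resolve_left h4
        have := ih z p hz hp h1 (by omega)
        have := ih p w hp hw h2 (by omega)
        omega
      · rcases (F.f_le z w hz hw h).eq_or_lt with e | e
        · rw [F.inj hz hw e]; omega
        · omega
  exact key _ z w hz hw h le_rfl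

theorem L_eq (F : Iso x y x' y') {z w : Alc} (hz : Mem x y z) (hw : Mem x y w) (h : Le z w) :
    (F.f w).L - (F.f z).L = w.L - z.L := by
  have h1 := F.L_mono hz hw h
  have h2 := F.symm.L_mono (F.hf z hz) (F.hf w hw) (F.f_le z w hz hw h)
  change (F.f w).L - (F.f z).L ≤ (F.g (F.f w)).L - (F.g (F.f z)).L at h2
  rw [F.gf z hz, F.gf w hw] at h2
  omega

theorem cov (F : Iso x y x' y') {z w : Alc} (hz : Mem x y z) (hw : Le w y) (h : Cov z w) :
    Cov (F.f z) (F.f w) := by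
  have hw' := mem_trans hz h.edge.le hw
  refine (F.f_le z w hz hw' h.edge.le).cov ?_
  have := F.L_eq hz hw' h.edge.le
  have := h.2.2
  omega

theorem cov_iff (F : Iso x y x' y') {z w : Alc} (hz : Mem x y z) (hw : Mem x y w) :
    Cov (F.f z) (F.f w) ↔ Cov z w := by
  constructor
  · intro h
    have := F.symm.cov (F.hf z hz) (F.hf w hw).2 h
    change Cov (F.g _) (F.g _) at this
    rwa [F.gf z hz, F.gf w hw] at this
  · exact F.cov hz hw.2

theorem map_x (F : Iso x y x' y') : F.f x = x' := by
  have m : Mem x y x := ⟨Le.refl x, F.hxy⟩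
  have m' : Mem x' y' x' := ⟨Le.refl x', (F.hf x m).1.trans (F.hf x m).2⟩
  refine Le.antisymm ?_ (F.hf x m).1
  have := F.f_le x (F.g x') m (F.hg x' m') (F.hg x' m').1
  rwa [F.fg x' m'] at this

theorem map_y (F : Iso x y x' y') : F.f y = y' := by
  have m : Mem x y y := ⟨F.hxy, Le.refl y⟩
  have m' : Mem x' y' y' := ⟨(F.hf y m).1.trans (F.hf y m).2, Le.refl y'⟩
  refine Le.antisymm (F.hf y m).2 ?_
  have := F.f_le (F.g y') y (F.hg y' m') m (F.hg y' m').2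
  rwa [F.fg y' m'] at this

theorem count (F : Iso x y x' y') {u : Alc} (hu : Mem x y u) {S T : List Alc} (hS : S.Nodup)
    (hSc : ∀ w ∈ S, Cov u w ∧ Le w y) (hT : CovIn (F.f u) T) :
    S.length ≤ T.length ∧ (T.length ≤ S.length → ∀ t ∈ T, ∃ w ∈ S, F.f w = t) := by
  have hm : ∀ w ∈ S, Mem x y w := fun w hw => mem_trans hu (hSc w hw).1.edge.le (hSc w hw).2
  have hn : (S.map F.f).Nodup :=
    List.Nodup.map_on (fun a ha b hb e => F.inj (hm a ha) (hm b hb) e) hS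
  have hsub : S.map F.f ⊆ T := by
    intro t ht
    obtain ⟨w, hw, rfl⟩ := List.mem_map.1 ht
    exact hT _ (F.cov hu (hSc w hw).2 (hSc w hw).1)
  have hp := hn.subperm hsub
  refine ⟨by simpa using hp.length_le, fun hl t ht => ?_⟩
  have hp' := hp.perm_of_length_le (by simpa using hl)
  exact List.mem_map.1 (hp'.mem_iff.2 ht)

end Iso

theorem TH.ts_rc {w : Alc} (h : TH w) : TS (rc w) := by
  obtain ⟨hK, hI, hJ⟩ := h; simp only [TS, Alc.rc, t3]; omega

theorem TS.th_ra {w : Alc} (h : TS w) : TH (ra w) := by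
  obtain ⟨hK, hI, hJ⟩ := h; simp only [TH, Alc.ra, t1]; omega

theorem TS.th_rb {w : Alc} (h : TS w) : TH (rb w) := by
  obtain ⟨hK, hI, hJ⟩ := h; simp only [TH, Alc.rb, t2]; omega

/-- `y` is at least the translate of `z` by `(p α₁ + q α₂) / 3`. -/
def Room (p q : ℤ) (z y : Alc) : Prop :=
  z.I + z.K + p ≤ y.I + y.K ∧ z.J + z.K + q ≤ y.J + y.K

theorem Room.sg {p q : ℤ} {z y : Alc} (h : Room p q z y) : Room q p (sg z) (sg y) := ⟨h.2, h.1⟩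

theorem Room.le {p q : ℤ} {z y : Alc} (h : Room p q z y) (hz : Dom z) (hy : Dom y)
    (hp : 0 ≤ p) (hq : 0 ≤ q) : Le z y :=
  hz.le hy (by have := h.1; omega) (by have := h.2; omega)

namespace Iso

variable {x y x' y' : Alc}

/-- An even dominant element has at least five covers. -/
theorem five (F : Iso x y x' y') {u : Alc} (hy : Dom y) (hu : Dom u) (hxu : Le x u)
    (hr : Room 3 3 u y) {T : List Alc} (hT : CovIn (F.f u) T) :
    5 ≤ T.length ∧ (T.length = 5 → ∀ t ∈ T, ∃ w, Cov u w ∧ Mem x y w ∧ F.f w = t) := by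
  have hm : Mem x y u := ⟨hxu, hr.le hu hy (by norm_num) (by norm_num)⟩
  have hc := dom_cov hu
  have hall : ∀ w ∈ [t1 u.I u, t2 u.J u, t1 (-1) u, t2 (-1) u, t3 (-1) u], Cov u w ∧ Le w y := by
    intro w hw
    have : Cov u w := by
      simp only [List.mem_cons, List.not_mem_nil, or_false] at hw
      rcases hw with rfl | rfl | rfl | rfl | rfl
      exacts [hc.1, hc.2.1, hc.2.2.1, hc.2.2.2.1, hc.2.2.2.2.1]
    exact ⟨this, this.le_of_room hu hy hr.1 hr.2⟩
  have := F.count hm (nodup_dom hu) hall hT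
  refine ⟨this.1, fun h t ht => ?_⟩
  obtain ⟨w, hw, e⟩ := this.2 (by simp [h]) t ht
  exact ⟨w, (hall w hw).1, mem_trans hm (hall w hw).1.edge.le (hall w hw).2, e⟩

/-- An odd dominant element has at least six covers. -/
theorem six (F : Iso x y x' y') {u : Alc} (hy : Dom y) (hu : TH u) (hxu : Le x u)
    (hr : Room 3 3 u y) {T : List Alc} (hT : CovIn (F.f u) T) :
    6 ≤ T.length ∧ (T.length = 6 → ∀ t ∈ T, ∃ w, Cov u w ∧ Mem x y w ∧ F.f w = t) := by
  have hm : Mem x y u := ⟨hxu, hr.le hu.dom hy (by norm_num) (by norm_num)⟩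
  have hc := dom_cov hu.dom
  have hall : ∀ w ∈ [t1 u.I u, t2 u.J u, t1 (-1) u, t2 (-1) u, t3 (-1) u, t3 u.K u],
      Cov u w ∧ Le w y := by
    intro w hw
    have : Cov u w := by
      simp only [List.mem_cons, List.not_mem_nil, or_false] at hw
      rcases hw with rfl | rfl | rfl | rfl | rfl | rfl
      exacts [hc.1, hc.2.1, hc.2.2.1, hc.2.2.2.1, hc.2.2.2.2.1, hc.2.2.2.2.2 hu.1]
    exact ⟨this, this.le_of_room hu.dom hy hr.1 hr.2⟩
  have := F.count hm (nodup_odd hu) hall hT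
  refine ⟨this.1, fun h t ht => ?_⟩
  obtain ⟨w, hw, e⟩ := this.2 (by simp [h]) t ht
  exact ⟨w, (hall w hw).1, mem_trans hm (hall w hw).1.edge.le (hall w hw).2, e⟩

/-- The image of `rc w` is not `rb` of the image of `w`. -/
theorem rc_ne_rb (F : Iso x y x' y') {w : Alc} (hy : Dom y) (hw : TH w) (hxw : Le x w)
    (hr : Room 4 4 w y) (hw' : TH (F.f w)) (hI : 2 ≤ (F.f w).I) :
    F.f (rc w) ≠ rb (F.f w) := by
  intro e
  have hrc := hw.ts_rc
  have hc : Cov w (rc w) := (dom_cov hw.dom).2.2.2.2.2 hw.1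
  have hrw : Room 3 3 w y := ⟨by have := hr.1; omega, by have := hr.2; omega⟩
  have hrr : Room 3 3 (rc w) y := by
    obtain ⟨h1, h2⟩ := hr
    obtain ⟨h3, -⟩ := hw
    simp only [Room, Alc.rc, t3]; omega
  obtain ⟨p1, p2, hne, h1, h2, h3, h4⟩ := two_common hw' hI
  obtain ⟨q, hq, hqm, eq⟩ := (F.six hy hw hxw hrw (covIn_dom hw'.dom)).2 rfl (t2 (-1) (F.f w))
    (by simp)
  have hqc : q ≠ rc w := by
    rintro rfl
    rw [eq] at e
    obtain ⟨k1, k2, k3⟩ := hw'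
    simp only [t2, Alc.rb, Alc.mk.injEq] at e
    omega
  have hd : TS (rb (F.f w)) := by
    obtain ⟨hK, -, hJ⟩ := hw'
    simp only [TS, Alc.rb, t2]; omega
  obtain ⟨T, hTl, hT⟩ : ∃ T, T.length = 5 ∧ CovIn (rb (F.f w)) T :=
    ⟨_, rfl, covIn_dom_even hd.dom hd.1⟩
  have h5 := (F.five hy hrc.dom (hxw.trans hc.edge.le) hrr (e.symm ▸ hT)).2 hTl
  have hm : Mem x y (rc w) :=
    ⟨hxw.trans hc.edge.le, hrr.le hrc.dom hy (by norm_num) (by norm_num)⟩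
  obtain ⟨r1, k1, m1, e1⟩ := h5 p1 (hT _ h1)
  obtain ⟨r2, k2, m2, e2⟩ := h5 p2 (hT _ h2)
  have j1 : Cov q r1 := (F.cov_iff hqm m1).1 (by rw [eq, e1]; exact h3)
  have j2 : Cov q r2 := (F.cov_iff hqm m2).1 (by rw [eq, e2]; exact h4)
  have := common_unique hw hq hqc k1 j1 k2 j2
  exact hne (by rw [← e1, ← e2, this])

theorem rc_ne_ra (F : Iso x y x' y') {w : Alc} (hy : Dom y) (hw : TH w) (hxw : Le x w)
    (hr : Room 4 4 w y) (hw' : TH (F.f w)) (hJ : 2 ≤ (F.f w).J) :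
    F.f (rc w) ≠ ra (F.f w) := by
  intro e
  refine F.sg.rc_ne_rb (w := Alc.sg w) hy.sg hw.sg hxw.sg hr.sg hw'.sg hJ ?_
  exact congrArg Alc.sg e

end Iso

theorem sg_tr (a b : ℤ) (z : Alc) : sg (tr a b z) = tr b a (sg z) := by
  ext <;> simp only [sg, tr]; ring
theorem ra_tr (a b : ℤ) (z : Alc) : ra (tr a b z) = tr a b (ra z) := by
  ext <;> simp only [ra, t1, tr] <;> ring
theorem rb_tr (a b : ℤ) (z : Alc) : rb (tr a b z) = tr a b (rb z) := by
  ext <;> simp only [rb, t2, tr] <;> ring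
theorem rc_tr (a b : ℤ) (z : Alc) : rc (tr a b z) = tr a b (rc z) := by
  ext <;> simp only [rc, t3, tr] <;> ring

theorem TS.ts_tr {z : Alc} (h : TS z) {a b : ℤ} (ha : 1 ≤ z.I + a) (hb : 1 ≤ z.J + b) :
    TS (tr a b z) := by
  obtain ⟨hK, -, -⟩ := h; simp only [TS, tr]; omega

theorem TH.th_tr {z : Alc} (h : TH z) {a b : ℤ} (ha : 1 ≤ z.I + a) (hb : 1 ≤ z.J + b) :
    TH (tr a b z) := by
  obtain ⟨hK, -, -⟩ := h; simp only [TH, tr]; omega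

theorem Dom.cov_ra {z : Alc} (h : Dom z) : Cov z (ra z) := (dom_cov h).1
theorem Dom.cov_rb {z : Alc} (h : Dom z) : Cov z (rb z) := (dom_cov h).2.1
theorem TH.cov_rc {z : Alc} (h : TH z) : Cov z (rc z) := (dom_cov h.dom).2.2.2.2.2 h.1

theorem TS.ra_rb {v : Alc} (h : TS v) : ra (rb v) = rc (ra v) := by
  obtain ⟨hK, -, -⟩ := h
  ext <;> simp only [ra, rb, rc, t1, t2, t3] <;> omega
theorem TS.rb_ra {v : Alc} (h : TS v) : rb (ra v) = rc (rb v) := by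
  obtain ⟨hK, -, -⟩ := h
  ext <;> simp only [ra, rb, rc, t1, t2, t3] <;> omega
theorem TH.rb_ra {v : Alc} (h : TH v) : rb (ra v) = ra (rc v) := by
  obtain ⟨hK, -, -⟩ := h
  ext <;> simp only [ra, rb, rc, t1, t2, t3] <;> omega
theorem TS.ra_rc_rb {v : Alc} (h : TS v) : ra (rc (rb v)) = rb (rc (ra v)) := by
  obtain ⟨hK, -, -⟩ := h
  ext <;> simp only [ra, rb, rc, t1, t2, t3] <;> omega
theorem TS.rc_ra {v : Alc} (h : TS v) : rc (ra v) = tr 1 0 v := by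
  obtain ⟨hK, -, -⟩ := h
  ext <;> simp only [ra, rc, t1, t3, tr] <;> omega
theorem TS.rc_rb {v : Alc} (h : TS v) : rc (rb v) = tr 0 1 v := by
  obtain ⟨hK, -, -⟩ := h
  ext <;> simp only [rb, rc, t2, t3, tr] <;> omega
theorem Dom.ra_ne_rb {v : Alc} (h : Dom v) : ra v ≠ rb v := by
  obtain ⟨hv, hI, hJ⟩ := h
  unfold V at hv
  simp only [ra, rb, t1, t2, ne_eq, Alc.mk.injEq]; omega

namespace Iso

variable {x y x' y' : Alc}

/-- `F` acts as the translation by `a ϖ₁ + b ϖ₂` on the even element `v` and its two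
dominant covers. -/
structure H (F : Iso x y x' y') (a b : ℤ) (v : Alc) : Prop where
  ts : TS v
  xv : Le x v
  I_pos : 1 ≤ v.I + a
  J_pos : 1 ≤ v.J + b
  eq : F.f v = tr a b v
  eqa : F.f (ra v) = tr a b (ra v)
  eqb : F.f (rb v) = tr a b (rb v)

theorem H.sg {F : Iso x y x' y'} {a b : ℤ} {v : Alc} (h : F.H a b v) :
    F.sg.H b a (Alc.sg v) where
  ts := h.ts.sg
  xv := h.xv.sg
  I_pos := h.J_pos
  J_pos := h.I_pos
  eq := (congrArg Alc.sg h.eq).trans (sg_tr a b v)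
  eqa := (congrArg Alc.sg h.eqb).trans (sg_tr a b _)
  eqb := (congrArg Alc.sg h.eqa).trans (sg_tr a b _)

theorem H.of_sg {F : Iso x y x' y'} {a b : ℤ} {v : Alc} (h : F.sg.H b a (Alc.sg v)) :
    F.H a b v := by
  have := h.sg
  exact ⟨this.ts, this.xv, this.I_pos, this.J_pos, this.eq, this.eqa, this.eqb⟩

theorem H.of_rb {F : Iso x y x' y'} {a b : ℤ} {v : Alc} (hy : Dom y) (hv : TS v) (hxv : Le x v)
    (hI : 1 ≤ v.I + a) (hJ : 1 ≤ v.J + b) (e : F.f v = tr a b v)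
    (eb : F.f (rb v) = tr a b (rb v)) (hr : Room 3 3 (ra v) y) (hr' : Room 0 0 (rb v) y) :
    F.H a b v := by
  refine ⟨hv, hxv, hI, hJ, e, ?_, eb⟩
  have hm : Mem x y (ra v) :=
    ⟨hxv.trans hv.dom.cov_ra.edge.le, hr.le hv.th_ra.dom hy (by norm_num) (by norm_num)⟩
  have hmb : Mem x y (rb v) :=
    ⟨hxv.trans hv.dom.cov_rb.edge.le, hr'.le hv.th_rb.dom hy (by norm_num) (by norm_num)⟩
  have hmv : Mem x y v := ⟨hxv, hv.dom.cov_ra.edge.le.trans hm.2⟩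
  have hc := F.cov hmv hm.2 hv.dom.cov_ra
  rw [e] at hc
  have ht : TS (tr a b v) := hv.ts_tr hI hJ
  have h6 : ∀ l : List Alc, l.length = 4 → ¬ CovIn (F.f (ra v)) l := by
    intro l hl hT
    have := (F.six hy hv.th_ra hm.1 hr hT).1
    omega
  obtain ⟨⟨l1, n1, k1⟩, ⟨l2, n2, k2⟩, ⟨l3, n3, k3⟩⟩ := few_covers ht
  have := covIn_dom_even ht.dom ht.1 _ hc
  simp only [List.mem_cons, List.not_mem_nil, or_false] at this
  rcases this with h | h | h | h | h
  · rw [h]; exact ra_tr a b v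
  · exact absurd (F.inj hm hmb (by rw [h, eb]; exact rb_tr a b v)) hv.dom.ra_ne_rb
  · exact absurd (h ▸ k1) (h6 l1 n1)
  · exact absurd (h ▸ k2) (h6 l2 n2)
  · exact absurd (h ▸ k3) (h6 l3 n3)

theorem H.rc_ra {F : Iso x y x' y'} {a b : ℤ} {v : Alc} (hy : Dom y) (h : F.H a b v)
    (hr : Room 5 4 v y) : F.f (rc (ra v)) = tr a b (rc (ra v)) := by
  obtain ⟨hv, hxv, hI, hJ, e, ea, eb⟩ := h
  have hK := hv.1
  have hra : Room 4 4 (ra v) y := by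
    obtain ⟨h1, h2⟩ := hr
    simp only [Room, ra, t1]; omega
  have hla : Le (ra v) y := hra.le hv.th_ra.dom hy (by norm_num) (by norm_num)
  have hlb : Le (rb v) y := by
    refine Room.le (p := 0) (q := 0) ?_ hv.th_rb.dom hy le_rfl le_rfl
    obtain ⟨h1, h2⟩ := hr
    simp only [Room, rb, t2]; omega
  have hlc : Le (rc (ra v)) y := by
    refine Room.le (p := 0) (q := 0) ?_ hv.th_ra.ts_rc.dom hy le_rfl le_rfl
    obtain ⟨h1, h2⟩ := hr
    simp only [Room, ra, t1, rc, t3]; omega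
  have hma : Mem x y (ra v) := ⟨hxv.trans hv.dom.cov_ra.edge.le, hla⟩
  have hmb : Mem x y (rb v) := ⟨hxv.trans hv.dom.cov_rb.edge.le, hlb⟩
  have c1 := F.cov hma hlc hv.th_ra.cov_rc
  have c2 := F.cov hmb hlc (hv.ra_rb ▸ hv.th_rb.dom.cov_ra)
  rw [ea, ← ra_tr] at c1
  rw [eb, ← rb_tr] at c2
  have ht : TS (tr a b v) := hv.ts_tr hI hJ
  rcases common_ab ht c1 c2 with k | k
  · rw [k, ra_tr, rc_tr]
  · have e' : F.f (ra v) = ra (tr a b v) := ea.trans (ra_tr a b v).symm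
    refine absurd ?_ (F.rc_ne_rb hy hv.th_ra hma.1 hra (e' ▸ ht.th_ra) ?_)
    · rw [k, e', ht.rb_ra]
    · rw [ea]; simp only [tr, ra, t1]; omega

theorem H.rc_rb {F : Iso x y x' y'} {a b : ℤ} {v : Alc} (hy : Dom y) (h : F.H a b v)
    (hr : Room 4 5 v y) : F.f (rc (rb v)) = tr a b (rc (rb v)) := by
  have := h.sg.rc_ra hy.sg hr.sg
  exact (congrArg Alc.sg this).trans (sg_tr b a _)

theorem H.rb_rc_ra {F : Iso x y x' y'} {a b : ℤ} {v : Alc} (hy : Dom y) (h : F.H a b v)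
    (hr : Room 5 5 v y) : F.f (rb (rc (ra v))) = tr a b (rb (rc (ra v))) := by
  have e1 := h.rc_ra hy ⟨hr.1, by have := hr.2; omega⟩
  have e2 := h.rc_rb hy ⟨by have := hr.1; omega, hr.2⟩
  obtain ⟨hv, hxv, hI, hJ, e, ea, eb⟩ := h
  have hK := hv.1
  have c1 := hv.th_ra.ts_rc.dom.cov_rb
  have c2 := hv.th_rb.ts_rc.dom.cov_ra
  rw [hv.ra_rc_rb] at c2
  have hl : Le (rb (rc (ra v))) y := by
    refine Room.le (p := 0) (q := 0) ?_ hv.th_ra.ts_rc.th_rb.dom hy le_rfl le_rfl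
    obtain ⟨h1, h2⟩ := hr
    simp only [Room, ra, t1, rc, t3, rb, t2]; omega
  have m1 : Mem x y (rc (ra v)) :=
    ⟨(hxv.trans hv.dom.cov_ra.edge.le).trans hv.th_ra.cov_rc.edge.le, c1.edge.le.trans hl⟩
  have m2 : Mem x y (rc (rb v)) :=
    ⟨(hxv.trans hv.dom.cov_rb.edge.le).trans hv.th_rb.cov_rc.edge.le, c2.edge.le.trans hl⟩
  have d1 := F.cov m1 hl c1
  have d2 := F.cov m2 hl c2
  rw [e1, ← rc_tr, ← ra_tr] at d1
  rw [e2, ← rc_tr, ← rb_tr] at d2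
  rw [common_cc (hv.ts_tr hI hJ) d1 d2, ra_tr, rc_tr, rb_tr]

theorem H.step_one {F : Iso x y x' y'} {a b : ℤ} {v : Alc} (hy : Dom y) (h : F.H a b v)
    (hr : Room 6 5 v y) : F.H a b (rc (ra v)) := by
  have e1 := h.rc_ra hy ⟨by have := hr.1; omega, by have := hr.2; omega⟩
  have e2 := h.rb_rc_ra hy ⟨by have := hr.1; omega, hr.2⟩
  obtain ⟨hv, hxv, hI, hJ, e, ea, eb⟩ := h
  obtain ⟨h1, h2⟩ := hr
  have hK := hv.1
  refine H.of_rb hy hv.th_ra.ts_rc ((hxv.trans hv.dom.cov_ra.edge.le).trans hv.th_ra.cov_rc.edge.le)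
    ?_ ?_ e1 e2 ?_ ?_ <;> simp only [Room, ra, t1, rc, t3, rb, t2] <;> omega

theorem H.step_two {F : Iso x y x' y'} {a b : ℤ} {v : Alc} (hy : Dom y) (h : F.H a b v)
    (hr : Room 5 6 v y) : F.H a b (rc (rb v)) :=
  (h.sg.step_one hy.sg hr.sg : F.sg.H b a (Alc.sg (rc (rb v)))).of_sg

theorem H.down_one {F : Iso x y x' y'} {a b : ℤ} {w : Alc} (hy : Dom y) (hw : TH w)
    (hxw : Le x w) (e : F.f w = tr a b w) (h : F.H a b (rc w)) (hJ : 2 ≤ w.J)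
    (hr : Room 5 3 w y) :
    2 ≤ w.J + b ∧ F.f (ra w) = tr a b (ra w) := by
  have hI0 := h.I_pos
  have hJ0 := h.J_pos
  have hK := hw.1
  obtain ⟨h1, h2⟩ := hr
  simp only [rc, t3] at hI0 hJ0
  have hTS : TS (ra w) := by
    obtain ⟨-, h3, h4⟩ := hw
    simp only [TS, ra, t1]; omega
  have hr3 : Room 3 3 (ra w) y := by simp only [Room, ra, t1]; omega
  have hl : Le (rb (ra w)) y := by
    refine Room.le (p := 0) (q := 0) ?_ hTS.th_rb.dom hy le_rfl le_rfl
    simp only [Room, ra, t1, rb, t2]; omega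
  have hma : Mem x y (ra w) :=
    ⟨hxw.trans hw.dom.cov_ra.edge.le, hTS.dom.cov_rb.edge.le.trans hl⟩
  have hmw : Mem x y w := ⟨hxw, hw.dom.cov_ra.edge.le.trans hma.2⟩
  have hmc : Mem x y (rc w) := by
    refine ⟨h.xv, Room.le (p := 0) (q := 0) ?_ h.ts.dom hy le_rfl le_rfl⟩
    simp only [Room, rc, t3]; omega
  have c1 := F.cov hmw hma.2 hw.dom.cov_ra
  have c2 := F.cov hma hl hTS.dom.cov_rb
  rw [hw.rb_ra, h.eqa, ← ra_tr, ← rc_tr] at c2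
  rw [e] at c1
  have htw : TH (tr a b w) := hw.th_tr (by omega) (by omega)
  have ef : F.f (ra w) = tr a b (ra w) := by
    rcases between_ac htw c1 c2 with k | k
    · exfalso
      have := F.inj hma hmc (by rw [k, h.eq, rc_tr])
      simp only [ra, t1, rc, t3, Alc.mk.injEq] at this
      omega
    · rw [k, ra_tr]
  refine ⟨?_, ef⟩
  by_contra hc
  have hT : CovIn (F.f (ra w)) _ := ef ▸ covIn_wall2 (z := tr a b (ra w))
    (by simp only [tr, ra, t1]; omega) (by simp only [tr, ra, t1]; omega)
    (by simp only [tr, ra, t1]; omega)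
  have := (F.five hy hTS.dom hma.1 hr3 hT).1
  norm_num at this

theorem H.slide_one {F : Iso x y x' y'} {a b : ℤ} {w : Alc} (hy : Dom y) (hw : TH w)
    (hxw : Le x w) (e : F.f w = tr a b w) (h : F.H a b (rc w)) (hJ : 2 ≤ w.J)
    (hr : Room 6 3 w y) : F.H a b (ra w) := by
  obtain ⟨h1, h2⟩ := hr
  have k := h.down_one hy hw hxw e hJ ⟨by omega, by omega⟩
  have hI0 := h.I_pos
  have hK := hw.1
  have eb := h.eqa
  rw [← hw.rb_ra] at eb
  simp only [rc, t3] at hI0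
  have hTS : TS (ra w) := by
    obtain ⟨-, h3, h4⟩ := hw
    simp only [TS, ra, t1]; omega
  refine H.of_rb hy hTS (hxw.trans hw.dom.cov_ra.edge.le) ?_ ?_ k.2 eb ?_ ?_ <;>
    simp only [Room, ra, t1, rb, t2] <;> omega

theorem H.down_two {F : Iso x y x' y'} {a b : ℤ} {w : Alc} (hy : Dom y) (hw : TH w)
    (hxw : Le x w) (e : F.f w = tr a b w) (h : F.H a b (rc w)) (hI : 2 ≤ w.I)
    (hr : Room 3 5 w y) :
    2 ≤ w.I + a ∧ F.f (rb w) = tr a b (rb w) := by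
  have := H.down_one (F := F.sg) (w := Alc.sg w) hy.sg hw.sg hxw.sg
    ((congrArg Alc.sg e).trans (sg_tr a b _)) h.sg hI hr.sg
  exact ⟨this.1, (congrArg Alc.sg this.2).trans (sg_tr b a _)⟩

theorem H.slide_two {F : Iso x y x' y'} {a b : ℤ} {w : Alc} (hy : Dom y) (hw : TH w)
    (hxw : Le x w) (e : F.f w = tr a b w) (h : F.H a b (rc w)) (hI : 2 ≤ w.I)
    (hr : Room 3 6 w y) : F.H a b (rb w) :=
  (H.slide_one (F := F.sg) (w := Alc.sg w) hy.sg hw.sg hxw.sg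
    ((congrArg Alc.sg e).trans (sg_tr a b _)) h.sg hI hr.sg :
      F.sg.H b a (Alc.sg (rb w))).of_sg

end Iso

theorem TS.rb_rb {v : Alc} (h : TS v) : rb (rb v) = tr (-1) 2 v := by
  obtain ⟨hK, -, -⟩ := h
  ext <;> simp only [rb, t2, tr] <;> omega

theorem TS.eq_of {v w : Alc} (hv : TS v) (hw : TS w) (hI : v.I = w.I) (hJ : v.J = w.J) :
    v = w := by
  have h1 := hv.1
  have h2 := hw.1
  ext <;> omega

namespace Iso

variable {x y x' y' : Alc} {F : Iso x y x' y'} {a b : ℤ}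

theorem H.move_one (hy : Dom y) {v0 v1 : Alc} (h : F.H a b v0) (hv1 : TS v1)
    (hJ : v0.J ≤ v1.J) (hP : v0.I + v0.K ≤ v1.I + v1.K) (hr : Room 5 4 v1 y) : F.H a b v1 := by
  obtain ⟨n, hn⟩ : ∃ n : ℕ, v1.K - v0.K = n :=
    ⟨(v1.K - v0.K).toNat, by have := h.ts.1; have := hv1.1; omega⟩
  induction n generalizing v0 with
  | zero =>
    have := h.ts.1
    have := hv1.1
    rwa [← h.ts.eq_of hv1 (by push_cast at hn; omega) (by push_cast at hn; omega)]
  | succ n ih =>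
    obtain ⟨r1, r2⟩ := hr
    have k0 := h.ts.1
    have k1 := hv1.1
    push_cast at hn
    by_cases c : v0.I < v1.I
    · have h' := h.step_one hy ⟨by omega, by omega⟩
      rw [h.ts.rc_ra] at h'
      refine ih h' ?_ ?_ ?_ <;> simp only [tr] <;> omega
    · have h' := h.step_two hy ⟨by omega, by omega⟩
      by_cases c' : v0.I + v0.K < v1.I + v1.K
      · rw [h.ts.rc_rb] at h'
        refine ih h' ?_ ?_ ?_ <;> simp only [tr] <;> omega
      · have hI1 := hv1.2.1
        have h'' := h'.slide_two hy h.ts.th_rb (h.xv.trans h.ts.dom.cov_rb.edge.le) h.eqb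
          (by simp only [rb, t2]; omega) ⟨by simp only [rb, t2]; omega, by simp only [rb, t2]; omega⟩
        rw [h.ts.rb_rb] at h''
        refine ih h'' ?_ ?_ ?_ <;> simp only [tr] <;> omega

theorem H.move_two (hy : Dom y) {v0 v1 : Alc} (h : F.H a b v0) (hv1 : TS v1)
    (hI : v0.I ≤ v1.I) (hQ : v0.J + v0.K ≤ v1.J + v1.K) (hr : Room 4 5 v1 y) : F.H a b v1 :=
  (h.sg.move_one hy.sg hv1.sg hI hQ hr.sg).of_sg

theorem H.move (hy : Dom y) {v0 v1 : Alc} (h : F.H a b v0) (hv1 : TS v1)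
    (hP : v0.I + v0.K ≤ v1.I + v1.K) (hQ : v0.J + v0.K ≤ v1.J + v1.K) (hr : Room 5 5 v1 y) :
    F.H a b v1 := by
  obtain ⟨r1, r2⟩ := hr
  have k0 := h.ts.1
  have k1 := hv1.1
  by_cases c : v0.J ≤ v1.J
  · exact h.move_one hy hv1 c hP ⟨r1, by omega⟩
  · exact h.move_two hy hv1 (by omega) hQ ⟨by omega, r2⟩

/-- The image of an even element on which `F` is a translation stays away from the wall. -/
theorem H.wall_one (hy : Dom y) {v : Alc} (h : F.H a b v) (hI : 2 ≤ v.I) (hr : Room 5 6 v y) :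
    2 ≤ v.I + a := by
  have h' := h.step_two hy hr
  obtain ⟨r1, r2⟩ := hr
  have k := h.ts.1
  have := (h'.down_two hy h.ts.th_rb (h.xv.trans h.ts.dom.cov_rb.edge.le) h.eqb
          (by simp only [rb, t2]; omega)
          ⟨by simp only [rb, t2]; omega, by simp only [rb, t2]; omega⟩).1
  simp only [rb, t2] at this
  omega

end Iso

/-- An involution of the set of alcoves that preserves lengths and reflections. -/
def io (κ : ℤ) (z : Alc) : Alc :=
  if z.K = z.I + z.J then
    if (z.I - z.J - κ) % 3 = 0 then ⟨-z.J, -z.I, -z.K⟩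
    else if (z.I - z.J - κ) % 3 = 1 then ⟨z.K, -z.J, z.I⟩ else ⟨-z.I, z.K, z.J⟩
  else
    if (z.I - z.J - κ) % 3 = 0 then z
    else if (z.I - z.J - κ) % 3 = 1 then ⟨-z.K, z.I, -z.J⟩ else ⟨z.J, -z.K, -z.I⟩

theorem io_cases (κ : ℤ) {z : Alc} (h : z.V) :
    (z.K = z.I + z.J ∧ (z.I - z.J - κ) % 3 = 0 ∧ io κ z = ⟨-z.J, -z.I, -z.K⟩) ∨
    (z.K = z.I + z.J ∧ (z.I - z.J - κ) % 3 = 1 ∧ io κ z = ⟨z.K, -z.J, z.I⟩) ∨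
    (z.K = z.I + z.J ∧ (z.I - z.J - κ) % 3 = 2 ∧ io κ z = ⟨-z.I, z.K, z.J⟩) ∨
    (z.K = z.I + z.J - 1 ∧ (z.I - z.J - κ) % 3 = 0 ∧ io κ z = z) ∨
    (z.K = z.I + z.J - 1 ∧ (z.I - z.J - κ) % 3 = 1 ∧ io κ z = ⟨-z.K, z.I, -z.J⟩) ∨
    (z.K = z.I + z.J - 1 ∧ (z.I - z.J - κ) % 3 = 2 ∧ io κ z = ⟨z.J, -z.K, -z.I⟩) := by
  unfold V at h
  unfold io
  split_ifs with h1 h2 h3 h2 h3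
  · exact Or.inl ⟨h1, h2, rfl⟩
  · exact Or.inr (Or.inl ⟨h1, h3, rfl⟩)
  · exact Or.inr (Or.inr (Or.inl ⟨h1, by omega, rfl⟩))
  · exact Or.inr (Or.inr (Or.inr (Or.inl ⟨by omega, h2, rfl⟩)))
  · exact Or.inr (Or.inr (Or.inr (Or.inr (Or.inl ⟨by omega, h3, rfl⟩))))
  · exact Or.inr (Or.inr (Or.inr (Or.inr (Or.inr ⟨by omega, by omega, rfl⟩))))

theorem V.io (κ : ℤ) {z : Alc} (h : z.V) : (io κ z).V := by
  rcases io_cases κ h with ⟨h1, -, e⟩ | ⟨h1, -, e⟩ | ⟨h1, -, e⟩ | ⟨h1, -, e⟩ | ⟨h1, -, e⟩ |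
    ⟨h1, -, e⟩ <;> rw [e] <;> simp only [V] <;> omega

theorem L_io (κ : ℤ) {z : Alc} (h : z.V) : (io κ z).L = z.L := by
  rcases io_cases κ h with ⟨-, -, e⟩ | ⟨-, -, e⟩ | ⟨-, -, e⟩ | ⟨-, -, e⟩ | ⟨-, -, e⟩ |
    ⟨-, -, e⟩ <;> rw [e] <;> simp only [L, abs_neg] <;> ring

theorem io_io (κ : ℤ) {z : Alc} (h : z.V) : io κ (io κ z) = z := by
  have h' := h.io κ
  rcases io_cases κ h with ⟨h1, h2, e⟩ | ⟨h1, h2, e⟩ | ⟨h1, h2, e⟩ | ⟨h1, h2, e⟩ | ⟨h1, h2, e⟩ |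
    ⟨h1, h2, e⟩ <;> rw [e] at h' ⊢ <;>
  rcases io_cases κ h' with ⟨h1', h2', e'⟩ | ⟨h1', h2', e'⟩ | ⟨h1', h2', e'⟩ | ⟨h1', h2', e'⟩ |
    ⟨h1', h2', e'⟩ | ⟨h1', h2', e'⟩ <;> rw [e'] <;> (try simp only at h1' h2') <;>
  first
  | (exfalso; omega)
  | (ext <;> simp)

theorem rfl_of {z w : Alc}
    (h : (w.I = 2 * (z.K - w.J) + 1 - z.I ∧ w.K = z.J + (z.K - w.J)) ∨
      (w.J = 2 * (z.K - w.I) + 1 - z.J ∧ w.K = z.I + (z.K - w.I)) ∨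
      (w.I + z.J = z.I + w.J ∧ w.K = 2 * (z.I + w.J - 1) + 1 - z.K)) : Rfl z w := by
  rcases h with ⟨h1, h2⟩ | ⟨h1, h2⟩ | ⟨h1, h2⟩
  · exact Or.inl ⟨z.K - w.J, by ext <;> simp only [t1] <;> omega⟩
  · exact Or.inr (Or.inl ⟨z.K - w.I, by ext <;> simp only [t2] <;> omega⟩)
  · exact Or.inr (Or.inr ⟨z.I + w.J - 1, by ext <;> simp only [t3] <;> omega⟩)

theorem Rfl.io (κ : ℤ) {z w : Alc} (hR : Rfl z w) (hz : z.V) : Rfl (io κ z) (io κ w) := by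
  have hw := hR.valid hz
  apply rfl_of
  rcases hR with ⟨m, rfl⟩ | ⟨m, rfl⟩ | ⟨m, rfl⟩ <;>
  rcases io_cases κ hz with ⟨h1, h2, e⟩ | ⟨h1, h2, e⟩ | ⟨h1, h2, e⟩ | ⟨h1, h2, e⟩ | ⟨h1, h2, e⟩ |
    ⟨h1, h2, e⟩ <;>
  rcases io_cases κ hw with ⟨h1', h2', e'⟩ | ⟨h1', h2', e'⟩ | ⟨h1', h2', e'⟩ | ⟨h1', h2', e'⟩ |
    ⟨h1', h2', e'⟩ | ⟨h1', h2', e'⟩ <;> simp only [e, e'] <;> simp only [t1, t2, t3] at h1' h2' ⊢ <;>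
  omega

theorem Edge.io (κ : ℤ) {z w : Alc} (h : Edge z w) : Edge (io κ z) (io κ w) :=
  ⟨h.1.io κ, h.2.1.io κ h.1, by rw [L_io κ h.1, L_io κ (h.2.1.valid h.1)]; exact h.2.2⟩

theorem Le.io (κ : ℤ) {z w : Alc} (h : Le z w) : Le (io κ z) (io κ w) := by
  induction h with
  | refl => exact Le.refl _
  | tail _ h ih => exact ih.trans (h.io κ).le

theorem sg_io (κ : ℤ) {z : Alc} (h : z.V) : io (-κ) (sg z) = sg (io κ z) := by
  rcases io_cases κ h with ⟨h1, h2, e⟩ | ⟨h1, h2, e⟩ | ⟨h1, h2, e⟩ | ⟨h1, h2, e⟩ | ⟨h1, h2, e⟩ |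
    ⟨h1, h2, e⟩ <;>
  rcases io_cases (-κ) h.sg with ⟨h1', h2', e'⟩ | ⟨h1', h2', e'⟩ | ⟨h1', h2', e'⟩ | ⟨h1', h2', e'⟩ |
    ⟨h1', h2', e'⟩ | ⟨h1', h2', e'⟩ <;> rw [e, e'] <;> simp only [sg] at h1' h2' ⊢ <;>
  (exfalso; omega)

namespace Iso

variable {x y x' y' : Alc}

theorem hy' (F : Iso x y x' y') : y'.V :=
  have hm := F.hf x ⟨Le.refl x, F.hxy⟩
  have hv := F.hx'
  (hm.1.trans hm.2).valid hv

/-- Postcomposition with an involution that preserves the Bruhat order. -/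
def post (F : Iso x y x' y') (φ : Alc → Alc) (hV : ∀ z, z.V → (φ z).V)
    (hφ : ∀ z, z.V → φ (φ z) = z) (hle : ∀ z w, Le z w → Le (φ z) (φ w)) :
    Iso x y (φ x') (φ y') :=
  have hm : ∀ z, Mem (φ x') (φ y') z → Mem x' y' (φ z) := fun z hz =>
    ⟨hφ _ F.hx' ▸ hle _ _ hz.1, hφ _ F.hy' ▸ hle _ _ hz.2⟩
  have hi : ∀ z, Mem (φ x') (φ y') z → φ (φ z) = z := fun z hz =>
    hφ _ (hz.1.valid (hV _ F.hx'))
  { f := fun z => φ (F.f z)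
    g := fun z => F.g (φ z)
    hx := F.hx
    hx' := hV _ F.hx'
    hxy := F.hxy
    hf := fun z hz => ⟨hle _ _ (F.hf z hz).1, hle _ _ (F.hf z hz).2⟩
    hg := fun z hz => F.hg _ (hm z hz)
    gf := fun z hz => by rw [hφ _ ((F.hf z hz).1.valid F.hx'), F.gf z hz]
    fg := fun z hz => by rw [F.fg _ (hm z hz), hi z hz]
    f_le := fun z w hz hw h => hle _ _ (F.f_le z w hz hw h)
    g_le := fun z w hz hw h => F.g_le _ _ (hm z hz) (hm w hw) (hle _ _ h) }

/-- Postcomposition with the diagram automorphism. -/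
def postSg (F : Iso x y x' y') : Iso x y (Alc.sg x') (Alc.sg y') :=
  F.post Alc.sg (fun _ h => h.sg) (fun _ _ => rfl) (fun _ _ h => h.sg)

/-- Postcomposition with `io κ`. -/
def postIo (F : Iso x y x' y') (κ : ℤ) : Iso x y (io κ x') (io κ y') :=
  F.post (io κ) (fun _ h => h.io κ) (fun _ h => io_io κ h) (fun _ _ h => h.io κ)

end Iso

theorem Dom.L_eq {z : Alc} (h : Dom z) : z.L = z.I + z.J + z.K := by
  obtain ⟨hv, h1, h2⟩ := h
  unfold V at hv
  rw [L, abs_of_pos (by omega), abs_of_pos (by omega), abs_of_pos (by omega)]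

theorem eq_tr_of_le {u Y : Alc} (hu : Dom u) (hY : Dom Y) (hL : Y.L = u.L + 4)
    (h : Le (t3 (-1) u) Y) : Y = tr 1 1 u := by
  have hin := h.in hY.in
  rw [hY.L_eq, hu.L_eq] at hL
  obtain ⟨hv, h1, h2⟩ := hu
  obtain ⟨hv', h1', h2'⟩ := hY
  unfold V at hv hv'
  simp only [In, t3] at hin
  ext <;> simp only [tr] <;> omega

theorem eq_tr_of_io_le {κ : ℤ} {u Y : Alc} (hu : Dom u) (hY : Dom Y) (hL : Y.L = u.L + 4)
    (h : ∀ t ∈ [t1 u.I u, t2 u.J u, t1 (-1) u, t2 (-1) u, t3 (-1) u], Le (io κ t) Y) : Y = tr 1 1 u := by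
  have hc := dom_cov hu
  have v1 := hc.1.edge.valid
  have v2 := hc.2.1.edge.valid
  have v3 := hc.2.2.1.edge.valid
  have v4 := hc.2.2.2.1.edge.valid
  have v5 := hc.2.2.2.2.1.edge.valid
  have e1 := (h (t1 u.I u) (by simp)).in hY.in
  have e2 := (h (t2 u.J u) (by simp)).in hY.in
  have e3 := (h (t1 (-1) u) (by simp)).in hY.in
  have e4 := (h (t2 (-1) u) (by simp)).in hY.in
  have e5 := (h (t3 (-1) u) (by simp)).in hY.in
  rw [hY.L_eq, hu.L_eq] at hL
  obtain ⟨hI, hJ⟩ := hu.2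
  obtain ⟨hv', hI', hJ'⟩ := hY
  unfold V at hv'
  suffices Y.I = u.I + 1 ∧ Y.J = u.J + 1 ∧ Y.K = u.K + 2 by
    ext <;> simp only [tr] <;> omega
  rcases io_cases κ hu.1 with ⟨a, b, -⟩ | ⟨a, b, -⟩ | ⟨a, b, -⟩ | ⟨a, b, -⟩ | ⟨a, b, -⟩ |
      ⟨a, b, -⟩ <;>
  clear hc h hu <;>
  rcases io_cases κ v1 with ⟨p1, q1, k1⟩ | ⟨p1, q1, k1⟩ | ⟨p1, q1, k1⟩ | ⟨p1, q1, k1⟩ | ⟨p1, q1, k1⟩ |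
      ⟨p1, q1, k1⟩ <;> rw [k1] at e1 <;>
    clear k1 v1 <;> simp only [t1, In] at p1 q1 e1 <;> (try (exfalso; omega)) <;>
  rcases io_cases κ v2 with ⟨p2, q2, k2⟩ | ⟨p2, q2, k2⟩ | ⟨p2, q2, k2⟩ | ⟨p2, q2, k2⟩ | ⟨p2, q2, k2⟩ |
      ⟨p2, q2, k2⟩ <;> rw [k2] at e2 <;>
    clear k2 v2 <;> simp only [t2, In] at p2 q2 e2 <;> (try (exfalso; omega)) <;>
  rcases io_cases κ v3 with ⟨p3, q3, k3⟩ | ⟨p3, q3, k3⟩ | ⟨p3, q3, k3⟩ | ⟨p3, q3, k3⟩ | ⟨p3, q3, k3⟩ |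
      ⟨p3, q3, k3⟩ <;> rw [k3] at e3 <;>
    clear k3 v3 <;> simp only [t1, In] at p3 q3 e3 <;> (try (exfalso; omega)) <;>
  rcases io_cases κ v4 with ⟨p4, q4, k4⟩ | ⟨p4, q4, k4⟩ | ⟨p4, q4, k4⟩ | ⟨p4, q4, k4⟩ | ⟨p4, q4, k4⟩ |
      ⟨p4, q4, k4⟩ <;> rw [k4] at e4 <;>
    clear k4 v4 <;> simp only [t2, In] at p4 q4 e4 <;> (try (exfalso; omega)) <;>
  rcases io_cases κ v5 with ⟨p5, q5, k5⟩ | ⟨p5, q5, k5⟩ | ⟨p5, q5, k5⟩ | ⟨p5, q5, k5⟩ | ⟨p5, q5, k5⟩ |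
      ⟨p5, q5, k5⟩ <;> rw [k5] at e5 <;>
    clear k5 v5 <;> simp only [t3, In] at p5 q5 e5 <;> (try (exfalso; omega)) <;> omega

/-- The numerical content of thickness of a dominant interval. -/
structure Thk (x y : Alc) : Prop where
  dx : Dom x
  dy : Dom y
  xI : 2 ≤ x.I
  xJ : 2 ≤ x.J
  yI : 3 ≤ y.I
  yJ : 3 ≤ y.J
  room : Room 6 6 x y

theorem Thk.sg {x y : Alc} (h : Thk x y) : Thk (sg x) (sg y) :=
  ⟨h.dx.sg, h.dy.sg, h.xJ, h.xI, h.yJ, h.yI, h.room.sg⟩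

theorem TS.exists_tr {z w : Alc} (hz : TS z) (hw : TS w) : ∃ a b, w = tr a b z :=
  ⟨w.I - z.I, w.J - z.J, by
    have h1 := hz.1
    have h2 := hw.1
    ext <;> simp only [tr] <;> omega⟩

theorem TH.exists_tr {z w : Alc} (hz : TH z) (hw : TH w) : ∃ a b, w = tr a b z :=
  ⟨w.I - z.I, w.J - z.J, by
    have h1 := hz.1
    have h2 := hw.1
    ext <;> simp only [tr] <;> omega⟩

theorem TS.not_th {z : Alc} (h : TS z) : ¬ TH z := fun h' => by
  have := h.1
  have := h'.1
  omega

namespace Iso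

variable {x y x' y' : Alc} {F : Iso x y x' y'} {a b : ℤ}

theorem six_cover (hy : Dom y) {v v' u : Alc} (hxv : Le x v) (hv' : TS v') (e : F.f v = v')
    (hu : TH u) (hc : Cov v u) (hr : Room 3 3 u y) : F.f u = ra v' ∨ F.f u = rb v' := by
  have hm : Mem x y u :=
    ⟨hxv.trans hc.edge.le, hr.le hu.dom hy (by norm_num) (by norm_num)⟩
  have hmv : Mem x y v := ⟨hxv, hc.edge.le.trans hm.2⟩
  have d := F.cov hmv hm.2 hc
  rw [e] at d
  have h6 : ∀ l : List Alc, l.length = 4 → ¬ CovIn (F.f u) l := by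
    intro l hl hT
    have := (F.six hy hu hm.1 hr hT).1
    omega
  obtain ⟨⟨l1, n1, k1⟩, ⟨l2, n2, k2⟩, ⟨l3, n3, k3⟩⟩ := few_covers hv'
  have := covIn_dom_even hv'.dom hv'.1 _ d
  simp only [List.mem_cons, List.not_mem_nil, or_false] at this
  rcases this with h | h | h | h | h
  · exact Or.inl h
  · exact Or.inr h
  · exact absurd (h ▸ k1) (h6 l1 n1)
  · exact absurd (h ▸ k2) (h6 l2 n2)
  · exact absurd (h ▸ k3) (h6 l3 n3)

theorem image_ab (hy : Dom y) {v v' : Alc} (hv : TS v) (hxv : Le x v) (hr : Room 5 5 v y)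
    (hv' : TS v') (e : F.f v = v') :
    (F.f (ra v) = ra v' ∧ F.f (rb v) = rb v') ∨ (F.f (ra v) = rb v' ∧ F.f (rb v) = ra v') := by
  obtain ⟨r1, r2⟩ := hr
  have hK := hv.1
  have ha : Room 3 3 (ra v) y := by simp only [Room, ra, t1]; omega
  have hb : Room 3 3 (rb v) y := by simp only [Room, rb, t2]; omega
  have h1 := six_cover hy hxv hv' e hv.th_ra hv.dom.cov_ra ha
  have h2 := six_cover hy hxv hv' e hv.th_rb hv.dom.cov_rb hb
  have hne : F.f (ra v) ≠ F.f (rb v) := fun k => hv.dom.ra_ne_rb <| F.inj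
    ⟨hxv.trans hv.dom.cov_ra.edge.le, ha.le hv.th_ra.dom hy (by norm_num) (by norm_num)⟩
    ⟨hxv.trans hv.dom.cov_rb.edge.le, hb.le hv.th_rb.dom hy (by norm_num) (by norm_num)⟩ k
  rcases h1 with h1 | h1 <;> rcases h2 with h2 | h2
  · exact absurd (h1.trans h2.symm) hne
  · exact Or.inl ⟨h1, h2⟩
  · exact Or.inr ⟨h1, h2⟩
  · exact absurd (h1.trans h2.symm) hne

/-- Near `x`, the isomorphism is the translation by `a ϖ₁ + b ϖ₂`. -/
structure Start (F : Iso x y x' y') (a b : ℤ) : Prop where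
  eq : x' = tr a b x
  even : TS x → F.H a b x
  odd : TH x → F.H a b (rc x)

theorem Start.of_even (hx : TS x) (hx' : TS x')
    (ha : F.f (ra x) = ra x') (hb : F.f (rb x) = rb x') : ∃ a b, F.Start a b := by
  obtain ⟨a, b, rfl⟩ := hx.exists_tr hx'
  exact ⟨a, b, rfl, fun _ => ⟨hx, Le.refl x, hx'.2.1, hx'.2.2, F.map_x, ha.trans (ra_tr a b x),
    hb.trans (rb_tr a b x)⟩, fun h => absurd h hx.not_th⟩

theorem Start.of_odd (hx : TH x) (hx' : TH x') (hc : F.f (rc x) = rc x')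
    (ha : F.f (ra (rc x)) = ra (rc x')) (hb : F.f (rb (rc x)) = rb (rc x')) :
    ∃ a b, F.Start a b := by
  obtain ⟨a, b, rfl⟩ := hx.exists_tr hx'
  have hs := hx'.ts_rc
  rw [rc_tr] at hc ha hb hs
  exact ⟨a, b, rfl, fun h => absurd hx h.not_th, fun _ => ⟨hx.ts_rc, hx.cov_rc.edge.le, hs.2.1,
    hs.2.2, hc, ha.trans (ra_tr a b _), hb.trans (rb_tr a b _)⟩⟩

theorem ts_of_ts (F : Iso x y x' y') (hy : Dom y) (hr : Room 3 3 x y) (hx : Dom x) (hx' : TS x') : TS x := by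
  refine hx.ts_or_th.resolve_right fun h => ?_
  have := (F.six hy h (Le.refl x) hr (F.map_x ▸ covIn_dom_even hx'.dom hx'.1)).1
  norm_num at this

theorem exists_start_even (h : Thk x y) (hx : TS x) (hx' : TS x') :
    (∃ a b, F.Start a b) ∨ ∃ a b, F.postSg.Start a b := by
  have hr : Room 5 5 x y := ⟨by have := h.room.1; omega, by have := h.room.2; omega⟩
  rcases F.image_ab h.dy hx (Le.refl x) hr hx' F.map_x with ⟨h1, h2⟩ | ⟨h1, h2⟩
  · exact Or.inl (Start.of_even hx hx' h1 h2)
  · exact Or.inr (Start.of_even hx hx'.sg (congrArg Alc.sg h1) (congrArg Alc.sg h2))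

theorem exists_start_rc (h : Thk x y) (hx : TH x) (hx' : TH x') (hc : F.f (rc x) = rc x') :
    (∃ a b, F.Start a b) ∨ ∃ a b, F.postSg.Start a b := by
  have hr : Room 5 5 (rc x) y := by
    have h1 := h.room.1
    have h2 := h.room.2
    have h3 := hx.1
    simp only [Room, rc, t3]; omega
  rcases F.image_ab h.dy hx.ts_rc hx.cov_rc.edge.le hr hx'.ts_rc hc with ⟨h1, h2⟩ | ⟨h1, h2⟩
  · exact Or.inl (Start.of_odd hx hx' hc h1 h2)
  · exact Or.inr (Start.of_odd hx hx'.sg (congrArg Alc.sg hc) (congrArg Alc.sg h1)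
      (congrArg Alc.sg h2))

theorem map_rc (h : Thk x y) (hx : TH x) (hx' : TH x') (hI : 2 ≤ x'.I) (hJ : 2 ≤ x'.J) :
    F.f (rc x) = t1 (-1) x' ∨ F.f (rc x) = t2 (-1) x' ∨ F.f (rc x) = t3 (-1) x' ∨
      F.f (rc x) = rc x' := by
  have hr : Room 4 4 x y := ⟨by have := h.room.1; omega, by have := h.room.2; omega⟩
  have hl : Le (rc x) y := by
    have h1 := h.room.1
    have h2 := h.room.2
    have h3 := hx.1
    refine Room.le (p := 0) (q := 0) ?_ hx.ts_rc.dom h.dy le_rfl le_rfl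
    simp only [Room, rc, t3]; omega
  have hc := F.cov ⟨Le.refl x, F.hxy⟩ hl hx.cov_rc
  have n1 := F.rc_ne_ra h.dy hx (Le.refl x) hr (by rwa [F.map_x]) (by rwa [F.map_x])
  have n2 := F.rc_ne_rb h.dy hx (Le.refl x) hr (by rwa [F.map_x]) (by rwa [F.map_x])
  rw [F.map_x] at hc n1 n2
  have := covIn_dom hx'.dom _ hc
  simp only [List.mem_cons, List.not_mem_nil, or_false] at this
  rcases this with k | k | k
  · exact absurd k n1
  · exact absurd k n2
  · exact k

theorem io_self {z : Alc} (h : TH z) : io (z.I - z.J) z = z := by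
  rcases io_cases (z.I - z.J) h.dom.1 with ⟨p, q, e⟩ | ⟨p, q, e⟩ | ⟨p, q, e⟩ | ⟨p, q, e⟩ |
    ⟨p, q, e⟩ | ⟨p, q, e⟩ <;> have := h.1
  · omega
  · omega
  · omega
  · exact e
  · omega
  · omega

theorem io_t3 {z : Alc} (h : TH z) : io (z.I - z.J) (t3 (-1) z) = rc z := by
  have hv := (dom_cov h.dom).2.2.2.2.1.edge.valid
  have := h.1
  rcases io_cases (z.I - z.J) hv with ⟨p, q, e⟩ | ⟨p, q, e⟩ | ⟨p, q, e⟩ | ⟨p, q, e⟩ |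
    ⟨p, q, e⟩ | ⟨p, q, e⟩ <;> simp only [t3] at p q
  · rw [e]; ext <;> simp only [t3, rc] <;> omega
  all_goals omega

theorem io_t1 {z : Alc} (h : TH z) : io (z.I - z.J) (t1 (-1) z) = ra z := by
  have hv := (dom_cov h.dom).2.2.1.edge.valid
  have := h.1
  rcases io_cases (z.I - z.J) hv with ⟨p, q, e⟩ | ⟨p, q, e⟩ | ⟨p, q, e⟩ | ⟨p, q, e⟩ |
    ⟨p, q, e⟩ | ⟨p, q, e⟩ <;> simp only [t1] at p q
  rotate_left 2
  · rw [e]; ext <;> simp only [t1, ra] <;> omega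
  all_goals omega

theorem io_t2 {z : Alc} (h : TH z) : io (z.I - z.J) (t2 (-1) z) = rb z := by
  have hv := (dom_cov h.dom).2.2.2.1.edge.valid
  have := h.1
  rcases io_cases (z.I - z.J) hv with ⟨p, q, e⟩ | ⟨p, q, e⟩ | ⟨p, q, e⟩ | ⟨p, q, e⟩ |
    ⟨p, q, e⟩ | ⟨p, q, e⟩ <;> simp only [t2] at p q
  rotate_left
  · rw [e]; ext <;> simp only [t2, rb] <;> omega
  all_goals omega

/-- Postcomposition with `io κ` when it fixes the target bottom element. -/
def postStab (F : Iso x y x' y') (κ : ℤ) (h : io κ x' = x') : Iso x y x' (io κ y') :=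
  have hm : ∀ z, Mem (io κ x') (io κ y') z ↔ Mem x' (io κ y') z := fun z => by rw [h]
  { f := fun z => io κ (F.f z)
    g := fun z => F.g (io κ z)
    hx := F.hx
    hx' := F.hx'
    hxy := F.hxy
    hf := fun z hz => (hm _).1 ((F.postIo κ).hf z hz)
    hg := fun z hz => (F.postIo κ).hg z ((hm z).2 hz)
    gf := (F.postIo κ).gf
    fg := fun z hz => (F.postIo κ).fg z ((hm z).2 hz)
    f_le := (F.postIo κ).f_le
    g_le := fun z w hz hw hzw => (F.postIo κ).g_le z w ((hm z).2 hz) ((hm w).2 hw) hzw }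

theorem exists_start_odd (F : Iso x y x' y') (h : Thk x y) (hx : TH x) (hx' : TH x')
    (hI : 2 ≤ x'.I) (hJ : 2 ≤ x'.J) :
    F.f (rc x) = rc x' ∨ (F.postStab (x'.I - x'.J) (io_self hx')).f (rc x) = rc x' := by
  have h1 := F.map_rc h hx hx' hI hJ
  have h2 : io (x'.I - x'.J) (F.f (rc x)) = t1 (-1) x' ∨
      io (x'.I - x'.J) (F.f (rc x)) = t2 (-1) x' ∨
      io (x'.I - x'.J) (F.f (rc x)) = t3 (-1) x' ∨ io (x'.I - x'.J) (F.f (rc x)) = rc x' :=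
    (F.postStab (x'.I - x'.J) (io_self hx')).map_rc h hx hx' hI hJ
  have k := hx'.1
  rcases h1 with e | e | e | e
  · rw [e, io_t1 hx'] at h2
    simp only [ra, rc, t1, t2, t3, Alc.mk.injEq] at h2
    omega
  · rw [e, io_t2 hx'] at h2
    simp only [rb, rc, t1, t2, t3, Alc.mk.injEq] at h2
    omega
  · exact Or.inr ((congrArg (io (x'.I - x'.J)) e).trans (io_t3 hx'))
  · exact Or.inl e

theorem Start.reach (h : Thk x y) (hs : F.Start a b) {v : Alc} (hv : TS v)
    (hP : x.I + x.K ≤ v.I + v.K) (hQ : x.J + x.K ≤ v.J + v.K) (hr : Room 5 5 v y) :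
    F.H a b v := by
  have kv := hv.1
  obtain ⟨r1, r2⟩ := h.room
  rcases h.dx.ts_or_th with hx | hx
  · exact (hs.even hx).move h.dy hv hP hQ hr
  have k := hx.1
  have hc := hs.odd hx
  have ex : F.f x = tr a b x := F.map_x.trans hs.eq
  by_cases c1 : v.I + v.K = x.I + x.K
  · refine (hc.slide_two h.dy hx (Le.refl x) ex h.xI ⟨by omega, r2⟩).move h.dy hv ?_ ?_ hr <;>
      simp only [rb, t2] <;> omega
  by_cases c2 : v.J + v.K = x.J + x.K
  · refine (hc.slide_one h.dy hx (Le.refl x) ex h.xJ ⟨r1, by omega⟩).move h.dy hv ?_ ?_ hr <;>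
      simp only [ra, t1] <;> omega
  refine hc.move h.dy hv ?_ ?_ hr <;> simp only [rc, t3] <;> omega

theorem Start.wall_one (h : Thk x y) (hs : F.Start a b) (hI : 1 ≤ x.I + a)
    (hI' : TH x → 2 ≤ x.I + a) (ha : a < 0) :
    y.J + y.K - (x.J + x.K) + (x.I + x.J - x.K) ≤ 3 * (x.I + a) + 2 := by
  by_contra hc
  obtain ⟨r1, r2⟩ := h.room
  rcases h.dx.ts_or_th with hx | hx <;> have k := hx.1
  · have hH := hs.reach h (v := tr (1 - (x.I + a)) (2 * (x.I + a) - 2) x)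
      ⟨by simp only [tr]; omega, by simp only [tr]; omega,
        by simp only [tr]; have := hx.2.2; omega⟩ (by simp only [tr]; omega)
      (by simp only [tr]; omega) ⟨by simp only [tr]; omega, by simp only [tr]; omega⟩
    have := hH.wall_one h.dy (by simp only [tr]; omega)
      ⟨by simp only [tr]; omega, by simp only [tr]; omega⟩
    simp only [tr] at this
    omega
  · have := hI' hx
    have hH := hs.reach h (v := ⟨x.I - (x.I + a) + 1, x.J + 2 * (x.I + a) - 3,
        x.K + (x.I + a) - 1⟩) ⟨by simp only; omega, by simp only; omega, by simp only; have := h.xJ; omega⟩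
      (by simp only; omega) (by simp only; omega) ⟨by simp only; omega, by simp only; omega⟩
    have := hH.wall_one h.dy (by simp only; omega) ⟨by simp only; omega, by simp only; omega⟩
    simp only at this
    omega

theorem Start.sg (hs : F.Start a b) : F.sg.Start b a :=
  ⟨(congrArg Alc.sg hs.eq).trans (sg_tr a b x), fun h => (hs.even h.sg).sg, fun h => (hs.odd h.sg).sg⟩

theorem Start.wall_two (h : Thk x y) (hs : F.Start a b) (hJ : 1 ≤ x.J + b)
    (hJ' : TH x → 2 ≤ x.J + b) (hb : b < 0) :
    y.I + y.K - (x.I + x.K) + (x.I + x.J - x.K) ≤ 3 * (x.J + b) + 2 := by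
  have := hs.sg.wall_one h.sg hJ (fun k => hJ' k.sg) hb
  simp only [Alc.sg] at this
  omega

/-- The isomorphism is the expected translation on `y - ρ`. -/
theorem Start.near_top (h : Thk x y) (hs : F.Start a b) :
    Le x (tr (-1) (-1) y) ∧ F.f (tr (-1) (-1) y) = tr a b (tr (-1) (-1) y) ∧
      2 ≤ y.I - 1 + a ∧ 2 ≤ y.J - 1 + b := by
  obtain ⟨r1, r2⟩ := h.room
  have hI := h.yI
  have hJ := h.yJ
  rcases h.dy.ts_or_th with hy | hy <;> have k := hy.1
  · have hv : TS (tr (-2) (-2) y) := by simp only [TS, tr]; omega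
    have h1 := hs.reach h hv (by simp only [tr]; omega) (by simp only [tr]; omega)
      ⟨by simp only [tr]; omega, by simp only [tr]; omega⟩
    have h2 := h1.step_one h.dy ⟨by simp only [tr]; omega, by simp only [tr]; omega⟩
    rw [hv.rc_ra] at h2
    have h3 := h2.rc_rb h.dy ⟨by simp only [tr]; omega, by simp only [tr]; omega⟩
    have hl := (h2.xv.trans h2.ts.dom.cov_rb.edge.le).trans h2.ts.th_rb.cov_rc.edge.le
    rw [h2.ts.rc_rb] at h3 hl
    have e : tr 0 1 (tr 1 0 (tr (-2) (-2) y)) = tr (-1) (-1) y := by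
      ext <;> simp only [tr] <;> ring
    rw [e] at h3 hl
    have p1 := h1.I_pos
    have p2 := h1.J_pos
    simp only [tr] at p1 p2
    exact ⟨hl, h3, by omega, by omega⟩
  · have hv : TS ⟨y.I - 2, y.J - 2, y.K - 3⟩ := by simp only [TS]; omega
    have h1 := hs.reach h hv (by simp only; omega) (by simp only; omega)
      ⟨by simp only; omega, by simp only; omega⟩
    have h3 := h1.rb_rc_ra h.dy ⟨by simp only; omega, by simp only; omega⟩
    have hl := (h1.xv.trans hv.dom.cov_ra.edge.le).trans hv.th_ra.cov_rc.edge.le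
    have hl := hl.trans hv.th_ra.ts_rc.dom.cov_rb.edge.le
    have e : rb (rc (ra ⟨y.I - 2, y.J - 2, y.K - 3⟩)) = tr (-1) (-1) y := by
      ext <;> simp only [tr, ra, rb, rc, t1, t2, t3] <;> omega
    rw [e] at h3 hl
    have p1 := h1.I_pos
    have p2 := h1.J_pos
    simp only at p1 p2
    exact ⟨hl, h3, by omega, by omega⟩

end Iso

/-- The polygon condition at the first wall for the interval `[x, y]` and the offset `c`. -/
def Low (x y : Alc) (c : ℤ) : Prop :=
  y.J + y.K - (x.J + x.K) + (x.I + x.J - x.K) ≤ 3 * c + 2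

/-- The pair `(X, Y)` is a translate of `(x, y)`, and moving towards a wall is only possible
if the polygon stays away from it. -/
def Fit (x y X Y : Alc) : Prop :=
  ∃ a b, X = tr a b x ∧ Y = tr a b y ∧ (a < 0 → Low x y (x.I + a)) ∧
    (b < 0 → Low (sg x) (sg y) (x.J + b))

namespace Iso

variable {x y x' y' : Alc} {F : Iso x y x' y'} {a b : ℤ}

theorem Start.covers_le (h : Thk x y) (hs : F.Start a b) :
    Dom (tr a b (tr (-1) (-1) y)) ∧ y'.L = (tr a b (tr (-1) (-1) y)).L + 4 ∧
    ∀ t ∈ [t1 (tr a b (tr (-1) (-1) y)).I (tr a b (tr (-1) (-1) y)),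
      t2 (tr a b (tr (-1) (-1) y)).J (tr a b (tr (-1) (-1) y)),
      t1 (-1) (tr a b (tr (-1) (-1) y)), t2 (-1) (tr a b (tr (-1) (-1) y)),
      t3 (-1) (tr a b (tr (-1) (-1) y))], Le t y' := by
  obtain ⟨hxz, e, hI, hJ⟩ := hs.near_top h
  have yI := h.yI
  have yJ := h.yJ
  set z := tr (-1) (-1) y with hz
  have zI : z.I = y.I - 1 := rfl
  have zJ : z.J = y.J - 1 := rfl
  have zK : z.K = y.K - 1 - 1 := rfl
  have hr : Room 3 3 z y := ⟨by omega, by omega⟩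
  have uI : (tr a b z).I = z.I + a := rfl
  have uJ : (tr a b z).J = z.J + b := rfl
  have key : Dom z ∧ Dom (tr a b z) ∧ ∀ t ∈ [t1 (tr a b z).I (tr a b z),
      t2 (tr a b z).J (tr a b z), t1 (-1) (tr a b z), t2 (-1) (tr a b z), t3 (-1) (tr a b z)],
      Le t y' := by
    rcases h.dy.ts_or_th with hy | hy
    · have zt : TS z := hy.ts_tr (by omega) (by omega)
      have ut : TS (tr a b z) := zt.ts_tr (by omega) (by omega)
      refine ⟨zt.dom, ut.dom, fun t ht => ?_⟩
      have hT := covIn_dom_even ut.dom ut.1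
      nth_rw 1 [← e] at hT
      obtain ⟨w, -, hw, rfl⟩ := (F.five h.dy zt.dom hxz hr hT).2 rfl t ht
      exact (F.hf w hw).2
    · have zt : TH z := hy.th_tr (by omega) (by omega)
      have ut : TH (tr a b z) := zt.th_tr (by omega) (by omega)
      refine ⟨zt.dom, ut.dom, fun t ht => ?_⟩
      have hT := covIn_dom ut.dom
      nth_rw 1 [← e] at hT
      obtain ⟨w, -, hw, rfl⟩ := (F.six h.dy zt hxz hr hT).2 rfl t (by
          simp only [List.mem_cons, List.not_mem_nil, or_false] at ht ⊢
          tauto)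
      exact (F.hf w hw).2
  obtain ⟨dz, du, k⟩ := key
  refine ⟨du, ?_, k⟩
  have hzy : Le z y := hr.le dz h.dy (by norm_num) (by norm_num)
  have := F.L_eq ⟨hxz, hzy⟩ ⟨F.hxy, Le.refl y⟩ hzy
  rw [F.map_y, e, h.dy.L_eq, dz.L_eq] at this
  omega

theorem tr_add (a b : ℤ) (y : Alc) : tr 1 1 (tr a b (tr (-1) (-1) y)) = tr a b y := by
  ext <;> simp only [tr] <;> ring

theorem Start.top_eq (h : Thk x y) (hs : F.Start a b) (hY : Dom y') : y' = tr a b y := by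
  obtain ⟨hu, hL, k⟩ := hs.covers_le h
  rw [← tr_add a b y]
  exact eq_tr_of_le hu hY hL (k _ (by simp))

theorem Start.io_top_eq {κ : ℤ} {Y : Alc} (h : Thk x y) (hs : F.Start a b) (hY : Dom Y)
    (e : y' = io κ Y) : Y = tr a b y := by
  obtain ⟨hu, hL, k⟩ := hs.covers_le h
  rw [← tr_add a b y]
  subst e
  rw [L_io κ hY.1] at hL
  exact eq_tr_of_io_le hu hY hL fun t ht => io_io κ hY.1 ▸ (k t ht).io κ

theorem Start.fit {Y : Alc} (h : Thk x y) (h' : Thk x' Y) (hs : F.Start a b)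
    (e : Y = tr a b y) : Fit x y x' Y := by
  have e1 := hs.eq
  have hI : 2 ≤ x.I + a := by have := h'.xI; rwa [e1] at this
  have hJ : 2 ≤ x.J + b := by have := h'.xJ; rwa [e1] at this
  exact ⟨a, b, e1, e, hs.wall_one h (by omega) (fun _ => hI),
    fun hb => by
      have := hs.wall_two h (by omega) (fun _ => hJ) hb
      simp only [Low, Alc.sg]; omega⟩

theorem ts_iff (F : Iso x y x' y') (h : Thk x y) (h' : Thk x' y') : TS x ↔ TS x' :=
  ⟨F.symm.ts_of_ts h'.dy ⟨by have := h'.room.1; omega, by have := h'.room.2; omega⟩ h'.dx,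
    F.ts_of_ts h.dy ⟨by have := h.room.1; omega, by have := h.room.2; omega⟩ h.dx⟩

theorem fit (F : Iso x y x' y') (h : Thk x y) (h' : Thk x' y') :
    Fit x y x' y' ∨ Fit x y (Alc.sg x') (Alc.sg y') := by
  have hts := F.ts_iff h h'
  have h'' : Thk (Alc.sg x') (Alc.sg y') := h'.sg
  rcases h.dx.ts_or_th with hx | hx
  · rcases F.exists_start_even h hx (hts.1 hx) with ⟨a, b, hs⟩ | ⟨a, b, hs⟩
    · exact Or.inl (hs.fit h h' (hs.top_eq h h'.dy))
    · exact Or.inr (hs.fit h h'' (hs.top_eq h h''.dy))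
  have hx' : TH x' := h'.dx.ts_or_th.resolve_left fun k => (hts.2 k).not_th hx
  rcases F.exists_start_odd h hx hx' h'.xI h'.xJ with hc | hc
  · rcases F.exists_start_rc h hx hx' hc with ⟨a, b, hs⟩ | ⟨a, b, hs⟩
    · exact Or.inl (hs.fit h h' (hs.top_eq h h'.dy))
    · exact Or.inr (hs.fit h h'' (hs.top_eq h h''.dy))
  · rcases exists_start_rc h hx hx' hc with ⟨a, b, hs⟩ | ⟨a, b, hs⟩
    · exact Or.inl (hs.fit h h' (hs.io_top_eq h h'.dy rfl))
    · exact Or.inr (hs.fit h h'' (hs.io_top_eq h h''.dy (sg_io _ h'.dy.1).symm))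

end Iso

/-- The polygons of `(x, y)` and of its translate `(X, Y)` agree near the walls. -/
def Match (x y X Y : Alc) : Prop :=
  ∃ a b, X = tr a b x ∧ Y = tr a b y ∧ (a = 0 ∨ Low x y x.I ∧ Low x y (x.I + a)) ∧
    (b = 0 ∨ Low (sg x) (sg y) x.J ∧ Low (sg x) (sg y) (x.J + b))

theorem Fit.match_of {x y X Y : Alc} (h : Fit x y X Y) (h' : Fit X Y x y) : Match x y X Y := by
  obtain ⟨a, b, rfl, rfl, h1, h2⟩ := h
  obtain ⟨c, d, e, -, h3, h4⟩ := h'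
  refine ⟨a, b, rfl, rfl, ?_, ?_⟩
  all_goals
    simp only [Alc.ext_iff, Low, tr, sg] at *
    omega

theorem Fit.match_of_sg {x y X Y : Alc} (h : Fit x y X Y) (h' : Fit X Y (sg x) (sg y)) :
    Match x y X Y := by
  obtain ⟨a, b, rfl, rfl, h1, h2⟩ := h
  obtain ⟨c, d, e, e', h3, h4⟩ := h'
  refine ⟨a, b, rfl, rfl, ?_, ?_⟩
  all_goals
    simp only [Alc.ext_iff, Low, tr, sg] at *
    omega

theorem Fit.sg {x y X Y : Alc} (h : Fit x y X Y) : Fit (sg x) (sg y) (sg X) (sg Y) := by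
  obtain ⟨a, b, rfl, rfl, h1, h2⟩ := h
  exact ⟨b, a, sg_tr a b x, sg_tr a b y, h2, h1⟩

/-- Isomorphic thick intervals are translates of each other up to the diagram automorphism. -/
theorem Iso.matching {x y x' y' : Alc} (F : Iso x y x' y') (h : Thk x y) (h' : Thk x' y') :
    Match x y x' y' ∨ Match x y (Alc.sg x') (Alc.sg y') := by
  rcases F.fit h h' with k | k <;> rcases F.symm.fit h' h with k' | k'
  · exact Or.inl (k.match_of k')
  · exact Or.inl (k.match_of_sg k')
  · exact Or.inr (k.match_of_sg k'.sg)
  · exact Or.inr (k.match_of k'.sg)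


theorem Rfl.s {a b : Alc} (h : Rfl a b) (i : Fin 3) : Rfl (s i a) (s i b) := by
  rcases h with ⟨m, rfl⟩ | ⟨m, rfl⟩ | ⟨m, rfl⟩ <;> fin_cases i <;>
    simp only [Rfl, Alc.s, Alc.ext_iff, t1, t2, t3, Fin.zero_eta, Fin.mk_one, Fin.reduceFinMk,
      Matrix.cons_val_zero, Matrix.cons_val_one, Matrix.cons_val]
  · exact Or.inr (Or.inl ⟨-1-m, by omega⟩)
  · exact Or.inl ⟨-m, by omega⟩
  · exact Or.inr (Or.inr ⟨m, by omega⟩)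
  · exact Or.inl ⟨-1-m, by omega⟩
  · exact Or.inr (Or.inr ⟨m, by omega⟩)
  · exact Or.inr (Or.inl ⟨-m, by omega⟩)
  · exact Or.inr (Or.inr ⟨-2-m, by omega⟩)
  · exact Or.inr (Or.inl ⟨m, by omega⟩)
  · exact Or.inl ⟨m, by omega⟩

/-- A coordinatization of the alcoves of a Coxeter system of type `A₂` affine. -/
structure Coord {W : Type*} [Group W] {M : CoxeterMatrix (Fin 3)} (cs : CoxeterSystem M W)
    (c : W → Alc) : Prop where
  one : c 1 = ⟨0, 0, 0⟩
  mul : ∀ i w, c (cs.simple i * w) = s i (c w)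
  inj : Function.Injective c

namespace Coord

variable {W : Type*} [Group W] {M : CoxeterMatrix (Fin 3)} {cs : CoxeterSystem M W} {c : W → Alc}

theorem valid (h : Coord cs c) (w : W) : (c w).V := by
  induction w using cs.simple_induction_left with
  | one => rw [h.one]; exact Or.inl (by simp)
  | mul_simple_left w i ih => rw [h.mul]; exact ih.s i

theorem length (h : Coord cs c) (w : W) : (cs.length w : ℤ) = (c w).L := by
  apply le_antisymm
  · have key : ∀ n : ℕ, ∀ w : W, (c w).L ≤ n → (cs.length w : ℤ) ≤ (c w).L := by
      intro n
      induction n with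
      | zero =>
        intro w hw
        have h0 : (c w).L = 0 := le_antisymm hw (L_nonneg _)
        have : w = 1 := h.inj ((L_eq_zero h0).trans h.one.symm)
        rw [h0, this, cs.length_one]
        simp
      | succ n ih =>
        intro w hw
        by_cases h0 : (c w).L = 0
        · have : w = 1 := h.inj ((L_eq_zero h0).trans h.one.symm)
          rw [h0, this, cs.length_one]
          simp
        obtain ⟨i, hi⟩ := exists_descent (h.valid w) h0
        rw [← h.mul] at hi
        have h1 := ih (cs.simple i * w) (by push_cast at hw; omega)
        have h2 := cs.length_simple_mul w i
        omega
    exact key (c w).L.toNat w (by rw [Int.toNat_of_nonneg (L_nonneg _)])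
  · obtain ⟨ω, hω, rfl⟩ := cs.exists_isReduced w
    rw [hω.eq]
    clear hω
    induction ω with
    | nil => simp [h.one, L]
    | cons i ω ih =>
      rw [cs.wordProd_cons, h.mul, List.length_cons]
      have := L_s (h.valid (cs.wordProd ω)) i
      push_cast
      omega

theorem rfl_mul (h : Coord cs c) (w : W) {a b : W} (hR : Rfl (c a) (c b)) :
    Rfl (c (w * a)) (c (w * b)) := by
  induction w using cs.simple_induction_left with
  | one => simpa
  | mul_simple_left w i ih => rw [mul_assoc, mul_assoc, h.mul, h.mul]; exact ih.s i

theorem rfl_of_isReflection (h : Coord cs c) {t : W} (ht : cs.IsReflection t) (a : W) :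
    Rfl (c a) (c (t * a)) := by
  obtain ⟨w, i, rfl⟩ := ht
  have := h.rfl_mul w (a := w⁻¹ * a) (b := cs.simple i * (w⁻¹ * a)) (by
    rw [h.mul]; exact s_rfl i _)
  simpa [mul_assoc] using this

/-- Some reflection acts by `φ` on alcoves. -/
def Acts (cs : CoxeterSystem M W) (c : W → Alc) (φ : Alc → Alc) : Prop :=
  ∃ t, cs.IsReflection t ∧ ∀ a, c (t * a) = φ (c a)

theorem Acts.conj (h : Coord cs c) {φ : Alc → Alc} (hφ : Acts cs c φ) (i : Fin 3)
    {ψ : Alc → Alc} (e : ∀ z, s i (φ (s i z)) = ψ z) : Acts cs c ψ := by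
  obtain ⟨t, ht, k⟩ := hφ
  refine ⟨cs.simple i * t * (cs.simple i)⁻¹, ht.conj _, fun a => ?_⟩
  rw [cs.inv_simple, mul_assoc, mul_assoc, h.mul, k, h.mul, e]

theorem acts_t3 (h : Coord cs c) (m : ℤ) : Acts cs c (t3 m) := by
  have c13 : ∀ m, Acts cs c (t1 m) → Acts cs c (t3 m) := fun m k => k.conj h 2 fun z => by
    ext <;> simp [s, t1, t2, t3] <;> ring
  have c31 : ∀ m, Acts cs c (t3 m) → Acts cs c (t1 m) := fun m k => k.conj h 2 fun z => by
    ext <;> simp [s, t1, t2, t3] <;> ring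
  have c11 : ∀ m, Acts cs c (t1 m) → Acts cs c (t1 (-m)) := fun m k => k.conj h 1 fun z => by
    ext <;> simp [s, t1] <;> ring
  have c33 : ∀ m, Acts cs c (t3 m) → Acts cs c (t3 (-2 - m)) := fun m k => k.conj h 0 fun z => by
    ext <;> simp [s, t3] <;> ring
  have neg : ∀ m, Acts cs c (t3 m) → Acts cs c (t3 (-m)) := fun m k => c13 _ (c11 _ (c31 _ k))
  have up : ∀ m, Acts cs c (t3 m) → Acts cs c (t3 (m + 2)) := fun m k => by
    have := neg _ (c33 _ k)
    rwa [show -(-2 - m) = m + 2 by ring] at this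
  have down : ∀ m, Acts cs c (t3 m) → Acts cs c (t3 (m - 2)) := fun m k => by
    have := c33 _ (neg _ k)
    rwa [show -2 - -m = m - 2 by ring] at this
  have b0 : Acts cs c (t3 0) := c13 0 ⟨cs.simple 1, cs.isReflection_simple 1, fun a => h.mul 1 a⟩
  have b1 : Acts cs c (t3 (-1)) := ⟨cs.simple 0, cs.isReflection_simple 0, fun a => h.mul 0 a⟩
  have key : Acts cs c (t3 m) ∧ Acts cs c (t3 (m - 1)) := by
    induction m using Int.induction_on with
    | zero => exact ⟨b0, b1⟩
    | succ i ih =>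
      refine ⟨?_, by simpa using ih.1⟩
      have := up _ ih.2
      rwa [show (i : ℤ) - 1 + 2 = i + 1 by ring] at this
    | pred i ih =>
      refine ⟨ih.2, ?_⟩
      have := down _ ih.1
      rwa [show -(i : ℤ) - 2 = -i - 1 - 1 by ring] at this
  exact key.1

theorem acts_t1 (h : Coord cs c) (m : ℤ) : Acts cs c (t1 m) :=
  (h.acts_t3 m).conj h 2 fun z => by ext <;> simp [s, t1, t2, t3] <;> ring

theorem acts_t2 (h : Coord cs c) (m : ℤ) : Acts cs c (t2 m) :=
  (h.acts_t3 m).conj h 1 fun z => by ext <;> simp [s, t1, t2, t3] <;> ring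

theorem exists_reflection (h : Coord cs c) {a : W} {z : Alc} (hR : Rfl (c a) z) :
    ∃ t, cs.IsReflection t ∧ c (t * a) = z := by
  rcases hR with ⟨m, rfl⟩ | ⟨m, rfl⟩ | ⟨m, rfl⟩
  · obtain ⟨t, ht, k⟩ := h.acts_t1 m
    exact ⟨t, ht, k a⟩
  · obtain ⟨t, ht, k⟩ := h.acts_t2 m
    exact ⟨t, ht, k a⟩
  · obtain ⟨t, ht, k⟩ := h.acts_t3 m
    exact ⟨t, ht, k a⟩

theorem le_of_bruhat (h : Coord cs c) {a b : W} (hab : bruhatLE cs a b) : Le (c a) (c b) := by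
  rcases hab with rfl | hab
  · exact Le.refl _
  · have key : ∀ u v : W, ((∃ t, cs.IsReflection t ∧ v = t * u) ∧ cs.length u < cs.length v) →
        Edge (c u) (c v) := by
      rintro u v ⟨⟨t, ht, rfl⟩, hl⟩
      exact ⟨h.valid u, h.rfl_of_isReflection ht u, by
        rw [← h.length, ← h.length]; exact_mod_cast hl⟩
    exact (Relation.TransGen.lift c key _ _ hab).to_reflTransGen

theorem lift_le (h : Coord cs c) {a : W} {z : Alc} (hz : Le (c a) z) :
    ∃ b, c b = z ∧ bruhatLE cs a b := by
  induction hz with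
  | refl => exact ⟨a, rfl, Or.inl rfl⟩
  | tail _ he ih =>
    obtain ⟨b, rfl, hb⟩ := ih
    obtain ⟨t, ht, rfl⟩ := h.exists_reflection he.2.1
    have hs : (∃ t', cs.IsReflection t' ∧ t * b = t' * b) ∧ cs.length b < cs.length (t * b) := by
      refine ⟨⟨t, ht, rfl⟩, ?_⟩
      have := he.2.2
      rw [← h.length, ← h.length] at this
      exact_mod_cast this
    refine ⟨t * b, rfl, Or.inr ?_⟩
    rcases hb with rfl | hb
    · exact Relation.TransGen.single hs
    · exact Relation.TransGen.tail hb hs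

theorem le_iff (h : Coord cs c) {a b : W} : Le (c a) (c b) ↔ bruhatLE cs a b := by
  refine ⟨fun k => ?_, h.le_of_bruhat⟩
  obtain ⟨b', e, hb⟩ := h.lift_le k
  rwa [h.inj e] at hb

/-- A map between intervals of the group, transported to alcoves. -/
def transport (cs : CoxeterSystem M W) (c : W → Alc) {x y x' y' : W}
    (e : {z : W // bruhatLE cs x z ∧ bruhatLE cs z y} →
      {z : W // bruhatLE cs x' z ∧ bruhatLE cs z y'}) (z : Alc) : Alc :=
  open Classical in
  if h : bruhatLE cs x (Function.invFun c z) ∧ bruhatLE cs (Function.invFun c z) y then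
    c (e ⟨Function.invFun c z, h⟩).1 else z

theorem transport_apply (h : Coord cs c) {x y x' y' : W}
    (e : {z : W // bruhatLE cs x z ∧ bruhatLE cs z y} →
      {z : W // bruhatLE cs x' z ∧ bruhatLE cs z y'}) (u : {z : W // bruhatLE cs x z ∧ bruhatLE cs z y}) :
    transport cs c e (c u.1) = c (e u).1 := by
  have hi : Function.invFun c (c u.1) = u.1 := Function.leftInverse_invFun h.inj u.1
  have hm : bruhatLE cs x (Function.invFun c (c u.1)) ∧
      bruhatLE cs (Function.invFun c (c u.1)) y := by rw [hi]; exact u.2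
  rw [transport, dif_pos hm]
  exact congrArg (fun v => c (e v).1) (Subtype.ext hi)

theorem exists_of_mem (h : Coord cs c) {x y : W} {z : Alc} (hz : Mem (c x) (c y) z) :
    ∃ u : {z : W // bruhatLE cs x z ∧ bruhatLE cs z y}, c u.1 = z := by
  obtain ⟨w, rfl, hw⟩ := h.lift_le hz.1
  exact ⟨⟨w, hw, h.le_iff.1 hz.2⟩, rfl⟩

theorem mem (h : Coord cs c) {x y : W} (u : {z : W // bruhatLE cs x z ∧ bruhatLE cs z y}) :
    Mem (c x) (c y) (c u.1) := ⟨h.le_of_bruhat u.2.1, h.le_of_bruhat u.2.2⟩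

theorem exists_iso (h : Coord cs c) {x y x' y' : W} (hxy : bruhatLE cs x y)
    (hiso : IntervalIso cs cs x y x' y') : Nonempty (Iso (c x) (c y) (c x') (c y')) := by
  obtain ⟨e, he⟩ := hiso
  refine ⟨{
    f := transport cs c e
    g := transport cs c e.symm
    hx := h.valid x
    hx' := h.valid x'
    hxy := h.le_of_bruhat hxy
    hf := fun z hz => ?_
    hg := fun z hz => ?_
    gf := fun z hz => ?_
    fg := fun z hz => ?_
    f_le := fun z w hz hw k => ?_
    g_le := fun z w hz hw k => ?_ }⟩
  · obtain ⟨u, rfl⟩ := h.exists_of_mem hz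
    rw [h.transport_apply]; exact h.mem _
  · obtain ⟨u, rfl⟩ := h.exists_of_mem hz
    rw [h.transport_apply]; exact h.mem _
  · obtain ⟨u, rfl⟩ := h.exists_of_mem hz
    rw [h.transport_apply, h.transport_apply, Equiv.symm_apply_apply]
  · obtain ⟨u, rfl⟩ := h.exists_of_mem hz
    rw [h.transport_apply, h.transport_apply, Equiv.apply_symm_apply]
  · obtain ⟨u, rfl⟩ := h.exists_of_mem hz
    obtain ⟨v, rfl⟩ := h.exists_of_mem hw
    rw [h.transport_apply, h.transport_apply, h.le_iff, ← he, ← h.le_iff]; exact k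
  · obtain ⟨u, rfl⟩ := h.exists_of_mem hz
    obtain ⟨v, rfl⟩ := h.exists_of_mem hw
    rw [h.transport_apply, h.transport_apply, h.le_iff, he, Equiv.apply_symm_apply,
      Equiv.apply_symm_apply, ← h.le_iff]; exact k

end Coord

/-- The barycenter of an alcove. -/
def pt (z : Alc) : E2 := (((z.I + z.K - 1 : ℤ) : ℝ) / 3, ((z.J + z.K - 1 : ℤ) : ℝ) / 3)

theorem pt_inj {z w : Alc} (hz : z.V) (hw : w.V) (h : pt z = pt w) : z = w := by
  simp only [pt, Prod.mk.injEq] at h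
  obtain ⟨h1, h2⟩ := h
  have e1 : z.I + z.K - 1 = w.I + w.K - 1 := by
    have : ((z.I + z.K - 1 : ℤ) : ℝ) = ((w.I + w.K - 1 : ℤ) : ℝ) := by linarith
    exact_mod_cast this
  have e2 : z.J + z.K - 1 = w.J + w.K - 1 := by
    have : ((z.J + z.K - 1 : ℤ) : ℝ) = ((w.J + w.K - 1 : ℤ) : ℝ) := by linarith
    exact_mod_cast this
  unfold V at hz hw
  ext <;> omega

theorem reflE_a1 (m : ℤ) (z : Alc) : reflE a1 m (pt z) = pt (t1 m z) := by
  ext <;> simp [reflE, B2, a1, pt, t1] <;> ring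

theorem reflE_a2 (m : ℤ) (z : Alc) : reflE a2 m (pt z) = pt (t2 m z) := by
  ext <;> simp [reflE, B2, a2, pt, t2] <;> ring

theorem reflE_rho2 (m : ℤ) (z : Alc) : reflE rho2 m (pt z) = pt (t3 m z) := by
  ext <;> simp [reflE, B2, rho2, pt, t3] <;> ring

theorem pt_tr (a b : ℤ) (z : Alc) : pt (tr a b z) = pt z + ((a : ℝ) • fw1 + (b : ℝ) • fw2) := by
  ext <;> simp [pt, tr, fw1, fw2] <;> ring

/-- The polygon of a pair of alcoves. -/
def poly (z w : Alc) : Set E2 :=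
  {v | ((pt z).1 ≤ v.1 ∧ (pt z).2 ≤ v.2) ∧ (v.1 ≤ (pt w).1 ∧ v.2 ≤ (pt w).2) ∧
    -1 ≤ 2 * v.1 - v.2 ∧ -1 ≤ 2 * v.2 - v.1}

theorem mem_poly_sg {z w : Alc} {v : E2} : (v.2, v.1) ∈ poly z w ↔ v ∈ poly (sg z) (sg w) := by
  simp only [poly, pt, sg, Set.mem_ofPred_eq]
  tauto

theorem low_iff {x y : Alc} {c : ℤ} : Low x y c ↔
    ((y.J : ℝ) + y.K - (x.J + x.K) + (x.I + x.J - x.K)) ≤ 3 * c + 2 := by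
  unfold Low
  exact_mod_cast Iff.rfl

theorem Match.poly {x y X Y : Alc} (h : Match x y X Y) :
    ∃ μ ∈ wLat, ∀ v, v ∈ poly x y ↔ v + μ ∈ poly X Y := by
  obtain ⟨a, b, rfl, rfl, ha, hb⟩ := h
  refine ⟨_, ⟨a, b, rfl⟩, fun v => ?_⟩
  simp only [Alc.poly, pt_tr, Set.mem_ofPred_eq, Prod.fst_add, Prod.snd_add, add_le_add_iff_right]
  refine and_congr_right fun h1 => and_congr_right fun h2 => ?_
  obtain ⟨p1, p2⟩ := h1
  obtain ⟨q1, q2⟩ := h2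
  simp only [pt] at p1 p2 q1 q2
  push_cast at p1 p2 q1 q2
  simp only [fw1, fw2, Prod.smul_mk, smul_eq_mul]
  apply and_congr
  · rcases ha with rfl | ⟨h1, h2⟩
    · apply iff_of_eq; congr 1; push_cast; ring
    · rw [low_iff] at h1 h2
      push_cast at h2
      exact iff_of_true (by linarith) (by linarith)
  · rcases hb with rfl | ⟨h1, h2⟩
    · apply iff_of_eq; congr 1; push_cast; ring
    · rw [low_iff] at h1 h2
      simp only [sg] at h1 h2
      push_cast at h2
      exact iff_of_true (by linarith) (by linarith)

theorem B2_swap (u v : E2) : B2 (u.2, u.1) (v.2, v.1) = B2 u v := by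
  simp only [B2]; ring

theorem congruent_of_match {x y x' y' : Alc} (h : Match x y x' y' ∨ Match x y (sg x') (sg y')) :
    (∃ mu ∈ wLat,
      (fun v => v + mu) '' poly x' y' = poly x y ∨
      (fun v => v + mu) '' poly x' y' = (fun v : E2 => (v.2, v.1)) '' poly x y) ∧
    (∃ f : E2 → E2, Function.Bijective f ∧
      (∀ u v : E2, B2 (f u - f v) (f u - f v) = B2 (u - v) (u - v)) ∧
      f '' poly x y = poly x' y') := by
  rcases h with h | h
  · obtain ⟨μ, ⟨a, b, hμ⟩, k⟩ := h.poly
    refine ⟨⟨-μ, ⟨-a, -b, by rw [hμ]; push_cast; module⟩, Or.inl ?_⟩, fun v => v + μ,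
      (Equiv.addRight μ).bijective, fun u v => by simp only [add_sub_add_right_eq_sub], ?_⟩
    · ext u
      constructor
      · rintro ⟨v, hv, rfl⟩
        rw [k]
        simpa using hv
      · intro hu
        exact ⟨u + μ, (k u).1 hu, by simp⟩
    · ext u
      constructor
      · rintro ⟨v, hv, rfl⟩
        exact (k v).1 hv
      · intro hu
        exact ⟨u - μ, (k _).2 (by simpa using hu), by simp⟩
  · obtain ⟨μ, ⟨a, b, hμ⟩, k⟩ := h.poly
    refine ⟨⟨-(μ.2, μ.1), ⟨-b, -a, ?_⟩, Or.inr ?_⟩, fun v => (v.2 + μ.2, v.1 + μ.1), ?_, ?_, ?_⟩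
    · rw [hμ]
      ext <;> simp [fw1, fw2]
    · ext u
      constructor
      · rintro ⟨v, hv, rfl⟩
        refine ⟨(v.2, v.1) - μ, (k _).2 ?_, by ext <;> simp [sub_eq_add_neg]⟩
        rw [sub_add_cancel, ← mem_poly_sg]
        exact hv
      · rintro ⟨v, hv, rfl⟩
        exact ⟨(v.2 + μ.2, v.1 + μ.1), mem_poly_sg.2 ((k v).1 hv), by ext <;> simp⟩
    · exact ((Equiv.addRight μ).trans (Equiv.prodComm ℝ ℝ)).bijective
    · intro u v
      rw [← B2_swap (u - v)]
      congr 1 <;> ext <;> simp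
    · ext u
      constructor
      · rintro ⟨v, hv, rfl⟩
        exact mem_poly_sg.2 ((k v).1 hv)
      · intro hu
        refine ⟨(u.2, u.1) - μ, (k _).2 ?_, by ext <;> simp⟩
        rw [sub_add_cancel, ← mem_poly_sg]
        exact hu

section Group

variable {W : Type*} [Group W] {M : CoxeterMatrix (Fin 3)} {cs : CoxeterSystem M W}
  {act : W →* Equiv.Perm E2} {c : W → Alc}

theorem act_simple (h0 : ∀ v, act (cs.simple 0) v = reflE rho2 (-1) v)
    (h1 : ∀ v, act (cs.simple 1) v = reflE a1 0 v)
    (h2 : ∀ v, act (cs.simple 2) v = reflE a2 0 v) (i : Fin 3) (z : Alc) :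
    act (cs.simple i) (pt z) = pt (s i z) := by
  fin_cases i
  · exact (h0 _).trans (by have := reflE_rho2 (-1) z; push_cast at this; exact this)
  · exact (h1 _).trans (by have := reflE_a1 0 z; push_cast at this; exact this)
  · exact (h2 _).trans (by have := reflE_a2 0 z; push_cast at this; exact this)

theorem cen_mul (w v : W) : cen act (w * v) = act w (cen act v) := by
  simp [cen]

theorem cen_one : cen act (1 : W) = pt ⟨0, 0, 0⟩ := by
  ext <;> simp [cen, pt, rho2] <;> ring

theorem exists_coord (hact : ∀ i z, act (cs.simple i) (pt z) = pt (s i z))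
    (hcen : Function.Injective (cen act)) :
    ∃ c : W → Alc, Coord cs c ∧ ∀ w, cen act w = pt (c w) := by
  have hex : ∀ w, ∃ z : Alc, z.V ∧ cen act w = pt z := by
    intro w
    induction w using cs.simple_induction_left with
    | one => exact ⟨⟨0, 0, 0⟩, Or.inl (by simp), cen_one⟩
    | mul_simple_left w i ih =>
      obtain ⟨z, hz, e⟩ := ih
      exact ⟨s i z, hz.s i, by rw [cen_mul, e, hact]⟩
  choose c hV hc using hex
  refine ⟨c, ⟨?_, fun i w => ?_, fun u v h => ?_⟩, hc⟩
  · exact pt_inj (hV 1) (Or.inl (by simp)) ((hc 1).symm.trans cen_one)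
  · exact pt_inj (hV _) ((hV w).s i) (by rw [← hc, cen_mul, hc, hact])
  · exact hcen (by rw [hc, hc, h])

theorem pgn_eq (hc : ∀ w, cen act w = pt (c w)) {x y : W} (hx : Dom (c x)) :
    Pgn act x y = poly (c x) (c y) := by
  have hp : (0 : ℝ) ≤ (pt (c x)).1 ∧ (0 : ℝ) ≤ (pt (c x)).2 := by
    obtain ⟨hV, h1, h2⟩ := hx
    unfold V at hV
    exact ⟨div_nonneg (by exact_mod_cast (by omega)) (by norm_num),
      div_nonneg (by exact_mod_cast (by omega)) (by norm_num)⟩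
  ext v
  simp only [Pgn, Fid, coneK, poly, Set.mem_ofPred_eq, hc, B2, a1, a2, rho2]
  constructor
  · rintro ⟨⟨f1, f2, -⟩, ⟨-, ⟨p, q, hp, hq, rfl⟩, rfl⟩, -, ⟨r, t, hr, ht, rfl⟩, e⟩
    have e1 := congrArg Prod.fst e
    have e2 := congrArg Prod.snd e
    simp at e1 e2 f1 f2 ⊢
    refine ⟨⟨hp, hq⟩, ⟨?_, ?_⟩, ?_, ?_⟩ <;> linarith
  · rintro ⟨⟨p1, p2⟩, ⟨q1, q2⟩, f1, f2⟩
    refine ⟨⟨by linarith, by linarith, by linarith⟩,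
      ⟨_, ⟨v.1 - (pt (c x)).1, v.2 - (pt (c x)).2, by linarith, by linarith, rfl⟩, ?_⟩,
      ⟨_, ⟨(pt (c y)).1 - v.1, (pt (c y)).2 - v.2, by linarith, by linarith, rfl⟩, ?_⟩⟩ <;>
    ext <;> simp

theorem dom_of_mem (hC : Coord cs c) (hc : ∀ w, cen act w = pt (c w)) {th ths : ℕ → ℕ → W}
    (hth : ∀ m n : ℕ, cen act (th m n) =
      cen act (cs.simple 1 * cs.simple 2 * cs.simple 1) + (m : ℝ) • fw1 + (n : ℝ) • fw2)
    (hths : ∀ m n : ℕ, cen act (ths m n) =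
      cen act 1 + ((m : ℝ) + 1) • fw1 + ((n : ℝ) + 1) • fw2) {x : W} (hx : x ∈ Dset th ths) :
    Dom (c x) := by
  have tr_of : ∀ (w : W) (z : Alc) (a b : ℤ), c w = z →
      cen act x = cen act w + (a : ℝ) • fw1 + (b : ℝ) • fw2 → c x = tr a b z := by
    rintro w z a b rfl e
    refine pt_inj (hC.valid x) ?_ ?_
    · have := hC.valid w
      simp only [V, tr] at *
      omega
    · rw [pt_tr, ← hc, ← hc, e, add_assoc]
  rcases hx with ⟨m, n, rfl⟩ | ⟨m, n, rfl⟩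
  · rw [tr_of (cs.simple 1 * cs.simple 2 * cs.simple 1) ⟨1, 1, 1⟩ m n ?_ (by exact_mod_cast hth m n)]
    · simp only [Dom, V, tr]; omega
    · rw [mul_assoc, hC.mul, hC.mul, ← mul_one (cs.simple 1), hC.mul, hC.one]
      simp [s, t1, t2]
  · rw [tr_of 1 ⟨0, 0, 0⟩ (m + 1) (n + 1) hC.one (by exact_mod_cast hths m n)]
    simp only [Dom, V, tr]; omega

theorem thk_of_thick (hC : Coord cs c) (hc : ∀ w, cen act w = pt (c w)) {Wadd : W → E2 → W}
    (hWadd : ∀ (z : W), ∀ v ∈ wLat, cen act (Wadd z v) = cen act z + v) {x y : W}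
    (hx : Dom (c x)) (hy : Dom (c y)) (h : Thick cs act Wadd x y) : Thk (c x) (c y) := by
  have add : ∀ (z : W) (v : E2) (a b : ℤ), v = (a : ℝ) • fw1 + (b : ℝ) • fw2 →
      c (Wadd z v) = tr a b (c z) := by
    intro z v a b e
    refine pt_inj (hC.valid _) ?_ ?_
    · have := hC.valid z
      simp only [V, tr] at *
      omega
    · rw [pt_tr, ← hc, ← hc, hWadd z v ⟨a, b, e⟩, e]
  have k1 := fun z => add z ((2 : ℝ) • a1) 4 (-2) (by ext <;> simp [a1, fw1, fw2] <;> norm_num)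
  have k2 := fun z => add z ((2 : ℝ) • a2) (-2) 4 (by ext <;> simp [a2, fw1, fw2] <;> norm_num)
  have k3 := fun z => add z (-((2 : ℝ) • a1)) (-4) 2 (by ext <;> simp [a1, fw1, fw2] <;> norm_num)
  have k4 := fun z => add z (-((2 : ℝ) • a2)) 2 (-4) (by ext <;> simp [a2, fw1, fw2] <;> norm_num)
  obtain ⟨⟨-, m1⟩, ⟨-, m2⟩, -, -, f1, f2, f3, f4⟩ := h
  have l1 := (hC.le_of_bruhat m1).in hy.in
  have l2 := (hC.le_of_bruhat m2).in hy.in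
  rw [k1] at l1
  rw [k2] at l2
  rw [hc, k1] at f1
  rw [hc, k2] at f2
  rw [hc, k3] at f3
  rw [hc, k4] at f4
  have g1 := f1.2.1
  have g2 := f2.1
  have g3 := f3.1
  have g4 := f4.2.1
  simp only [pt, tr, B2, a1, a2] at g1 g2 g3 g4
  have j1 : -3 ≤ 2 * ((c x).J - 2 + ((c x).K + 4 - 2) - 1) - ((c x).I + 4 + ((c x).K + 4 - 2) - 1) := by
    rify; push_cast at g1; linarith
  have j2 : -3 ≤ 2 * ((c x).I - 2 + ((c x).K - 2 + 4) - 1) - ((c x).J + 4 + ((c x).K - 2 + 4) - 1) := by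
    rify; push_cast at g2; linarith
  have j3 : -3 ≤ 2 * ((c y).I - 4 + ((c y).K - 4 + 2) - 1) - ((c y).J + 2 + ((c y).K - 4 + 2) - 1) := by
    rify; push_cast at g3; linarith
  have j4 : -3 ≤ 2 * ((c y).J - 4 + ((c y).K + 2 - 4) - 1) - ((c y).I + 2 + ((c y).K + 2 - 4) - 1) := by
    rify; push_cast at g4; linarith
  have vx := hx.1
  have vy := hy.1
  simp only [In, tr, V] at l1 l2 vx vy
  exact ⟨hx, hy, by omega, by omega, by omega, by omega, ⟨by omega, by omega⟩⟩

end Group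
end Alc

/-- isomorphic thick intervals have polygons that agree up to a translation
by a weight, possibly composed with the swap `σ` of the two simple roots; in particular
the polygons are congruent. -/
theorem statement14
    {W : Type*} [Group W] {M : CoxeterMatrix (Fin 3)} (cs : CoxeterSystem M W)
    (hM : ∀ i j : Fin 3, M i j = if i = j then 1 else 3)
    (act : W →* Equiv.Perm E2)
    (h0 : ∀ v, act (cs.simple 0) v = reflE rho2 (-1) v)
    (h1 : ∀ v, act (cs.simple 1) v = reflE a1 0 v)
    (h2 : ∀ v, act (cs.simple 2) v = reflE a2 0 v)
    (hcen : Function.Injective (cen act))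
    (th ths : ℕ → ℕ → W)
    (hth : ∀ m n : ℕ, cen act (th m n) =
      cen act (cs.simple 1 * cs.simple 2 * cs.simple 1) + (m : ℝ) • fw1 + (n : ℝ) • fw2)
    (hths : ∀ m n : ℕ, cen act (ths m n) =
      cen act 1 + ((m : ℝ) + 1) • fw1 + ((n : ℝ) + 1) • fw2)
    (Wadd : W → E2 → W)
    (hWadd : ∀ (z : W), ∀ v ∈ wLat, cen act (Wadd z v) = cen act z + v)
    (x y x' y' : W) (hx : x ∈ Dset th ths) (hy : y ∈ Dset th ths)
    (hx' : x' ∈ Dset th ths) (hy' : y' ∈ Dset th ths)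
    (hxy : bruhatLE cs x y) (hxy' : bruhatLE cs x' y')
    (hthick : Thick cs act Wadd x y) (hthick' : Thick cs act Wadd x' y')
    (hiso : IntervalIso cs cs x y x' y') :
    (∃ mu ∈ wLat,
      (fun v => v + mu) '' Pgn act x' y' = Pgn act x y ∨
      (fun v => v + mu) '' Pgn act x' y' = (fun v : E2 => (v.2, v.1)) '' Pgn act x y) ∧
    (∃ f : E2 → E2, Function.Bijective f ∧
      (∀ u v : E2, B2 (f u - f v) (f u - f v) = B2 (u - v) (u - v)) ∧
      f '' Pgn act x y = Pgn act x' y') := by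
  obtain ⟨c, hC, hc⟩ := Alc.exists_coord (Alc.act_simple h0 h1 h2) hcen
  have dx := Alc.dom_of_mem hC hc hth hths hx
  have dy := Alc.dom_of_mem hC hc hth hths hy
  have dx' := Alc.dom_of_mem hC hc hth hths hx'
  have dy' := Alc.dom_of_mem hC hc hth hths hy'
  obtain ⟨F⟩ := hC.exists_iso hxy hiso
  rw [Alc.pgn_eq hc dx, Alc.pgn_eq hc dx']
  exact Alc.congruent_of_match (F.matching (Alc.thk_of_thick hC hc hWadd dx dy hthick)
    (Alc.thk_of_thick hC hc hWadd dx' dy' hthick'))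
end
end

section
/- Stabilization of dominant Bruhat intervals in type A~2: let x ≤ y be dominant elements of W and let λ ∈ Λ be a dominant weight. Then there exists N0 ∈ ℕ such that for every N ≥ N0 the Bruhat intervals [x + N0·λ, y + N0·λ] and [x + N·λ, y + N·λ] are isomorphic as posets. -/
noncomputable section

open scoped RealInnerProductSpace

/-! ### Intervals of a relation covered by a common parametrization -/

section Parametrization

open Relation

variable {X X' P : Type*} {r : X → X → Prop} {r' : X' → X' → Prop}

theorem reflTransGen_lift_of_interval_subset_range {φ : P → X} (hφ : Function.Injective φ)
    {x y : P}
    (hcov : ∀ z, ReflTransGen r (φ x) z → ReflTransGen r z (φ y) → z ∈ Set.range φ)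
    {p : P} (hxp : ReflTransGen r (φ x) (φ p)) {z : X} (hpz : ReflTransGen r (φ p) z)
    (hzy : ReflTransGen r z (φ y)) {q : P} (hq : φ q = z) :
    ReflTransGen (fun a b => r (φ a) (φ b)) p q := by
  induction hpz generalizing q with
  | refl => rw [hφ hq]
  | tail hb hbc ih =>
    have hby := ReflTransGen.head hbc hzy
    obtain ⟨b', rfl⟩ := hcov _ (hxp.trans hb) hby
    exact (ih hby rfl).tail (by simpa [hq] using hbc)

theorem exists_interval_equiv {φ : P → X} (hφ : Function.Injective φ) {x y : P}
    (hcov : ∀ z, ReflTransGen r (φ x) z → ReflTransGen r z (φ y) → z ∈ Set.range φ)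
    {E : P → P → Prop} (hE : ∀ p q, E p q ↔ r (φ p) (φ q)) :
    ∃ e : {p : P // ReflTransGen E x p ∧ ReflTransGen E p y} ≃
        {z : X // ReflTransGen r (φ x) z ∧ ReflTransGen r z (φ y)},
      ∀ p q, ReflTransGen E p.1 q.1 ↔ ReflTransGen r (e p).1 (e q).1 := by
  obtain rfl : E = fun p q => r (φ p) (φ q) := by
    funext p q
    exact propext (hE p q)
  have push : ∀ {p q : P}, ReflTransGen (fun a b => r (φ a) (φ b)) p q →
      ReflTransGen r (φ p) (φ q) := fun h => h.lift φ fun _ _ h => h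
  refine ⟨Equiv.ofBijective (fun p => ⟨φ p.1, push p.2.1, push p.2.2⟩) ⟨?_, ?_⟩, ?_⟩
  · intro p q h
    exact Subtype.ext (hφ (congrArg Subtype.val h))
  · rintro ⟨z, hz⟩
    obtain ⟨p, rfl⟩ := hcov z hz.1 hz.2
    exact ⟨⟨p, reflTransGen_lift_of_interval_subset_range hφ hcov .refl hz.1 hz.2 rfl,
      reflTransGen_lift_of_interval_subset_range hφ hcov hz.1 hz.2 .refl rfl⟩, rfl⟩
  · intro p q
    refine ⟨push, fun h => ?_⟩
    exact reflTransGen_lift_of_interval_subset_range hφ hcov (push p.2.1) h (push q.2.2) rfl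

/-- Two relations with a common parametrization of the intervals `[φ x, φ y]` and `[φ' x, φ' y]`
have isomorphic intervals. -/
theorem exists_interval_equiv_of_parametrizations {φ : P → X} {φ' : P → X'}
    (hφ : Function.Injective φ) (hφ' : Function.Injective φ')
    (hr : ∀ p q, r (φ p) (φ q) ↔ r' (φ' p) (φ' q)) {x y : P}
    (hcov : ∀ z, ReflTransGen r (φ x) z → ReflTransGen r z (φ y) → z ∈ Set.range φ)
    (hcov' : ∀ z, ReflTransGen r' (φ' x) z → ReflTransGen r' z (φ' y) → z ∈ Set.range φ') :
    ∃ e : {z : X // ReflTransGen r (φ x) z ∧ ReflTransGen r z (φ y)} ≃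
        {z : X' // ReflTransGen r' (φ' x) z ∧ ReflTransGen r' z (φ' y)},
      ∀ a b, ReflTransGen r a.1 b.1 ↔ ReflTransGen r' (e a).1 (e b).1 := by
  obtain ⟨e, he⟩ := exists_interval_equiv hφ hcov fun _ _ => Iff.rfl
  obtain ⟨e', he'⟩ := exists_interval_equiv hφ' hcov' hr
  refine ⟨e.symm.trans e', fun a b => ?_⟩
  have h1 := he (e.symm a) (e.symm b)
  have h2 := he' (e.symm a) (e.symm b)
  simp only [Equiv.apply_symm_apply] at h1
  exact h1.symm.trans h2

end Parametrization

/-! ### Alcoves as integer triples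

An alcove is recorded by the triple `(A, B, C)` for which its points `v` satisfy
`A - 1 < (α₁, v) < A`, `B - 1 < (α₂, v) < B` and `C - 1 < (ρ, v) < C`. -/

namespace Alcove

/-- The triples coming from alcoves. -/
def IsAlcove (u : ℤ × ℤ × ℤ) : Prop := u.2.2 = u.1 + u.2.1 ∨ u.2.2 = u.1 + u.2.1 - 1

/-- The number of hyperplanes separating an alcove from the fundamental one. -/
def len (u : ℤ × ℤ × ℤ) : ℕ := u.1.natAbs + u.2.1.natAbs + u.2.2.natAbs

/-- The positive roots, indexed so that the `i`-th one is the gradient of the wall of `sᵢ`. -/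
def root : Fin 3 → E2 := ![rho2, a1, a2]

/-- The level of the wall of `sᵢ`. -/
def level : Fin 3 → ℤ := ![-1, 0, 0]

/-- The affine reflection `s_{root i, k}` on triples. -/
def reflect (i : Fin 3) (k : ℤ) (u : ℤ × ℤ × ℤ) : ℤ × ℤ × ℤ :=
  match i with
  | 0 => (k + 1 - u.2.1, k + 1 - u.1, 2 * k + 1 - u.2.2)
  | 1 => (2 * k + 1 - u.1, u.2.2 - k, u.2.1 + k)
  | 2 => (u.2.2 - k, 2 * k + 1 - u.2.1, u.1 + k)

/-- The coordinate of a triple along `root i`. -/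
def coord (i : Fin 3) (u : ℤ × ℤ × ℤ) : ℤ :=
  match i with
  | 0 => u.2.2
  | 1 => u.1
  | 2 => u.2.1

/-- The linear reflection in `root i` on the triples `((α₁, v), (α₂, v), (ρ, v))`. -/
def linReflect (i : Fin 3) (v : ℤ × ℤ × ℤ) : ℤ × ℤ × ℤ :=
  match i with
  | 0 => (-v.2.1, -v.1, -v.2.2)
  | 1 => (-v.1, v.2.2, v.2.1)
  | 2 => (v.2.2, -v.2.1, v.1)

/-- The barycenter of an alcove. -/
def center (u : ℤ × ℤ × ℤ) : E2 := (((u.1 : ℝ) + u.2.2 - 1) / 3, ((u.2.1 : ℝ) + u.2.2 - 1) / 3)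

/-- The edges of the Bruhat graph on triples. -/
def Up (u u' : ℤ × ℤ × ℤ) : Prop := (∃ i k, u' = reflect i k u) ∧ len u < len u'

/-- All coordinates are at most `R` in absolute value. -/
def Bounded (R : ℕ) (u : ℤ × ℤ × ℤ) : Prop :=
  u.1.natAbs ≤ R ∧ u.2.1.natAbs ≤ R ∧ u.2.2.natAbs ≤ R

/-- The vectors having the same invariants under the finite Weyl group as `l`. -/
def OrbitLike (l v : ℤ × ℤ × ℤ) : Prop :=
  v.2.2 = v.1 + v.2.1 ∧
    v.1 ^ 2 + v.1 * v.2.1 + v.2.1 ^ 2 = l.1 ^ 2 + l.1 * l.2.1 + l.2.1 ^ 2 ∧ len v = len l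

theorem center_injOn {u u' : ℤ × ℤ × ℤ} (hu : IsAlcove u) (hu' : IsAlcove u')
    (h : center u = center u') : u = u' := by
  obtain ⟨a, b, c⟩ := u
  obtain ⟨a', b', c'⟩ := u'
  simp only [center, IsAlcove, Prod.mk.injEq] at *
  obtain ⟨h1, h2⟩ := h
  have e1 : (a : ℝ) + c = a' + c' := by linarith
  have e2 : (b : ℝ) + c = b' + c' := by linarith
  norm_cast at e1 e2
  omega

theorem reflE_center (i : Fin 3) (k : ℤ) (u : ℤ × ℤ × ℤ) :
    reflE (root i) k (center u) = center (reflect i k u) := by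
  fin_cases i <;>
  · simp [reflE, root, center, reflect, B2, rho2, a1, a2]
    refine ⟨?_, ?_⟩ <;> ring

theorem IsAlcove.reflect {u : ℤ × ℤ × ℤ} (hu : IsAlcove u) (i : Fin 3) (k : ℤ) :
    IsAlcove (reflect i k u) := by
  fin_cases i <;> simp only [IsAlcove, Alcove.reflect] at * <;> omega

theorem IsAlcove.add {u v : ℤ × ℤ × ℤ} (hu : IsAlcove u) (hv : v.2.2 = v.1 + v.2.1) :
    IsAlcove (u + v) := by
  simp only [IsAlcove, Prod.fst_add, Prod.snd_add] at *
  omega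

theorem exists_reflect_conj (i j : Fin 3) (k l : ℤ) :
    ∃ i' k', ∀ u, reflect i k (reflect j l (reflect i k u)) = reflect i' k' u := by
  fin_cases i <;> fin_cases j
  · exact ⟨0, 2 * k - l, by rintro ⟨a, b, c⟩; simp [reflect]; omega⟩
  · exact ⟨2, k - l, by rintro ⟨a, b, c⟩; simp [reflect]; omega⟩
  · exact ⟨1, k - l, by rintro ⟨a, b, c⟩; simp [reflect]; omega⟩
  · exact ⟨2, l - k, by rintro ⟨a, b, c⟩; simp [reflect]; omega⟩
  · exact ⟨1, 2 * k - l, by rintro ⟨a, b, c⟩; simp [reflect]; omega⟩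
  · exact ⟨0, k + l, by rintro ⟨a, b, c⟩; simp [reflect]; omega⟩
  · exact ⟨1, l - k, by rintro ⟨a, b, c⟩; simp [reflect]; omega⟩
  · exact ⟨0, k + l, by rintro ⟨a, b, c⟩; simp [reflect]; omega⟩
  · exact ⟨2, 2 * k - l, by rintro ⟨a, b, c⟩; simp [reflect]; omega⟩

theorem len_reflect_level_le {u : ℤ × ℤ × ℤ} (hu : IsAlcove u) (i : Fin 3) :
    len (reflect i (level i) u) ≤ len u + 1 := by
  obtain ⟨a, b, c⟩ := u
  simp only [IsAlcove] at hu
  fin_cases i <;> simp [len, reflect, level] <;> omega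

theorem exists_len_reflect_level {u : ℤ × ℤ × ℤ} (hu : IsAlcove u) (h : u ≠ 0) :
    ∃ i, len (reflect i (level i) u) + 1 = len u := by
  obtain ⟨a, b, c⟩ := u
  simp only [IsAlcove, ne_eq, Prod.mk_eq_zero] at hu h
  by_cases ha : 1 ≤ a
  · refine ⟨1, ?_⟩
    simp [len, reflect, level]
    omega
  by_cases hb : 1 ≤ b
  · refine ⟨2, ?_⟩
    simp [len, reflect, level]
    omega
  refine ⟨0, ?_⟩
  simp [len, reflect, level]
  omega

/-- A reflection raising the length by at most `L` is near the origin or near the alcove. -/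
theorem level_near_of_len {u : ℤ × ℤ × ℤ} (hu : IsAlcove u) {i : Fin 3} {k : ℤ} {L : ℕ}
    (h1 : len u < len (reflect i k u)) (h2 : len (reflect i k u) ≤ len u + L) :
    k.natAbs ≤ L + 1 ∨ (k - coord i u).natAbs ≤ L + 1 := by
  obtain ⟨a, b, c⟩ := u
  fin_cases i <;> simp [len, reflect, coord, IsAlcove] at * <;> omega

theorem reflect_add (i : Fin 3) (k : ℤ) (u v : ℤ × ℤ × ℤ) :
    reflect i k (u + v) = reflect i k u + linReflect i v := by
  obtain ⟨a, b, c⟩ := u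
  obtain ⟨p, q, s⟩ := v
  fin_cases i <;> simp [reflect, linReflect] <;> omega

theorem reflect_add_coord (i : Fin 3) (k : ℤ) (u : ℤ × ℤ × ℤ) {v : ℤ × ℤ × ℤ}
    (hv : v.2.2 = v.1 + v.2.1) : reflect i (k + coord i v) (u + v) = reflect i k u + v := by
  obtain ⟨a, b, c⟩ := u
  obtain ⟨p, q, s⟩ := v
  fin_cases i <;> simp [reflect, coord] at * <;> omega

theorem linReflect_smul (i : Fin 3) (n : ℤ) (v : ℤ × ℤ × ℤ) :
    linReflect i (n • v) = n • linReflect i v := by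
  fin_cases i <;> simp [linReflect]

theorem coord_smul (i : Fin 3) (n : ℤ) (v : ℤ × ℤ × ℤ) : coord i (n • v) = n * coord i v := by
  fin_cases i <;> simp [coord]

theorem coord_add (i : Fin 3) (u v : ℤ × ℤ × ℤ) :
    coord i (u + v) = coord i u + coord i v := by
  fin_cases i <;> simp [coord]

theorem smul_snd_snd {v : ℤ × ℤ × ℤ} (hv : v.2.2 = v.1 + v.2.1) (n : ℤ) :
    (n • v).2.2 = (n • v).1 + (n • v).2.1 := by
  simp [hv, mul_add]

theorem OrbitLike.linReflect {l v : ℤ × ℤ × ℤ} (hv : OrbitLike l v) (i : Fin 3) :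
    OrbitLike l (linReflect i v) := by
  obtain ⟨p, q, s⟩ := v
  obtain ⟨h1, h2, h3⟩ := hv
  simp only at h1 h2
  rw [OrbitLike, ← h2, ← h3]
  subst h1
  fin_cases i <;> simp [Alcove.linReflect, len] <;> refine ⟨by ring, ?_⟩ <;> omega

theorem bounded_reflect_of_level {u : ℤ × ℤ × ℤ} {R L : ℕ} (hR : Bounded R u) {i : Fin 3}
    {k : ℤ} (hk : k.natAbs ≤ L + 1) : Bounded (R + (2 * L + 3)) (reflect i k u) := by
  obtain ⟨a, b, c⟩ := u
  fin_cases i <;> simp [reflect, Bounded] at * <;> omega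

theorem bounded_reflect_of_coord {u : ℤ × ℤ × ℤ} (hu : IsAlcove u) {R L : ℕ}
    (hR : Bounded R u) {i : Fin 3} {k : ℤ} (hk : (k - coord i u).natAbs ≤ L + 1) :
    Bounded (R + (2 * L + 3)) (reflect i k u) := by
  obtain ⟨a, b, c⟩ := u
  fin_cases i <;> simp [reflect, Bounded, coord, IsAlcove] at * <;> omega

/-- `z` lies within `R` of a point `N v`, with `v` in the orbit of `l`. -/
def Near (l : ℤ × ℤ × ℤ) (R N : ℕ) (z : ℤ × ℤ × ℤ) : Prop :=
  ∃ v u, OrbitLike l v ∧ Bounded R u ∧ IsAlcove u ∧ z = u + (N : ℤ) • v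

theorem Near.mono {l z : ℤ × ℤ × ℤ} {R R' N : ℕ} (h : Near l R N z) (hR : R ≤ R') :
    Near l R' N z := by
  obtain ⟨v, u, hv, hb, hu⟩ := h
  exact ⟨v, u, hv, ⟨hb.1.trans hR, hb.2.1.trans hR, hb.2.2.trans hR⟩, hu⟩

theorem Near.up {l z z' : ℤ × ℤ × ℤ} {R L N : ℕ} (h : Near l R N z) (hup : Up z z')
    (hL : len z' ≤ len z + L) : Near l (R + (2 * L + 3)) N z' := by
  obtain ⟨v, u, hv, hb, hu, rfl⟩ := h
  obtain ⟨⟨i, k, rfl⟩, hlt⟩ := hup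
  have hNv := smul_snd_snd hv.1 N
  rcases level_near_of_len (hu.add hNv) hlt hL with hk | hk
  · refine ⟨linReflect i v, reflect i k u, hv.linReflect i, bounded_reflect_of_level hb hk,
      hu.reflect i k, ?_⟩
    rw [reflect_add, linReflect_smul]
  · refine ⟨v, reflect i (k - coord i ((N : ℤ) • v)) u, hv, bounded_reflect_of_coord hu hb ?_,
      hu.reflect _ _, ?_⟩
    · rw [coord_add] at hk
      rwa [sub_sub, add_comm (coord i ((N : ℤ) • v))]
    · rw [← reflect_add_coord _ _ _ hNv, sub_add_cancel]

theorem len_le_of_reflTransGen {z z' : ℤ × ℤ × ℤ} (h : Relation.ReflTransGen Up z z') :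
    len z ≤ len z' := by
  induction h with
  | refl => exact le_rfl
  | tail _ h ih => exact ih.trans h.2.le

theorem Near.reflTransGen {l z z' : ℤ × ℤ × ℤ} {R L N : ℕ} (h : Near l R N z)
    (hzz' : Relation.ReflTransGen Up z z') (hL : len z' ≤ len z + L) :
    Near l (R + (2 * L + 3) * (len z' - len z)) N z' := by
  induction hzz' with
  | refl => exact h.mono (by omega)
  | @tail b c hb hbc ih =>
    have h1 := len_le_of_reflTransGen hb
    have h2 := hbc.2
    refine ((ih (by omega)).up hbc (L := L) (by omega)).mono ?_
    rw [add_assoc, ← Nat.mul_succ]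
    gcongr
    omega

theorem eq_zero_of_mul_natAbs_lt {N d : ℤ} (h : (N * d).natAbs < N.natAbs) : d = 0 := by
  by_contra hd
  rw [Int.natAbs_mul] at h
  exact absurd h (not_lt.mpr (Nat.le_mul_of_pos_right _ (Int.natAbs_pos.mpr hd)))

theorem natAbs_add_mul {a p : ℤ} {R N N' : ℕ} (ha : a.natAbs ≤ R) (hN : R ≤ N)
    (hN' : R ≤ N') :
    (a + N' * p).natAbs + N * p.natAbs = (a + N * p).natAbs + N' * p.natAbs := by
  rcases lt_trichotomy p 0 with hp | rfl | hp
  · have h1 : a + N * p ≤ 0 := by nlinarith [show a ≤ N by omega]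
    have h2 : a + N' * p ≤ 0 := by nlinarith [show a ≤ N' by omega]
    zify
    rw [abs_of_nonpos h1, abs_of_nonpos h2, abs_of_neg hp]
    ring
  · simp
  · have h1 : 0 ≤ a + N * p := by nlinarith [show -a ≤ N by omega]
    have h2 : 0 ≤ a + N' * p := by nlinarith [show -a ≤ N' by omega]
    zify
    rw [abs_of_nonneg h1, abs_of_nonneg h2, abs_of_pos hp]
    ring

theorem len_add_smul {u v : ℤ × ℤ × ℤ} {R N N' : ℕ} (hu : Bounded R u) (hN : R ≤ N)
    (hN' : R ≤ N') :
    len (u + (N' : ℤ) • v) + N * len v = len (u + (N : ℤ) • v) + N' * len v := by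
  have h1 := natAbs_add_mul (p := v.1) hu.1 hN hN'
  have h2 := natAbs_add_mul (p := v.2.1) hu.2.1 hN hN'
  have h3 := natAbs_add_mul (p := v.2.2) hu.2.2 hN hN'
  simp only [len, Prod.fst_add, Prod.snd_add, Prod.smul_fst, Prod.smul_snd, smul_eq_mul, mul_add]
  omega

theorem len_add_smul_of_nonneg {u v : ℤ × ℤ × ℤ} (hu : 0 ≤ u) (hv : 0 ≤ v) (N : ℕ) :
    len (u + (N : ℤ) • v) = len u + N * len v := by
  obtain ⟨a, b, c⟩ := u
  obtain ⟨p, q, s⟩ := v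
  simp only [Prod.le_def, Prod.fst_zero, Prod.snd_zero] at hu hv
  obtain ⟨ha, hb, hc⟩ := hu
  obtain ⟨hp, hq, hs⟩ := hv
  lift a to ℕ using ha
  lift b to ℕ using hb
  lift c to ℕ using hc
  lift p to ℕ using hp
  lift q to ℕ using hq
  lift s to ℕ using hs
  simp only [len, Prod.smul_mk, Prod.mk_add_mk, smul_eq_mul]
  norm_cast
  ring

/-- A reflection can only join the neighbourhoods of `N v` and `N v'` if it fixes `N v` up to a
bounded error, or if it is a bounded translate of a linear reflection exchanging `v` and `v'`. -/
theorem eq_or_eq_linReflect {l u u' v v' : ℤ × ℤ × ℤ} {R N : ℕ} (hN : 4 * R < N)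
    (hu : Bounded R u) (hu' : Bounded R u') (hv : OrbitLike l v) (hv' : OrbitLike l v')
    {i : Fin 3} {k : ℤ} (h : u' + (N : ℤ) • v' = reflect i k (u + (N : ℤ) • v)) :
    v' = v ∨ v' = linReflect i v := by
  obtain ⟨a, b, c⟩ := u
  obtain ⟨a', b', c'⟩ := u'
  obtain ⟨p, q, s⟩ := v
  obtain ⟨p', q', s'⟩ := v'
  have hq := hv.2.1.trans hv'.2.1.symm
  have hs := hv.1
  have hs' := hv'.1
  simp only [Bounded] at hu hu' hq hs hs'
  subst hs hs'
  fin_cases i <;>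
    simp only [reflect, linReflect, Prod.smul_mk, Prod.mk_add_mk, smul_eq_mul, Prod.mk.injEq] at h ⊢ <;>
    obtain ⟨e1, e2, e3⟩ := h
  · have hd : (N : ℤ) * ((p' - q') - (p - q)) = (a - b) - (a' - b') := by linarith
    have hz := eq_zero_of_mul_natAbs_lt (N := N) (d := (p' - q') - (p - q)) (by omega)
    have hsq : (p' + q') ^ 2 = (p + q) ^ 2 := by
      have : p' - q' = p - q := by linarith
      have : (p' - q') ^ 2 = (p - q) ^ 2 := by rw [this]
      linarith
    rcases sq_eq_sq_iff_eq_or_eq_neg.mp hsq with h | h <;> omega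
  · have hd : (N : ℤ) * ((p' + 2 * q') - (p + 2 * q)) = (b + c) - (b' + c') := by linarith
    have hz := eq_zero_of_mul_natAbs_lt (N := N) (d := (p' + 2 * q') - (p + 2 * q)) (by omega)
    have hsq : p' ^ 2 = p ^ 2 := by
      have : p' + 2 * q' = p + 2 * q := by linarith
      have : (p' + 2 * q') ^ 2 = (p + 2 * q) ^ 2 := by rw [this]
      linarith
    rcases sq_eq_sq_iff_eq_or_eq_neg.mp hsq with h | h <;> omega
  · have hd : (N : ℤ) * ((2 * p' + q') - (2 * p + q)) = (a + c) - (a' + c') := by linarith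
    have hz := eq_zero_of_mul_natAbs_lt (N := N) (d := (2 * p' + q') - (2 * p + q)) (by omega)
    have hsq : q' ^ 2 = q ^ 2 := by
      have : 2 * p' + q' = 2 * p + q := by linarith
      have : (2 * p' + q') ^ 2 = (2 * p + q) ^ 2 := by rw [this]
      linarith
    rcases sq_eq_sq_iff_eq_or_eq_neg.mp hsq with h | h <;> omega

/-- The Bruhat graph near the orbit of `N l` does not depend on `N`, for `N` large. -/
theorem Up.change_scale {l u u' v v' : ℤ × ℤ × ℤ} {R N N' : ℕ} (hN : 4 * R < N)
    (hN' : 4 * R < N') (hu : Bounded R u) (hu' : Bounded R u') (hv : OrbitLike l v)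
    (hv' : OrbitLike l v') (h : Up (u + (N : ℤ) • v) (u' + (N : ℤ) • v')) :
    Up (u + (N' : ℤ) • v) (u' + (N' : ℤ) • v') := by
  obtain ⟨⟨i, k, hk⟩, hlt⟩ := h
  refine ⟨?_, ?_⟩
  · rcases eq_or_eq_linReflect hN hu hu' hv hv' hk with rfl | rfl
    · refine ⟨i, k - coord i ((N : ℤ) • v') + coord i ((N' : ℤ) • v'), ?_⟩
      rw [reflect_add_coord _ _ _ (smul_snd_snd hv.1 _)]
      rw [← sub_add_cancel k (coord i ((N : ℤ) • v')),
        reflect_add_coord _ _ _ (smul_snd_snd hv.1 _)] at hk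
      rw [add_right_cancel hk]
    · refine ⟨i, k, ?_⟩
      rw [reflect_add, linReflect_smul] at hk ⊢
      rw [add_right_cancel hk]
  · have e1 := len_add_smul (v := v) (N := N) (N' := N') hu (by omega) (by omega)
    have e2 := len_add_smul (v := v') (N := N) (N' := N') hu' (by omega) (by omega)
    rw [hv.2.2] at e1
    rw [hv'.2.2] at e2
    omega

theorem eq_and_eq_of_add_smul_eq {u u' v v' : ℤ × ℤ × ℤ} {R N : ℕ} (hN : 4 * R < N)
    (hu : Bounded R u) (hu' : Bounded R u') (h : u + (N : ℤ) • v = u' + (N : ℤ) • v') :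
    v = v' ∧ u = u' := by
  have hv : v = v' := by
    obtain ⟨a, b, c⟩ := u
    obtain ⟨a', b', c'⟩ := u'
    obtain ⟨p, q, s⟩ := v
    obtain ⟨p', q', s'⟩ := v'
    simp only [Bounded, Prod.smul_mk, Prod.mk_add_mk, smul_eq_mul, Prod.mk.injEq] at *
    obtain ⟨e1, e2, e3⟩ := h
    have h1 : (N : ℤ) * (p - p') = a' - a := by linarith
    have h2 : (N : ℤ) * (q - q') = b' - b := by linarith
    have h3 : (N : ℤ) * (s - s') = c' - c := by linarith
    have := eq_zero_of_mul_natAbs_lt (N := N) (d := p - p') (by omega)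
    have := eq_zero_of_mul_natAbs_lt (N := N) (d := q - q') (by omega)
    have := eq_zero_of_mul_natAbs_lt (N := N) (d := s - s') (by omega)
    omega
  subst hv
  exact ⟨rfl, add_right_cancel h⟩

/-! ### Identification of the Coxeter group with the set of alcoves -/

section Coxeter

variable {W : Type*} [Group W] {M : CoxeterMatrix (Fin 3)} (cs : CoxeterSystem M W)

/-- `κ` sends the elements of `W` to their alcoves, the simple generators acting by the
reflections in the walls of the fundamental alcove. -/
structure IsAlcoveMap (κ : W → ℤ × ℤ × ℤ) : Prop where
  injective : Function.Injective κ
  isAlcove : ∀ z, IsAlcove (κ z)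
  one : κ 1 = 0
  simple_mul : ∀ i z, κ (cs.simple i * z) = reflect i (level i) (κ z)

theorem exists_isAlcoveMap (act : W →* Equiv.Perm E2)
    (hs : ∀ i v, act (cs.simple i) v = reflE (root i) (level i) v)
    (hcen : Function.Injective (cen act)) :
    ∃ κ : W → ℤ × ℤ × ℤ, IsAlcoveMap cs κ ∧ ∀ z, cen act z = center (κ z) := by
  have hmul : ∀ i z, cen act (cs.simple i * z) = reflE (root i) (level i) (cen act z) := by
    intro i z
    simp [cen, hs]
  have hone : cen act 1 = center 0 := by
    simp [cen, center, rho2]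
    norm_num
  have hex : ∀ z, ∃ u, IsAlcove u ∧ cen act z = center u := by
    intro z
    induction z using cs.simple_induction_left with
    | one => exact ⟨0, Or.inl rfl, hone⟩
    | mul_simple_left w i ih =>
      obtain ⟨u, hu, h⟩ := ih
      exact ⟨reflect i (level i) u, hu.reflect _ _, by rw [hmul, h, reflE_center]⟩
  choose κ hκ hc using hex
  refine ⟨κ, ⟨fun a b h => hcen ?_, hκ, ?_, fun i z => ?_⟩, hc⟩
  · rw [hc, hc, h]
  · exact center_injOn (hκ _) (Or.inl rfl) (by rw [← hc, hone])
  · exact center_injOn (hκ _) ((hκ _).reflect _ _) (by rw [← hc, hmul, hc, reflE_center])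

variable {cs} {κ : W → ℤ × ℤ × ℤ}

theorem IsAlcoveMap.len_eq (hκ : IsAlcoveMap cs κ) (z : W) : cs.length z = len (κ z) := by
  apply le_antisymm
  · induction hn : len (κ z) generalizing z with
    | zero =>
      by_cases h : κ z = 0
      · rw [hκ.injective (h.trans hκ.one.symm), cs.length_one]
      · obtain ⟨i, hi⟩ := exists_len_reflect_level (hκ.isAlcove z) h
        omega
    | succ n ih =>
      have h : κ z ≠ 0 := by
        intro h
        simp [h, len] at hn
      obtain ⟨i, hi⟩ := exists_len_reflect_level (hκ.isAlcove z) h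
      have h1 := ih (cs.simple i * z) (by rw [hκ.simple_mul]; omega)
      have h2 := cs.length_mul_le (cs.simple i) (cs.simple i * z)
      rw [cs.simple_mul_simple_cancel_left, cs.length_simple] at h2
      omega
  · obtain ⟨ω, hω, rfl⟩ := cs.exists_isReduced z
    rw [hω]
    clear hω
    induction ω with
    | nil => simp [hκ.one, len]
    | cons i ω ih =>
      rw [cs.wordProd_cons, hκ.simple_mul, List.length_cons]
      exact (len_reflect_level_le (hκ.isAlcove _) i).trans (by omega)

theorem IsAlcoveMap.exists_reflect (hκ : IsAlcoveMap cs κ) {t : W} (ht : cs.IsReflection t) :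
    ∃ i k, ∀ z, κ (t * z) = reflect i k (κ z) := by
  obtain ⟨w, j, rfl⟩ := ht
  induction w using cs.simple_induction_left with
  | one => exact ⟨j, level j, fun z => by simp [hκ.simple_mul]⟩
  | mul_simple_left w i ih =>
    obtain ⟨j', k, h⟩ := ih
    obtain ⟨i', k', h'⟩ := exists_reflect_conj i j' (level i) k
    refine ⟨i', k', fun z => ?_⟩
    rw [← h', ← hκ.simple_mul, ← h, ← hκ.simple_mul]
    simp [mul_assoc]

theorem IsAlcoveMap.conj_simple (hκ : IsAlcoveMap cs κ) {t : W} (ht : cs.IsReflection t)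
    {j : Fin 3} {k : ℤ} (h : ∀ z, κ (t * z) = reflect j k (κ z)) (i : Fin 3) {j' : Fin 3}
    {k' : ℤ}
    (hc : ∀ u, reflect i (level i) (reflect j k (reflect i (level i) u)) = reflect j' k' u) :
    ∃ t, cs.IsReflection t ∧ ∀ z, κ (t * z) = reflect j' k' (κ z) := by
  refine ⟨cs.simple i * t * (cs.simple i)⁻¹, ht.conj _, fun z => ?_⟩
  rw [← hc, ← hκ.simple_mul, ← h, ← hκ.simple_mul]
  simp [mul_assoc]

theorem IsAlcoveMap.exists_isReflection (hκ : IsAlcoveMap cs κ) (i : Fin 3) (k : ℤ) :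
    ∃ t, cs.IsReflection t ∧ ∀ z, κ (t * z) = reflect i k (κ z) := by
  have step : ∀ k : ℤ, (∃ t, cs.IsReflection t ∧ ∀ z, κ (t * z) = reflect 0 k (κ z)) →
      (∃ t, cs.IsReflection t ∧ ∀ z, κ (t * z) = reflect 0 (-k) (κ z)) := by
    rintro k ⟨t, ht, h⟩
    obtain ⟨t, ht, h⟩ := hκ.conj_simple ht h 1 (j' := 2) (k' := k)
      (by rintro ⟨a, b, c⟩; simp [reflect, level]; omega)
    obtain ⟨t, ht, h⟩ := hκ.conj_simple ht h 2 (j' := 2) (k' := -k)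
      (by rintro ⟨a, b, c⟩; simp [reflect, level]; omega)
    exact hκ.conj_simple ht h 1 (by rintro ⟨a, b, c⟩; simp [reflect, level]; omega)
  have step' : ∀ k : ℤ, (∃ t, cs.IsReflection t ∧ ∀ z, κ (t * z) = reflect 0 k (κ z)) →
      (∃ t, cs.IsReflection t ∧ ∀ z, κ (t * z) = reflect 0 (-2 - k) (κ z)) := by
    rintro k ⟨t, ht, h⟩
    exact hκ.conj_simple ht h 0 (by rintro ⟨a, b, c⟩; simp [reflect, level]; omega)
  have base : ∃ t, cs.IsReflection t ∧ ∀ z, κ (t * z) = reflect 0 (-1) (κ z) :=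
    ⟨cs.simple 0, cs.isReflection_simple 0, hκ.simple_mul 0⟩
  have base' : ∃ t, cs.IsReflection t ∧ ∀ z, κ (t * z) = reflect 0 0 (κ z) :=
    hκ.conj_simple (cs.isReflection_simple 1) (hκ.simple_mul 1) 2
      (by rintro ⟨a, b, c⟩; simp [reflect, level])
  have nat : ∀ n : ℕ, (∃ t, cs.IsReflection t ∧ ∀ z, κ (t * z) = reflect 0 n (κ z)) ∧
      ∃ t, cs.IsReflection t ∧ ∀ z, κ (t * z) = reflect 0 (n + 1) (κ z) := by
    intro n
    induction n with
    | zero => exact ⟨base', by simpa using step _ base⟩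
    | succ n ih =>
      refine ⟨by exact_mod_cast ih.2, ?_⟩
      have := step _ (step' _ ih.1)
      convert this using 6
      push_cast
      ring
  have zero : ∀ k : ℤ, ∃ t, cs.IsReflection t ∧ ∀ z, κ (t * z) = reflect 0 k (κ z) := by
    intro k
    obtain ⟨n, rfl | rfl⟩ := k.eq_nat_or_neg
    · exact (nat n).1
    · exact step _ (nat n).1
  obtain ⟨t, ht, h⟩ := zero k
  fin_cases i
  · exact ⟨t, ht, h⟩
  · exact hκ.conj_simple ht h 2 (by rintro ⟨a, b, c⟩; simp [reflect, level]; omega)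
  · exact hκ.conj_simple ht h 1 (by rintro ⟨a, b, c⟩; simp [reflect, level]; omega)

theorem IsAlcoveMap.up_iff (hκ : IsAlcoveMap cs κ) (a b : W) :
    ((∃ t, cs.IsReflection t ∧ b = t * a) ∧ cs.length a < cs.length b) ↔ Up (κ a) (κ b) := by
  rw [hκ.len_eq, hκ.len_eq, Up]
  refine and_congr_left fun _ => ⟨?_, ?_⟩
  · rintro ⟨t, ht, rfl⟩
    obtain ⟨i, k, h⟩ := hκ.exists_reflect ht
    exact ⟨i, k, h a⟩
  · rintro ⟨i, k, h⟩
    obtain ⟨t, ht, h'⟩ := hκ.exists_isReflection i k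
    exact ⟨t, ht, hκ.injective (by rw [h, h'])⟩

theorem bruhatLE_eq_reflTransGen :
    bruhatLE cs = Relation.ReflTransGen
      (fun a b => (∃ t, cs.IsReflection t ∧ b = t * a) ∧ cs.length a < cs.length b) := by
  ext x y
  rw [Relation.reflTransGen_iff_eq_or_transGen, eq_comm, bruhatLE, bruhatLT]

/-- Intervals between alcoves translated along the same dominant direction stabilize. -/
theorem IsAlcoveMap.intervalIso (hκ : IsAlcoveMap cs κ)
    (hsurj : ∀ u, IsAlcove u → ∃ z, κ z = u) {u w l : ℤ × ℤ × ℤ} (hu : IsAlcove u)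
    (hw : IsAlcove w) (hl : l.2.2 = l.1 + l.2.1) (hu0 : 0 ≤ u) (hw0 : 0 ≤ w) (hl0 : 0 ≤ l)
    {N N' : ℕ} (hN : 4 * (len u + len w + (2 * len w + 3) * len w) < N)
    (hN' : 4 * (len u + len w + (2 * len w + 3) * len w) < N') {x y x' y' : W}
    (hx : κ x = u + (N : ℤ) • l) (hy : κ y = w + (N : ℤ) • l)
    (hx' : κ x' = u + (N' : ℤ) • l) (hy' : κ y' = w + (N' : ℤ) • l) :
    IntervalIso cs cs x y x' y' := by
  set R := len u + len w + (2 * len w + 3) * len w with hR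
  let P := {p : (ℤ × ℤ × ℤ) × (ℤ × ℤ × ℤ) // OrbitLike l p.1 ∧ Bounded R p.2 ∧ IsAlcove p.2}
  have hex : ∀ (n : ℕ) (p : P), ∃ z, κ z = p.1.2 + (n : ℤ) • p.1.1 := fun n p =>
    hsurj _ (p.2.2.2.add (smul_snd_snd p.2.1.1 n))
  choose φ hφ using hex
  have hinj : ∀ n, 4 * R < n → Function.Injective (φ n) := by
    intro n hn p q h
    have h' := congrArg κ h
    rw [hφ, hφ] at h'
    obtain ⟨h1, h2⟩ := eq_and_eq_of_add_smul_eq hn p.2.2.1 q.2.2.1 h'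
    exact Subtype.ext (Prod.ext h1 h2)
  have hlen : ∀ v, len v ≤ R → Bounded R v := by
    intro v hv
    simp only [len, Bounded] at hv ⊢
    omega
  have huR : len u ≤ R := by omega
  have hwR : len w ≤ R := by omega
  let px : P := ⟨(l, u), ⟨hl, rfl, rfl⟩, hlen u huR, hu⟩
  let py : P := ⟨(l, w), ⟨hl, rfl, rfl⟩, hlen w hwR, hw⟩
  have hcov : ∀ n z, Relation.ReflTransGen
      (fun a b => (∃ t, cs.IsReflection t ∧ b = t * a) ∧ cs.length a < cs.length b) (φ n px) z →
      Relation.ReflTransGen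
      (fun a b => (∃ t, cs.IsReflection t ∧ b = t * a) ∧ cs.length a < cs.length b) z (φ n py) →
      z ∈ Set.range (φ n) := by
    intro n z h1 h2
    have h1' : Relation.ReflTransGen Up (κ (φ n px)) (κ z) := h1.lift κ fun a b => (hκ.up_iff a b).1
    have h2' := len_le_of_reflTransGen (h2.lift κ fun a b => (hκ.up_iff a b).1)
    rw [hφ] at h1' h2'
    change Relation.ReflTransGen Up (u + (n : ℤ) • l) (κ z) at h1'
    change len (κ z) ≤ len (w + (n : ℤ) • l) at h2'
    have e1 := len_add_smul_of_nonneg hu0 hl0 n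
    have e2 := len_add_smul_of_nonneg hw0 hl0 n
    have hnear : Near l (len u + len w) n (u + (n : ℤ) • l) := by
      refine ⟨l, u, ⟨hl, rfl, rfl⟩, ?_, hu, rfl⟩
      simp only [len, Bounded]
      omega
    obtain ⟨v, u', hv, hb, ha, h⟩ := (hnear.reflTransGen h1' (L := len w) (by omega)).mono
      (R' := R) (by rw [hR]; gcongr; omega)
    exact ⟨⟨(v, u'), hv, hb, ha⟩, hκ.injective (by rw [hφ, h])⟩
  have key := exists_interval_equiv_of_parametrizations (hinj N hN) (hinj N' hN')
    (fun p q => by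
      rw [hκ.up_iff, hκ.up_iff, hφ, hφ, hφ, hφ]
      exact ⟨Up.change_scale hN hN' p.2.2.1 q.2.2.1 p.2.1 q.2.1,
        Up.change_scale hN' hN p.2.2.1 q.2.2.1 p.2.1 q.2.1⟩) (hcov N) (hcov N')
  rw [← hκ.injective ((hφ N px).trans hx.symm), ← hκ.injective ((hφ N py).trans hy.symm),
    ← hκ.injective ((hφ N' px).trans hx'.symm), ← hκ.injective ((hφ N' py).trans hy'.symm)]
  rw [IntervalIso, bruhatLE_eq_reflTransGen]
  exact key

end Coxeter

theorem center_add_weight (u : ℤ × ℤ × ℤ) (m n : ℤ) :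
    center u + ((m : ℝ) • fw1 + (n : ℝ) • fw2) = center (u + (m, n, m + n)) := by
  ext <;> simp [center, fw1, fw2] <;> ring

end Alcove

/-- stabilization of dominant Bruhat intervals in type `Ã₂`. -/
theorem statement16
    {W : Type*} [Group W] {M : CoxeterMatrix (Fin 3)} (cs : CoxeterSystem M W)
    (hM : ∀ i j : Fin 3, M i j = if i = j then 1 else 3)
    (act : W →* Equiv.Perm E2)
    (h0 : ∀ v, act (cs.simple 0) v = reflE rho2 (-1) v)
    (h1 : ∀ v, act (cs.simple 1) v = reflE a1 0 v)
    (h2 : ∀ v, act (cs.simple 2) v = reflE a2 0 v)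
    (hcen : Function.Injective (cen act))
    (th ths : ℕ → ℕ → W)
    (hth : ∀ m n : ℕ, cen act (th m n) =
      cen act (cs.simple 1 * cs.simple 2 * cs.simple 1) + (m : ℝ) • fw1 + (n : ℝ) • fw2)
    (hths : ∀ m n : ℕ, cen act (ths m n) =
      cen act 1 + ((m : ℝ) + 1) • fw1 + ((n : ℝ) + 1) • fw2)
    (Wadd : W → E2 → W)
    (hWadd : ∀ (z : W), ∀ v ∈ wLat, cen act (Wadd z v) = cen act z + v)
    (x y : W) (hx : x ∈ Dset th ths) (hy : y ∈ Dset th ths) (hxy : bruhatLE cs x y)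
    (lam : E2) (hlam : ∃ a b : ℕ, lam = (a : ℝ) • fw1 + (b : ℝ) • fw2) :
    ∃ N0 : ℕ, ∀ N : ℕ, N0 ≤ N →
      IntervalIso cs cs (Wadd x ((N0 : ℝ) • lam)) (Wadd y ((N0 : ℝ) • lam))
        (Wadd x ((N : ℝ) • lam)) (Wadd y ((N : ℝ) • lam)) := by
  obtain ⟨κ, hκ, hc⟩ := Alcove.exists_isAlcoveMap cs act
    (by intro i v; fin_cases i <;> simp [Alcove.root, Alcove.level, h0, h1, h2]) hcen
  have htrans : ∀ (z w : W) (m n : ℤ),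
      cen act w = cen act z + ((m : ℝ) • fw1 + (n : ℝ) • fw2) → κ w = κ z + (m, n, m + n) := by
    intro z w m n h
    refine Alcove.center_injOn (hκ.isAlcove _) ((hκ.isAlcove z).add rfl) ?_
    rw [← hc, h, hc, Alcove.center_add_weight]
  have hadd : ∀ (z : W) (m n : ℤ),
      κ (Wadd z ((m : ℝ) • fw1 + (n : ℝ) • fw2)) = κ z + (m, n, m + n) := fun z m n =>
    htrans _ _ _ _ (hWadd z _ ⟨m, n, rfl⟩)
  have hs1 : κ (cs.simple 1) = (1, 0, 0) := by
    rw [← mul_one (cs.simple 1), hκ.simple_mul, hκ.one]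
    rfl
  have hsurj : ∀ u, Alcove.IsAlcove u → ∃ z, κ z = u := by
    rintro ⟨a, b, c⟩ (h | h)
    · exact ⟨_, (hadd 1 a b).trans (by simp_all [hκ.one])⟩
    · refine ⟨_, (hadd (cs.simple 1) (a - 1) b).trans ?_⟩
      simp only at h
      rw [hs1, h]
      simp
      ring
  have hw0 : κ (cs.simple 1 * cs.simple 2 * cs.simple 1) = (1, 1, 1) := by
    rw [mul_assoc, hκ.simple_mul, hκ.simple_mul, hs1]
    rfl
  have hdom : ∀ z ∈ Dset th ths, 0 ≤ κ z := by
    rintro z (⟨m, n, rfl⟩ | ⟨m, n, rfl⟩)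
    · rw [htrans _ _ m n (by simpa [add_assoc] using hth m n), hw0]
      simp only [Prod.le_def, Prod.mk_add_mk, Prod.fst_zero, Prod.snd_zero]
      omega
    · rw [htrans _ _ (m + 1) (n + 1) (by simpa [add_assoc] using hths m n), hκ.one]
      simp only [Prod.le_def, zero_add, Prod.fst_zero, Prod.snd_zero]
      omega
  obtain ⟨a, b, rfl⟩ := hlam
  have hscale : ∀ (z : W) (N : ℕ), κ (Wadd z ((N : ℝ) • ((a : ℝ) • fw1 + (b : ℝ) • fw2))) =
      κ z + (N : ℤ) • ((a : ℤ), (b : ℤ), (a + b : ℤ)) := by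
    intro z N
    have h := hadd z (N * a) (N * b)
    rw [← mul_add] at h
    rw [smul_add, smul_smul, smul_smul]
    exact_mod_cast h
  refine ⟨4 * (Alcove.len (κ x) + Alcove.len (κ y) +
    (2 * Alcove.len (κ y) + 3) * Alcove.len (κ y)) + 1, fun N hN => ?_⟩
  refine hκ.intervalIso hsurj (hκ.isAlcove x) (hκ.isAlcove y) rfl (hdom x hx) (hdom y hy) ?_
    (Nat.lt_succ_self _) hN (hscale _ _) (hscale _ _) (hscale _ _) (hscale _ _)
  simp only [Prod.le_def, Prod.fst_zero, Prod.snd_zero]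
  omega
end
end
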